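/- Let ab be an edge of an even-hole-free graph G, and let (J,M) be optimal for ab. Then the set of all major vertices is a clique. -/

import Mathlib

open SimpleGraph

namespace EHF

variable {V : Type*} {W : Type*} {U : Type*}

/-- The closed neighbourhood `N[a]` of a vertex `a`. -/
def closedNbhd (G : SimpleGraph V) (a : V) : Set V := insert a (G.neighborSet a)

/-- A hole: an induced cycle of length at least four. -/
def IsHole (G : SimpleGraph V) {v : V} (c : G.Walk v v) : Prop :=
  c.IsCycle ∧ 4 ≤ c.length ∧
    ∀ x y : V, x ∈ c.support → y ∈ c.support → G.Adj x y → s(x, y) ∈ c.edges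

/-- A graph is even-hole-free if it has no hole with an even number of vertices. -/
def EvenHoleFree (G : SimpleGraph V) : Prop :=
  ∀ (v : V) (c : G.Walk v v), IsHole G c → ¬ Even c.length

/-- A vertex is bisimplicial if its neighbourhood is the union of two cliques. -/
def Bisimplicial (G : SimpleGraph V) (v : V) : Prop :=
  ∃ K₁ K₂ : Set V, G.IsClique K₁ ∧ G.IsClique K₂ ∧ G.neighborSet v = K₁ ∪ K₂

/-- `F` induces a connected subgraph of `G`. -/
def ConnectedSubset (G : SimpleGraph V) (F : Set V) : Prop :=
  F.Nonempty ∧ ∀ x ∈ F, ∀ y ∈ F, ∃ p : G.Walk x y, ∀ z ∈ p.support, z ∈ F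

/-- `F` is the vertex set of a connected component of `G` minus the vertex set `S`. -/
def IsComponentOf (G : SimpleGraph V) (S F : Set V) : Prop :=
  ConnectedSubset G F ∧ Disjoint F S ∧
    ∀ x ∈ F, ∀ y : V, y ∉ S → G.Adj x y → y ∈ F

/-- The set of vertices of `S` having a neighbour in `F`. -/
def Att (G : SimpleGraph V) (S F : Set V) : Set V :=
  {v ∈ S | ∃ x ∈ F, G.Adj v x}

/-- A cutset: the rest of the graph is the union of two nonempty sets that are
anticomplete to each other. -/
def IsCutset (G : SimpleGraph V) (C : Set V) : Prop :=
  ∃ X Y : Set V, X.Nonempty ∧ Y.Nonempty ∧ Disjoint X Y ∧ X ∪ Y = Cᶜ ∧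
    ∀ x ∈ X, ∀ y ∈ Y, ¬ G.Adj x y

/-- `G` has a full star cutset with centre `v`. -/
def FullStarCutset (G : SimpleGraph V) (v : V) : Prop :=
  IsCutset G (closedNbhd G v)

/-- A walk is induced if every edge of `G` between vertices of the walk is an
edge of the walk. -/
def InducedWalk (G : SimpleGraph V) {x y : V} (P : G.Walk x y) : Prop :=
  ∀ u v : V, u ∈ P.support → v ∈ P.support → G.Adj u v → s(u, v) ∈ P.edges

/-- A theta with ends `u,w` and constituent paths `P₁,P₂,P₃`, as an induced
subgraph of `G`. -/
def IsThetaIn (G : SimpleGraph V) (u w : V) (P₁ P₂ P₃ : G.Walk u w) : Prop :=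
  u ≠ w ∧ P₁.IsPath ∧ P₂.IsPath ∧ P₃.IsPath ∧
  2 ≤ P₁.length ∧ 2 ≤ P₂.length ∧ 2 ≤ P₃.length ∧
  (∀ v : V, v ∈ P₁.support → v ∈ P₂.support → v = u ∨ v = w) ∧
  (∀ v : V, v ∈ P₁.support → v ∈ P₃.support → v = u ∨ v = w) ∧
  (∀ v : V, v ∈ P₂.support → v ∈ P₃.support → v = u ∨ v = w) ∧
  (∀ x y : V, (x ∈ P₁.support ∨ x ∈ P₂.support ∨ x ∈ P₃.support) →
    (y ∈ P₁.support ∨ y ∈ P₂.support ∨ y ∈ P₃.support) → G.Adj x y →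
    s(x, y) ∈ P₁.edges ∨ s(x, y) ∈ P₂.edges ∨ s(x, y) ∈ P₃.edges)

/-- A near-prism with bases `{a₁,a₂,a₃}`, `{b₁,b₂,b₃}` and constituent paths
`R₁,R₂,R₃`, as an induced subgraph of `G`. -/
def IsNearPrismIn (G : SimpleGraph V) (a₁ a₂ a₃ b₁ b₂ b₃ : V)
    (R₁ : G.Walk a₁ b₁) (R₂ : G.Walk a₂ b₂) (R₃ : G.Walk a₃ b₃) : Prop :=
  G.Adj a₁ a₂ ∧ G.Adj a₁ a₃ ∧ G.Adj a₂ a₃ ∧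
  G.Adj b₁ b₂ ∧ G.Adj b₁ b₃ ∧ G.Adj b₂ b₃ ∧
  (({a₁, a₂, a₃} : Set V) ∩ ({b₁, b₂, b₃} : Set V) = ({a₃} : Set V) ∩ ({b₃} : Set V)) ∧
  R₁.IsPath ∧ R₂.IsPath ∧ R₃.IsPath ∧
  (∀ v : V, v ∈ R₁.support → v ∉ R₂.support) ∧
  (∀ v : V, v ∈ R₁.support → v ∉ R₃.support) ∧
  (∀ v : V, v ∈ R₂.support → v ∉ R₃.support) ∧
  (∀ p q : V, (p ∈ R₁.support ∨ p ∈ R₂.support ∨ p ∈ R₃.support) →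
    (q ∈ R₁.support ∨ q ∈ R₂.support ∨ q ∈ R₃.support) → G.Adj p q →
    s(p, q) ∈ R₁.edges ∨ s(p, q) ∈ R₂.edges ∨ s(p, q) ∈ R₃.edges ∨
    s(p, q) = s(a₁, a₂) ∨ s(p, q) = s(a₁, a₃) ∨ s(p, q) = s(a₂, a₃) ∨
    s(p, q) = s(b₁, b₂) ∨ s(p, q) = s(b₁, b₃) ∨ s(p, q) = s(b₂, b₃))

/-- An extended near-prism contained in `G`, with cross-edge `xy` where
`x` lies in the interior of `R₁` and `y` in the interior of `R₂`. -/
def IsExtNearPrismIn (G : SimpleGraph V) (a₁ a₂ a₃ b₁ b₂ b₃ : V)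
    (R₁ : G.Walk a₁ b₁) (R₂ : G.Walk a₂ b₂) (R₃ : G.Walk a₃ b₃) (x y : V) : Prop :=
  G.Adj a₁ a₂ ∧ G.Adj a₁ a₃ ∧ G.Adj a₂ a₃ ∧
  G.Adj b₁ b₂ ∧ G.Adj b₁ b₃ ∧ G.Adj b₂ b₃ ∧
  (({a₁, a₂, a₃} : Set V) ∩ ({b₁, b₂, b₃} : Set V) = ({a₃} : Set V) ∩ ({b₃} : Set V)) ∧
  R₁.IsPath ∧ R₂.IsPath ∧ R₃.IsPath ∧
  (∀ v : V, v ∈ R₁.support → v ∉ R₂.support) ∧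
  (∀ v : V, v ∈ R₁.support → v ∉ R₃.support) ∧
  (∀ v : V, v ∈ R₂.support → v ∉ R₃.support) ∧
  x ∈ R₁.support ∧ x ≠ a₁ ∧ x ≠ b₁ ∧
  y ∈ R₂.support ∧ y ≠ a₂ ∧ y ≠ b₂ ∧
  G.Adj x y ∧
  (∀ p q : V, (p ∈ R₁.support ∨ p ∈ R₂.support ∨ p ∈ R₃.support) →
    (q ∈ R₁.support ∨ q ∈ R₂.support ∨ q ∈ R₃.support) → G.Adj p q →
    s(p, q) ∈ R₁.edges ∨ s(p, q) ∈ R₂.edges ∨ s(p, q) ∈ R₃.edges ∨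
    s(p, q) = s(a₁, a₂) ∨ s(p, q) = s(a₁, a₃) ∨ s(p, q) = s(a₂, a₃) ∨
    s(p, q) = s(b₁, b₂) ∨ s(p, q) = s(b₁, b₃) ∨ s(p, q) = s(b₂, b₃) ∨
    s(p, q) = s(x, y))

/-- There is an extended near-prism contained in `G` such that `a` is an end of
its cross-edge. -/
def ExtNearPrismCrossEnd (G : SimpleGraph V) (a : V) : Prop :=
  ∃ (a₁ a₂ a₃ b₁ b₂ b₃ : V) (R₁ : G.Walk a₁ b₁) (R₂ : G.Walk a₂ b₂)
    (R₃ : G.Walk a₃ b₃) (y : V),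
    IsExtNearPrismIn G a₁ a₂ a₃ b₁ b₂ b₃ R₁ R₂ R₃ a y ∨
    IsExtNearPrismIn G a₁ a₂ a₃ b₁ b₂ b₃ R₁ R₂ R₃ y a

/-- `G` contains an even wheel (as an induced subgraph). -/
def HasEvenWheel (G : SimpleGraph V) : Prop :=
  ∃ (u : V) (c : G.Walk u u) (v : V), IsHole G c ∧ v ∉ c.support ∧
    3 ≤ {x : V | x ∈ c.support ∧ G.Adj v x}.ncard ∧
    ({x : V | x ∈ c.support ∧ G.Adj v x}.ncard = 3 →
      ∀ x y : V, x ∈ c.support → y ∈ c.support → G.Adj v x → G.Adj v y → ¬ G.Adj x y) ∧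
    Even {x : V | x ∈ c.support ∧ G.Adj v x}.ncard

/-- A pyramid with apex `a`, base `{b₁,b₂,b₃}` and constituent paths
`R₁,R₂,R₃`, as an induced subgraph of `G`. -/
def IsPyramidIn (G : SimpleGraph V) (a b₁ b₂ b₃ : V)
    (R₁ : G.Walk a b₁) (R₂ : G.Walk a b₂) (R₃ : G.Walk a b₃) : Prop :=
  G.Adj b₁ b₂ ∧ G.Adj b₁ b₃ ∧ G.Adj b₂ b₃ ∧
  a ≠ b₁ ∧ a ≠ b₂ ∧ a ≠ b₃ ∧
  R₁.IsPath ∧ R₂.IsPath ∧ R₃.IsPath ∧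
  (∀ v : V, v ∈ R₁.support → v ∈ R₂.support → v = a) ∧
  (∀ v : V, v ∈ R₁.support → v ∈ R₃.support → v = a) ∧
  (∀ v : V, v ∈ R₂.support → v ∈ R₃.support → v = a) ∧
  ((2 ≤ R₁.length ∧ 2 ≤ R₂.length) ∨ (2 ≤ R₁.length ∧ 2 ≤ R₃.length) ∨
    (2 ≤ R₂.length ∧ 2 ≤ R₃.length)) ∧
  (∀ p q : V, (p ∈ R₁.support ∨ p ∈ R₂.support ∨ p ∈ R₃.support) →
    (q ∈ R₁.support ∨ q ∈ R₂.support ∨ q ∈ R₃.support) → G.Adj p q →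
    s(p, q) ∈ R₁.edges ∨ s(p, q) ∈ R₂.edges ∨ s(p, q) ∈ R₃.edges ∨
    s(p, q) = s(b₁, b₂) ∨ s(p, q) = s(b₁, b₃) ∨ s(p, q) = s(b₂, b₃))

/-- A vertex `a` is splendid: `V(G)\N[a]` is connected, every neighbour of `a`
has a neighbour in `V(G)\N[a]`, and there is no short pyramid with apex `a`. -/
def Splendid (G : SimpleGraph V) (a : V) : Prop :=
  ConnectedSubset G ((closedNbhd G a)ᶜ) ∧
  (∀ v : V, G.Adj a v → ∃ w : V, w ∉ closedNbhd G a ∧ G.Adj v w) ∧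
  ¬ ∃ (b₁ b₂ b₃ : V) (R₁ : G.Walk a b₁) (R₂ : G.Walk a b₂) (R₃ : G.Walk a b₃),
      IsPyramidIn G a b₁ b₂ b₃ R₁ R₂ R₃ ∧
      (R₁.length = 1 ∨ R₂.length = 1 ∨ R₃.length = 1)

/-- A rung of the strip `(A,B,C)`. -/
def IsRung (G : SimpleGraph V) (A B C : Set V) {x y : V} (P : G.Walk x y) : Prop :=
  P.IsPath ∧ x ∈ A ∧ y ∈ B ∧
  (∀ v ∈ P.support, v ≠ x → v ≠ y → v ∈ C) ∧
  (x ≠ y → x ∉ B ∧ y ∉ A) ∧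
  InducedWalk G P

/-- A strip `(A,B,C)`: `A,B` nonempty and disjoint from `C`, and every vertex of
`A∪B∪C` lies on a rung. -/
def IsStrip (G : SimpleGraph V) (A B C : Set V) : Prop :=
  A.Nonempty ∧ B.Nonempty ∧ Disjoint A C ∧ Disjoint B C ∧
  ∀ v ∈ A ∪ B ∪ C, ∃ (x y : V) (P : G.Walk x y), IsRung G A B C P ∧ v ∈ P.support

/-- A `J`-strip system in `G`. -/
structure StripSystem (G : SimpleGraph V) (J : SimpleGraph W) where
  ME : W → W → Set V
  MV : W → Set V
  me_symm : ∀ u v : W, ME u v = ME v u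
  me_disj : ∀ u v w x : W, J.Adj u v → J.Adj w x → s(u, v) ≠ s(w, x) →
    Disjoint (ME u v) (ME w x)
  mv_sub : ∀ u : W, MV u ⊆ ⋃ (v : W), ⋃ (_ : J.Adj u v), ME u v
  strip : ∀ u v : W, J.Adj u v →
    IsStrip G (ME u v ∩ MV u) (ME u v ∩ MV v) (ME u v \ (MV u ∪ MV v))
  far : ∀ u v w x : W, J.Adj u v → J.Adj w x → u ≠ w → u ≠ x → v ≠ w → v ≠ x →
    ∀ p ∈ ME u v, ∀ q ∈ ME w x, ¬ G.Adj p q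
  near : ∀ u v w : W, J.Adj u v → J.Adj u w → v ≠ w →
    ∀ p ∈ ME u v, ∀ q ∈ ME u w, (G.Adj p q ↔ p ∈ MV u ∧ q ∈ MV u)

/-- `V(M)`: the union of the sets `M_e` over the edges of `J`. -/
def VM {G : SimpleGraph V} {J : SimpleGraph W} (S : StripSystem G J) : Set V :=
  ⋃ (u : W), ⋃ (v : W), ⋃ (_ : J.Adj u v), S.ME u v

/-- A leaf of a graph: a vertex of degree exactly one. -/
def IsLeaf (J : SimpleGraph W) (u : W) : Prop := (J.neighborSet u).ncard = 1

/-- `ab` is a cross-edge for the strip system `S` with partition `(α,β)` of the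
leaves of `J`. -/
def IsCrossEdge {G : SimpleGraph V} {J : SimpleGraph W} (S : StripSystem G J)
    (a b : V) (α β : Set W) : Prop :=
  G.Adj a b ∧
  α ∪ β = {u : W | IsLeaf J u} ∧ Disjoint α β ∧
  (∀ u : W, (J.neighborSet u).ncard ≠ 2) ∧
  3 ≤ Nat.card W ∧
  (∀ u u₁ u₂ : W, u₁ ∈ α → u₂ ∈ α → J.Adj u u₁ → J.Adj u u₂ → u₁ = u₂) ∧
  (∀ u u₁ u₂ : W, u₁ ∈ β → u₂ ∈ β → J.Adj u u₁ → J.Adj u u₂ → u₁ = u₂) ∧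
  (∀ u v : W, J.Adj u v → a ∉ S.ME u v ∧ b ∉ S.ME u v) ∧
  (∀ x ∈ VM S, (G.Adj a x ↔ ∃ u ∈ α, x ∈ S.MV u)) ∧
  (∀ x ∈ VM S, (G.Adj b x ↔ ∃ u ∈ β, x ∈ S.MV u))

/-- A local subset of `V(M)∪{a,b}`. -/
def IsLocal {G : SimpleGraph V} {J : SimpleGraph W} (S : StripSystem G J)
    (a b : V) (α β : Set W) (X : Set V) : Prop :=
  (∃ u v : W, J.Adj u v ∧ X ⊆ S.ME u v) ∨
  (∃ u : W, X ⊆ S.MV u) ∨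
  (a ∈ X ∧ b ∉ X ∧ ∃ u ∈ α, X \ {a} ⊆ S.MV u) ∨
  (b ∈ X ∧ a ∉ X ∧ ∃ u ∈ β, X \ {b} ⊆ S.MV u)

/-- A branch-vertex of a tree: a vertex of degree different from two. -/
def BranchVertex (T : SimpleGraph U) (u : U) : Prop := (T.neighborSet u).ncard ≠ 2

/-- `u` and `v` are distinct branch-vertices joined by a branch of `T`. -/
def JoinedByBranch (T : SimpleGraph U) (u v : U) : Prop :=
  u ≠ v ∧ BranchVertex T u ∧ BranchVertex T v ∧
    ∃ p : T.Walk u v, p.IsPath ∧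
      ∀ w ∈ p.support, w ≠ u → w ≠ v → (T.neighborSet w).ncard = 2

/-- The shape of a tree `T`: the graph on its branch-vertices, two being
adjacent when joined by a branch. -/
def Shape (T : SimpleGraph U) : SimpleGraph {u : U // BranchVertex T u} :=
  SimpleGraph.fromRel (fun u v => JoinedByBranch T u.1 v.1)

/-- `y` is reachable from `x` in `T` by a walk avoiding `v`. -/
def ReachAvoiding (T : SimpleGraph U) (v x y : U) : Prop :=
  ∃ p : T.Walk x y, v ∉ p.support

/-- The component of `x` in `T` minus `v` contains no vertex of `A`. -/
def MissesSet (T : SimpleGraph U) (v : U) (A : Set U) (x : U) : Prop :=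
  ∀ z : U, ReachAvoiding T v x z → z ∉ A

/-- `G` contains an induced extended tree line-graph `H(T)` with cross-edge
`ab`, via the injection `φ` of the edges of `T` into `V(G)`, where `(A',B')`
is the bipartition of the tree `T`. -/
def ExtTreeLineGraphIn (G : SimpleGraph V) (T : SimpleGraph U)
    (A' B' : Set U) (a b : V) (φ : Sym2 U → V) : Prop :=
  T.IsTree ∧
  A' ∪ B' = Set.univ ∧ Disjoint A' B' ∧
  (∀ u v : U, T.Adj u v → (u ∈ A' ↔ v ∈ B')) ∧
  3 ≤ {u : U | IsLeaf T u}.ncard ∧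
  (∀ v x y : U, x ≠ v → y ≠ v → MissesSet T v A' x → MissesSet T v A' y →
    ReachAvoiding T v x y) ∧
  (∀ v x y : U, x ≠ v → y ≠ v → MissesSet T v B' x → MissesSet T v B' y →
    ReachAvoiding T v x y) ∧
  G.Adj a b ∧
  Set.InjOn φ T.edgeSet ∧
  (∀ e ∈ T.edgeSet, φ e ≠ a ∧ φ e ≠ b) ∧
  (∀ e ∈ T.edgeSet, ∀ f ∈ T.edgeSet, e ≠ f →
    (G.Adj (φ e) (φ f) ↔ ∃ u : U, u ∈ e ∧ u ∈ f)) ∧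
  (∀ e ∈ T.edgeSet, (G.Adj a (φ e) ↔ ∃ u : U, u ∈ e ∧ IsLeaf T u ∧ u ∈ A')) ∧
  (∀ e ∈ T.edgeSet, (G.Adj b (φ e) ↔ ∃ u : U, u ∈ e ∧ IsLeaf T u ∧ u ∈ B'))

/-- `(J, M)` is optimal for the edge `ab`: `G` contains an induced extended tree
line-graph with cross-edge `ab`; among all such, the shape `J` has as many edges
as possible; and the `J`-strip system `S` has cross-edge `ab` with partition
`(α,β)` and `V(M)` maximal. -/
def OptimalFor {G : SimpleGraph V} {J : SimpleGraph W} (S : StripSystem G J)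
    (a b : V) (α β : Set W) : Prop :=
  (∃ (n : ℕ) (T : SimpleGraph (Fin n)) (A' B' : Set (Fin n)) (φ : Sym2 (Fin n) → V),
      ExtTreeLineGraphIn G T A' B' a b φ ∧ Nonempty (J ≃g Shape T)) ∧
  (∀ (n : ℕ) (T : SimpleGraph (Fin n)) (A' B' : Set (Fin n)) (φ : Sym2 (Fin n) → V),
      ExtTreeLineGraphIn G T A' B' a b φ →
      (Shape T).edgeSet.ncard ≤ J.edgeSet.ncard) ∧
  IsCrossEdge S a b α β ∧
  (∀ (S' : StripSystem G J) (α' β' : Set W), IsCrossEdge S' a b α' β' →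
      VM S ⊆ VM S' → VM S' = VM S)

/-- There is a path from `y` to `VMset \ N[a]` containing no neighbours of `a`
except `y`. -/
def ExternalFrom (G : SimpleGraph V) (VMset : Set V) (a y : V) : Prop :=
  ∃ (z : V) (P : G.Walk y z), P.IsPath ∧ z ∈ VMset ∧ z ∉ closedNbhd G a ∧
    ∀ v ∈ P.support, G.Adj a v → v = y

/-- A major vertex: a common neighbour of `a,b` that is both `a`-external and
`b`-external. -/
def MajorVertex {G : SimpleGraph V} {J : SimpleGraph W} (S : StripSystem G J)
    (a b : V) (y : V) : Prop :=
  G.Adj a y ∧ G.Adj b y ∧ ExternalFrom G (VM S) a y ∧ ExternalFrom G (VM S) b y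

/-- The vertex set of a pyramid strip system. -/
def PSSVerts (a : V) {k : ℕ} (A B C : Fin k → Set V) : Set V :=
  insert a (⋃ i, A i ∪ B i ∪ C i)

/-- A pyramid strip system with apex `a` and proper strips `(A i, B i, C i)`. -/
def IsPyramidStripSystem (G : SimpleGraph V) (a : V) {k : ℕ}
    (A B C : Fin k → Set V) : Prop :=
  3 ≤ k ∧
  (∀ i, IsStrip G (A i) (B i) (C i)) ∧
  (∀ i, Disjoint (A i) (B i)) ∧
  (∀ i j, i ≠ j → Disjoint (A i ∪ B i ∪ C i) (A j ∪ B j ∪ C j)) ∧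
  (∀ i j, i ≠ j → ∀ p ∈ A i ∪ B i ∪ C i, ∀ q ∈ A j ∪ B j ∪ C j,
      (G.Adj p q ↔ p ∈ B i ∧ q ∈ B j)) ∧
  (∀ i, a ∉ A i ∪ B i ∪ C i) ∧
  (∀ i, ∀ p ∈ A i ∪ B i ∪ C i, (G.Adj a p ↔ p ∈ A i))

/-- `D i`: the union of the vertex sets of all components `F` of
`G \ (V(𝒮) ∪ N[a])` having a neighbour in `A i ∪ C i`. -/
def PSSD (G : SimpleGraph V) (a : V) {k : ℕ} (A B C : Fin k → Set V)
    (i : Fin k) : Set V :=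
  ⋃₀ {F : Set V | IsComponentOf G (PSSVerts a A B C ∪ closedNbhd G a) F ∧
      ∃ v ∈ A i ∪ C i, ∃ x ∈ F, G.Adj v x}

def TypeAlpha (G : SimpleGraph V) {k : ℕ} (A B C : Fin k → Set V) (v : V) : Prop :=
  ∀ i : Fin k, (∃ p ∈ B i ∪ C i, G.Adj v p) ∨ ∀ p ∈ A i, G.Adj v p

def TypeAlpha' (G : SimpleGraph V) (a : V) {k : ℕ} (A B C : Fin k → Set V)
    (v : V) : Prop :=
  ∃ i : Fin k, (∃ x ∈ PSSD G a A B C i, G.Adj v x) ∧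
    (∀ p ∈ B i ∪ C i, ¬ G.Adj v p) ∧
    ∀ j : Fin k, j ≠ i →
      (∀ p ∈ A j, G.Adj v p) ∧ ∀ p ∈ B j ∪ C j ∪ PSSD G a A B C j, ¬ G.Adj v p

def TypeBeta (G : SimpleGraph V) {k : ℕ} (A B C : Fin k → Set V) (v : V) : Prop :=
  ∃ i : Fin k, (∀ p ∈ A i ∪ B i ∪ C i, ¬ G.Adj v p) ∧
    ∀ j : Fin k, j ≠ i → ∃ p ∈ B j ∪ C j, G.Adj v p

def TypeGamma (G : SimpleGraph V) (a : V) {k : ℕ} (A B C : Fin k → Set V)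
    (v : V) : Prop :=
  ∃ (i : Fin k) (q : V) (Q : G.Walk v q), Q.IsPath ∧ InducedWalk G Q ∧
    (∀ w ∈ Q.support, w ≠ v → w ∉ PSSVerts a A B C ∪ closedNbhd G a) ∧
    (∃ p ∈ ⋃ j, B j, G.Adj q p) ∧
    ((∀ p ∈ (⋃ j, B j) \ B i, G.Adj q p) ∨ ∀ p ∈ (⋃ j, B j) \ B i, ¬ G.Adj q p) ∧
    (∀ j : Fin k, j ≠ i → ∀ p ∈ A j, G.Adj v p) ∧
    (∀ j : Fin k, ∀ p ∈ B j ∪ C j ∪ PSSD G a A B C j, ¬ G.Adj v p) ∧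
    ∀ w ∈ Q.support, w ≠ v → ∀ p ∈ PSSVerts a A B C, G.Adj w p →
      w = q ∧ p ∈ ⋃ j, B j

/-- A backdoor for `z`, relative to the strip `(A,B,C)` and the set `D`. -/
def Backdoor (G : SimpleGraph V) (A B C D : Set V) (z : V) : Prop :=
  ∃ (b' : V) (R : G.Walk z b'), R.IsPath ∧ InducedWalk G R ∧
    (∀ w ∈ R.support, w ≠ z → w ≠ b' → ∀ p ∈ (A ∪ B ∪ C) ∪ D, ¬ G.Adj w p) ∧
    (∀ p ∈ B, G.Adj b' p) ∧ ∀ p ∈ A ∪ C ∪ D, ¬ G.Adj b' p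

/-- `p 0, …, p n` is an induced path. -/
def IP (G : SimpleGraph V) (p : ℕ → V) (n : ℕ) : Prop :=
  ∀ i j, i ≤ n → j ≤ n → (p i = p j → i = j) ∧ (G.Adj (p i) (p j) ↔ i + 1 = j ∨ j + 1 = i)

/-- There is an induced path of length `n` from `x` to `y` with interior in `F`. -/
def PathIn (G : SimpleGraph V) (F : Set V) (x y : V) (n : ℕ) : Prop :=
  ∃ p : ℕ → V, IP G p n ∧ p 0 = x ∧ p n = y ∧ ∀ i, 0 < i → i < n → p i ∈ F

/-- The sets `X` and `Y` are disjoint and anticomplete. -/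
def Anti (G : SimpleGraph V) (X Y : Set V) : Prop :=
  ∀ x ∈ X, ∀ y ∈ Y, x ≠ y ∧ ¬ G.Adj x y

theorem Anti.symm {G : SimpleGraph V} {X Y : Set V} (h : Anti G X Y) : Anti G Y X :=
  fun y hy x hx => ⟨(h x hx y hy).1.symm, fun e => (h x hx y hy).2 e.symm⟩

theorem Anti.mono {G : SimpleGraph V} {X Y X' Y' : Set V} (h : Anti G X Y) (hX : X' ⊆ X)
    (hY : Y' ⊆ Y) : Anti G X' Y' :=
  fun x hx y hy => h x (hX hx) y (hY hy)

theorem IP.rev {G : SimpleGraph V} {p : ℕ → V} {n : ℕ} (h : IP G p n) :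
    IP G (fun i => p (n - i)) n := by
  intro i j hi hj
  have := h (n - i) (n - j) (by omega) (by omega)
  refine ⟨fun e => ?_, ?_⟩
  · have := this.1 e
    omega
  · rw [this.2]
    omega

theorem IP.sub {G : SimpleGraph V} {p : ℕ → V} {n : ℕ} (h : IP G p n) {i k : ℕ}
    (hi : i + k ≤ n) : IP G (fun t => p (i + t)) k := by
  intro s t hs ht
  have := h (i + s) (i + t) (by omega) (by omega)
  refine ⟨fun e => ?_, ?_⟩
  · have := this.1 e
    omega
  · rw [this.2]
    omega

theorem IP.adj {G : SimpleGraph V} {p : ℕ → V} {n : ℕ} (h : IP G p n) {i : ℕ} (hi : i < n) :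
    G.Adj (p i) (p (i + 1)) :=
  (h i (i + 1) hi.le hi).2.2 (Or.inl rfl)

theorem IP.ne {G : SimpleGraph V} {p : ℕ → V} {n : ℕ} (h : IP G p n) {i j : ℕ} (hi : i ≤ n)
    (hj : j ≤ n) (hij : i ≠ j) : p i ≠ p j :=
  fun e => hij ((h i j hi hj).1 e)

theorem IP.not_adj {G : SimpleGraph V} {p : ℕ → V} {n : ℕ} (h : IP G p n) {i j : ℕ} (hi : i ≤ n)
    (hj : j ≤ n) (hij : i + 1 < j) : ¬ G.Adj (p i) (p j) := by
  rw [(h i j hi hj).2]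
  omega

/-- Appending a vertex to an induced path. -/
theorem IP.snoc {G : SimpleGraph V} {p : ℕ → V} {n : ℕ} (h : IP G p n) {y : V}
    (hy : G.Adj (p n) y) (hn : ∀ i < n, p i ≠ y ∧ ¬ G.Adj (p i) y) :
    IP G (fun i => if i ≤ n then p i else y) (n + 1) := by
  intro i j hi hj
  rcases Nat.lt_or_ge n i with h1 | h1 <;> rcases Nat.lt_or_ge n j with h2 | h2
  · simp [not_le.2 h1, not_le.2 h2]; omega
  · simp only [not_le.2 h1, if_false, h2, if_true]
    rcases Nat.lt_or_ge j n with h3 | h3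
    · have := hn j h3
      refine ⟨fun e => absurd e.symm this.1, ⟨fun e => absurd e.symm this.2, fun e => by omega⟩⟩
    · obtain rfl : j = n := by omega
      exact ⟨fun e => absurd (e ▸ hy) (G.irrefl), ⟨fun _ => by omega, fun _ => hy.symm⟩⟩
  · simp only [not_le.2 h2, if_false, h1, if_true]
    rcases Nat.lt_or_ge i n with h3 | h3
    · have := hn i h3
      refine ⟨fun e => absurd e this.1, ⟨fun e => absurd e this.2, fun e => by omega⟩⟩
    · obtain rfl : i = n := by omega
      exact ⟨fun e => absurd (e ▸ hy) (G.irrefl), ⟨fun _ => by omega, fun _ => hy⟩⟩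
  · simp only [h1, h2, if_true]
    exact h i j h1 h2

theorem PathIn.symm {G : SimpleGraph V} {F : Set V} {x y : V} {n : ℕ} (h : PathIn G F x y n) :
    PathIn G F y x n := by
  obtain ⟨p, h1, h2, h3, h4⟩ := h
  refine ⟨_, h1.rev, by simpa using h3, by simpa using h2, fun i hi hn => ?_⟩
  exact h4 _ (by omega) (by omega)

theorem PathIn.mono {G : SimpleGraph V} {F F' : Set V} {x y : V} {n : ℕ} (h : PathIn G F x y n)
    (hF : F ⊆ F') : PathIn G F' x y n := by
  obtain ⟨p, h1, h2, h3, h4⟩ := h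
  exact ⟨p, h1, h2, h3, fun i hi hn => hF (h4 i hi hn)⟩

theorem PathIn.one {G : SimpleGraph V} {x y : V} (h : G.Adj x y) : PathIn G ∅ x y 1 := by
  refine ⟨fun i => if i = 0 then x else y, ?_, by simp, by simp, fun i hi hn => by omega⟩
  intro i j hi hj
  interval_cases i <;> interval_cases j <;> simp [h, h.symm, h.ne, h.ne']

theorem PathIn.sub {G : SimpleGraph V} {p : ℕ → V} {n : ℕ} (h : IP G p n) {i j : ℕ}
    (hij : i ≤ j) (hj : j ≤ n) : PathIn G {v | ∃ t, i < t ∧ t < j ∧ v = p t} (p i) (p j) (j - i) := by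
  refine ⟨fun t => p (i + t), h.sub (by omega), by simp, by simp [show i + (j - i) = j by omega], ?_⟩
  intro t h1 h2
  exact ⟨i + t, by omega, by omega, rfl⟩

theorem PathIn.of_ip {G : SimpleGraph V} {p : ℕ → V} {n : ℕ} (h : IP G p n) :
    PathIn G {v | ∃ t, 0 < t ∧ t < n ∧ v = p t} (p 0) (p n) n :=
  ⟨p, h, rfl, rfl, fun i h1 h2 => ⟨i, h1, h2, rfl⟩⟩

theorem PathIn.two_le {G : SimpleGraph V} {F : Set V} {x y : V} {n : ℕ} (h : PathIn G F x y n)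
    (h1 : x ≠ y) (h2 : ¬ G.Adj x y) : 2 ≤ n := by
  obtain ⟨p, hp, rfl, rfl, h4⟩ := h
  by_contra hn
  interval_cases n
  · exact h1 rfl
  · exact h2 (hp.adj (by omega))

theorem PathIn.one_le {G : SimpleGraph V} {F : Set V} {x y : V} {n : ℕ} (h : PathIn G F x y n)
    (h1 : x ≠ y) : 1 ≤ n := by
  obtain ⟨p, hp, rfl, rfl, h4⟩ := h
  by_contra hn
  interval_cases n
  exact h1 rfl

/-- Concatenation of two induced paths. -/
theorem PathIn.concat {G : SimpleGraph V} {F F' : Set V} {x y z : V} {n m : ℕ}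
    (h : PathIn G F x y n) (h' : PathIn G F' y z m) (hn : 1 ≤ n) (hm : 1 ≤ m)
    (ha : Anti G (insert x F) (insert z F')) : PathIn G (F ∪ F' ∪ {y}) x z (n + m) := by
  obtain ⟨p, h1, rfl, rfl, h4⟩ := h
  obtain ⟨q, k1, k2, rfl, k4⟩ := h'
  have hx : ∀ i < n, p i ∈ insert (p 0) F := by
    intro i hi
    rcases Nat.eq_zero_or_pos i with rfl | h
    · simp
    · exact Or.inr (h4 i h hi)
  have hz : ∀ i, 0 < i → i ≤ m → q i ∈ insert (q m) F' := by
    intro i h hi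
    rcases eq_or_ne i m with rfl | h'
    · simp
    · exact Or.inr (k4 i h (by omega))
  have key : ∀ i j, i ≤ n → n < j → j ≤ n + m →
      p i ≠ q (j - n) ∧ (G.Adj (p i) (q (j - n)) ↔ i + 1 = j) := by
    intro i j hi hj hjm
    rcases eq_or_ne i n with rfl | hin
    · rw [← k2]
      have := k1 0 (j - i) (by omega) (by omega)
      refine ⟨fun e => ?_, ?_⟩
      · have := this.1 e
        omega
      · rw [this.2]; omega
    · have := ha _ (hx i (by omega)) _ (hz (j - n) (by omega) (by omega))
      exact ⟨this.1, ⟨fun e => absurd e this.2, fun e => by omega⟩⟩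
  refine ⟨fun i => if i ≤ n then p i else q (i - n), ?_, by simp, ?_, ?_⟩
  · intro i j hi hj
    rcases Nat.lt_or_ge n i with g1 | g1 <;> rcases Nat.lt_or_ge n j with g2 | g2
    · simp only [not_le.2 g1, not_le.2 g2, if_false]
      have := k1 (i - n) (j - n) (by omega) (by omega)
      refine ⟨fun e => ?_, ?_⟩
      · have := this.1 e
        omega
      · rw [this.2]; omega
    · simp only [not_le.2 g1, g2, if_false, if_true]
      have := key j i g2 g1 hi
      refine ⟨fun e => absurd e.symm this.1, ?_⟩
      rw [G.adj_comm, this.2]; omega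
    · simp only [not_le.2 g2, g1, if_false, if_true]
      have := key i j g1 g2 hj
      refine ⟨fun e => absurd e this.1, ?_⟩
      rw [this.2]; omega
    · simp only [g1, g2, if_true]
      exact h1 i j g1 g2
  · simp [show ¬ (n + m ≤ n) by omega]
  · intro i hi hin
    rcases lt_trichotomy i n with h | rfl | h
    · simp only [h.le, if_true]
      exact Or.inl (Or.inl (h4 i hi h))
    · simp
    · simp only [not_le.2 h, if_false]
      exact Or.inl (Or.inr (k4 _ (by omega) (by omega)))

theorem PathIn.cons {G : SimpleGraph V} {F' : Set V} {x y z : V} {m : ℕ}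
    (h : G.Adj x y) (h' : PathIn G F' y z m) (hm : 1 ≤ m)
    (ha : Anti G {x} (insert z F')) : PathIn G (insert y F') x z (m + 1) := by
  have := (PathIn.one h).concat h' le_rfl hm (by simpa using ha)
  rw [add_comm]
  exact this.mono (by intro v hv; simpa [or_comm] using hv)

theorem PathIn.two {G : SimpleGraph V} {x y z : V} (h : G.Adj x y) (h' : G.Adj y z)
    (h1 : x ≠ z) (h2 : ¬ G.Adj x z) : PathIn G {y} x z 2 := by
  have := PathIn.cons h (PathIn.one h') le_rfl (by simp [Anti, h1, h2])
  simpa using this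

/-- A path walk along a function. -/
theorem exists_walk_of_fun (G : SimpleGraph V) (c : ℕ → V) (k : ℕ)
    (h : ∀ i < k, G.Adj (c i) (c (i + 1))) :
    ∃ w : G.Walk (c 0) (c k), w.length = k ∧ w.support = (List.range (k + 1)).map c ∧
      ∀ e, e ∈ w.edges ↔ ∃ i < k, e = s(c i, c (i + 1)) := by
  induction k with
  | zero => exact ⟨Walk.nil, rfl, by simp, by simp⟩
  | succ k ih =>
    obtain ⟨w, h1, h2, h3⟩ := ih (fun i hi => h i (by omega))
    refine ⟨w.concat (h k (by omega)), by simp [h1], ?_, ?_⟩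
    · rw [Walk.support_concat, h2, List.range_succ (n := k + 1)]
      simp
    · intro e
      rw [Walk.edges_concat]
      simp only [List.concat_eq_append, List.mem_append, List.mem_singleton, h3]
      constructor
      · rintro (⟨i, hi, rfl⟩ | rfl)
        · exact ⟨i, by omega, rfl⟩
        · exact ⟨k, by omega, rfl⟩
      · rintro ⟨i, hi, rfl⟩
        rcases Nat.lt_or_ge i k with h | h
        · exact Or.inl ⟨i, h, rfl⟩
        · obtain rfl : i = k := by omega
          exact Or.inr rfl

theorem odd_of_cyclic {G : SimpleGraph V} (hG : EvenHoleFree G) (c : ℕ → V) (k : ℕ) (hk : 3 ≤ k)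
    (hinj : ∀ i j, i ≤ k → j ≤ k → c i = c j → i = j)
    (hadj : ∀ i j, i < j → j ≤ k → (G.Adj (c i) (c j) ↔ i + 1 = j ∨ (i = 0 ∧ j = k))) :
    Odd (k + 1) := by
  obtain ⟨w, h1, h2, h3⟩ := exists_walk_of_fun G c k
    (fun i hi => (hadj i (i + 1) (by omega) (by omega)).2 (Or.inl rfl))
  have h0 : G.Adj (c k) (c 0) := ((hadj 0 k (by omega) le_rfl).2 (Or.inr ⟨rfl, rfl⟩)).symm
  have hmem : ∀ x ∈ w.support, ∃ i ≤ k, x = c i := by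
    intro x hx
    rw [h2] at hx
    obtain ⟨i, hi, rfl⟩ := List.mem_map.1 hx
    exact ⟨i, by simpa [Nat.lt_succ_iff] using hi, rfl⟩
  have hole : IsHole G (Walk.cons h0 w) := by
    refine ⟨?_, by simp [h1]; omega, ?_⟩
    · rw [Walk.cons_isCycle_iff]
      refine ⟨?_, ?_⟩
      · rw [Walk.isPath_def, h2]
        refine List.Nodup.map_on ?_ List.nodup_range
        intro i hi j hj e
        simp at hi hj
        exact hinj i j (by omega) (by omega) e
      · rw [h3]
        rintro ⟨i, hi, e⟩
        rw [Sym2.eq_iff] at e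
        rcases e with ⟨e1, e2⟩ | ⟨e1, e2⟩
        · have := hinj _ _ le_rfl (by omega) e1; omega
        · have := hinj _ _ le_rfl (by omega) e1
          have := hinj _ _ (by omega) (by omega) e2; omega
    · have main : ∀ i j, i ≤ k → j ≤ k → i < j → G.Adj (c i) (c j) →
          s(c i, c j) ∈ (Walk.cons h0 w).edges := by
        intro i j hi hj hij e
        rw [hadj i j hij hj] at e
        rw [Walk.edges_cons, List.mem_cons]
        rcases e with rfl | ⟨rfl, rfl⟩
        · exact Or.inr ((h3 _).2 ⟨i, by omega, rfl⟩)
        · exact Or.inl Sym2.eq_swap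
      have hm' : ∀ x ∈ (Walk.cons h0 w).support, ∃ i ≤ k, x = c i := by
        intro x hx
        rw [Walk.support_cons, List.mem_cons] at hx
        rcases hx with rfl | hx
        · exact ⟨k, le_rfl, rfl⟩
        · exact hmem x hx
      intro x y hx hy e
      obtain ⟨i, hi, rfl⟩ := hm' x hx
      obtain ⟨j, hj, rfl⟩ := hm' y hy
      rcases lt_trichotomy i j with h | rfl | h
      · exact main i j hi hj h e
      · exact absurd e G.irrefl
      · rw [Sym2.eq_swap]
        exact main j i hj hi h e.symm
  have := hG _ _ hole
  rw [Walk.length_cons, h1] at this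
  exact Nat.not_even_iff_odd.1 this

/-- Two induced paths of length at least two between the same ends, anticomplete to each other
apart from the ends, form a hole. -/
theorem PathIn.hole {G : SimpleGraph V} (hG : EvenHoleFree G) {F F' : Set V} {x y : V} {n m : ℕ}
    (h : PathIn G F x y n) (h' : PathIn G F' x y m) (hn : 2 ≤ n) (hm : 2 ≤ m)
    (ha : Anti G F F') : Odd (n + m) := by
  obtain ⟨p, h1, rfl, rfl, h4⟩ := h
  obtain ⟨q, k1, k2, k3, k4⟩ := h'
  have key : ∀ i j, i ≤ n → n < j → j < n + m →
      p i ≠ q (n + m - j) ∧ (G.Adj (p i) (q (n + m - j)) ↔ i + 1 = j ∨ (i = 0 ∧ j + 1 = n + m)) := by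
    intro i j hi hj hjm
    rcases Nat.eq_zero_or_pos i with rfl | hi0
    · rw [← k2]
      have := k1 0 (n + m - j) (by omega) (by omega)
      refine ⟨fun e => ?_, ?_⟩
      · have := this.1 e
        omega
      · rw [this.2]; omega
    rcases eq_or_ne i n with rfl | hin
    · rw [← k3]
      have := k1 m (i + m - j) (by omega) (by omega)
      refine ⟨fun e => ?_, ?_⟩
      · have := this.1 e
        omega
      · rw [this.2]; omega
    · have := ha _ (h4 i hi0 (by omega)) _ (k4 (n + m - j) (by omega) (by omega))
      exact ⟨this.1, ⟨fun e => absurd e this.2, fun e => by omega⟩⟩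
  have := odd_of_cyclic hG (fun i => if i ≤ n then p i else q (n + m - i)) (n + m - 1) (by omega)
    ?_ ?_
  · rwa [show n + m - 1 + 1 = n + m by omega] at this
  · intro i j hi hj e
    rcases Nat.lt_or_ge n i with g1 | g1 <;> rcases Nat.lt_or_ge n j with g2 | g2
    · simp only [not_le.2 g1, not_le.2 g2, if_false] at e
      have := (k1 _ _ (by omega) (by omega)).1 e
      omega
    · simp only [not_le.2 g1, g2, if_false, if_true] at e
      exact absurd e.symm (key j i g2 g1 (by omega)).1
    · simp only [not_le.2 g2, g1, if_false, if_true] at e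
      exact absurd e (key i j g1 g2 (by omega)).1
    · simp only [g1, g2, if_true] at e
      exact (h1 _ _ g1 g2).1 e
  · intro i j hij hj
    rcases Nat.lt_or_ge n i with g1 | g1 <;> rcases Nat.lt_or_ge n j with g2 | g2
    · simp only [not_le.2 g1, not_le.2 g2, if_false]
      rw [(k1 _ _ (by omega) (by omega)).2]
      omega
    · omega
    · simp only [not_le.2 g2, g1, if_false, if_true]
      rw [(key i j g1 g2 (by omega)).2]
      omega
    · simp only [g1, g2, if_true]
      rw [(h1 _ _ g1 g2).2]
      omega

theorem no_c4 {G : SimpleGraph V} (hG : EvenHoleFree G) {x p y q : V} (h1 : G.Adj x p)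
    (h2 : G.Adj p y) (h3 : G.Adj y q) (h4 : G.Adj q x) (hxy : x ≠ y) (hpq : p ≠ q)
    (nxy : ¬ G.Adj x y) (npq : ¬ G.Adj p q) : False := by
  have := PathIn.hole hG (PathIn.two h1 h2 hxy nxy) (PathIn.two h4.symm h3.symm hxy nxy) le_rfl
    le_rfl (by simp [Anti, hpq, npq])
  exact absurd this (by decide)

/-- `F` is connected. -/
def Conn (G : SimpleGraph V) (F : Set V) : Prop :=
  ∀ X ⊆ F, X.Nonempty → (∀ x ∈ X, ∀ z ∈ F, G.Adj x z → z ∈ X) → F ⊆ X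

theorem Conn.singleton (G : SimpleGraph V) (x : V) : Conn G {x} := by
  intro X hX ⟨y, hy⟩ _ z hz
  have := hX hy
  simp at this hz
  rwa [hz, ← this]

theorem Conn.union {G : SimpleGraph V} {F F' : Set V} (h : Conn G F) (h' : Conn G F') {x y : V}
    (hx : x ∈ F) (hy : y ∈ F') (e : x = y ∨ G.Adj x y) : Conn G (F ∪ F') := by
  intro X hX ⟨z, hz⟩ hc
  have a1 : ∀ z ∈ X, z ∈ F → F ⊆ X := by
    intro z hz hz'
    have := h (X ∩ F) (fun _ h => h.2) ⟨z, hz, hz'⟩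
      (fun x hx w hw e => ⟨hc x hx.1 w (Or.inl hw) e, hw⟩)
    exact fun w hw => (this hw).1
  have a2 : ∀ z ∈ X, z ∈ F' → F' ⊆ X := by
    intro z hz hz'
    have := h' (X ∩ F') (fun _ h => h.2) ⟨z, hz, hz'⟩
      (fun x hx w hw e => ⟨hc x hx.1 w (Or.inr hw) e, hw⟩)
    exact fun w hw => (this hw).1
  have b1 : F ⊆ X → F' ⊆ X := by
    intro hF
    have : y ∈ X := by
      rcases e with rfl | e
      · exact hF hx
      · exact hc x (hF hx) y (Or.inr hy) e
    exact a2 y this hy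
  have b2 : F' ⊆ X → F ⊆ X := by
    intro hF
    have : x ∈ X := by
      rcases e with rfl | e
      · exact hF hy
      · exact hc y (hF hy) x (Or.inl hx) e.symm
    exact a1 x this hx
  rcases hX hz with h1 | h1
  · have := a1 z hz h1
    exact Set.union_subset this (b1 this)
  · have := a2 z hz h1
    exact Set.union_subset (b2 this) this

theorem Conn.insert {G : SimpleGraph V} {F : Set V} (h : Conn G F) {x y : V}
    (hy : y ∈ F) (e : G.Adj x y) : Conn G (insert x F) :=
  (Conn.singleton G x).union h rfl hy (Or.inr e)

theorem Conn.segment {G : SimpleGraph V} {p : ℕ → V} {i j : ℕ}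
    (h : ∀ t, i ≤ t → t < j → G.Adj (p t) (p (t + 1))) (hij : i ≤ j) :
    Conn G {v | ∃ t, i ≤ t ∧ t ≤ j ∧ v = p t} := by
  induction j, hij using Nat.le_induction with
  | base =>
    have : {v | ∃ t, i ≤ t ∧ t ≤ i ∧ v = p t} = {p i} := by
      ext v
      constructor
      · rintro ⟨t, h1, h2, rfl⟩
        rw [show t = i by omega]; rfl
      · rintro rfl
        exact ⟨i, le_rfl, le_rfl, rfl⟩
    rw [this]
    exact Conn.singleton G _
  | succ j hij ih =>
    have : {v | ∃ t, i ≤ t ∧ t ≤ j + 1 ∧ v = p t} =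
        Insert.insert (p (j + 1)) {v | ∃ t, i ≤ t ∧ t ≤ j ∧ v = p t} := by
      ext v
      constructor
      · rintro ⟨t, h1, h2, rfl⟩
        rcases eq_or_ne t (j + 1) with rfl | h
        · exact Or.inl rfl
        · exact Or.inr ⟨t, h1, by omega, rfl⟩
      · rintro (rfl | ⟨t, h1, h2, rfl⟩)
        · exact ⟨j + 1, by omega, le_rfl, rfl⟩
        · exact ⟨t, h1, by omega, rfl⟩
    rw [this]
    exact (ih fun t h1 h2 => h t h1 (by omega)).insert ⟨j, hij, le_rfl, rfl⟩
      (h j hij (by omega)).symm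

/-- The component of `F` containing `x`. -/
theorem exists_component (G : SimpleGraph V) (F : Set V) (x : V) (hx : x ∈ F) :
    ∃ K ⊆ F, x ∈ K ∧ Conn G K ∧ ∀ k ∈ K, ∀ z ∈ F, G.Adj k z → z ∈ K := by
  refine ⟨{z | Relation.ReflTransGen (fun u v => G.Adj u v ∧ v ∈ F) x z}, ?_, .refl, ?_, ?_⟩
  · intro z hz
    induction hz with
    | refl => exact hx
    | tail _ h _ => exact h.2
  · intro X hX ⟨y, hy⟩ hc z hz
    have hxX : x ∈ X := by
      have : ∀ y, Relation.ReflTransGen (fun u v => G.Adj u v ∧ v ∈ F) x y → y ∈ X → x ∈ X := by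
        intro y h
        induction h with
        | refl => exact id
        | tail h1 h2 ih => exact fun h => ih (hc _ h _ h1 h2.1.symm)
      exact this y (hX hy) hy
    have : ∀ y, Relation.ReflTransGen (fun u v => G.Adj u v ∧ v ∈ F) x y → y ∈ X := by
      intro y h
      induction h with
      | refl => exact hxX
      | tail h1 h2 ih => exact hc _ ih _ (h1.tail h2) h2.1
    exact this z hz
  · intro k hk z hz e
    exact Relation.ReflTransGen.tail hk ⟨e, hz⟩

/-- A shortest walk from `x` with later vertices in `S`, to a vertex satisfying `T`. -/
theorem exists_shortest (G : SimpleGraph V) (x : V) (S : Set V) (T : V → Prop)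
    (h : ∃ n, ∃ p : ℕ → V, p 0 = x ∧ (∀ i < n, G.Adj (p i) (p (i + 1))) ∧
      (∀ i, 0 < i → i ≤ n → p i ∈ S) ∧ T (p n)) :
    ∃ n, ∃ p : ℕ → V, IP G p n ∧ p 0 = x ∧ (∀ i, 0 < i → i ≤ n → p i ∈ S) ∧ T (p n) ∧
      (∀ i < n, ¬ T (p i)) ∧ ∀ m (q : ℕ → V), q 0 = x → (∀ i < m, G.Adj (q i) (q (i + 1))) →
        (∀ i, 0 < i → i ≤ m → q i ∈ S) → T (q m) → n ≤ m := by
  classical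
  have hm := fun m => Nat.find_min h (m := m)
  obtain ⟨p, h1, h2, h3, h4⟩ := Nat.find_spec h
  set n := Nat.find h
  have hT : ∀ i < n, ¬ T (p i) := by
    intro i hi hti
    exact hm i hi ⟨p, h1, fun j hj => h2 j (by omega), fun j h0 hj => h3 j h0 (by omega), hti⟩
  have short : ∀ i j, i + 1 < j → j ≤ n → ¬ G.Adj (p i) (p j) := by
    intro i j hij hj e
    refine hm (n - (j - i - 1)) (by omega)
      ⟨fun t => if t ≤ i then p t else p (t + (j - i - 1)), by simp [h1], ?_, ?_, ?_⟩
    · intro t ht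
      rcases lt_trichotomy t i with h | rfl | h
      · simp only [h.le, show t + 1 ≤ i by omega, if_true]
        exact h2 t (by omega)
      · simp only [le_refl, if_true, show ¬ (t + 1 ≤ t) by omega, if_false]
        rwa [show t + 1 + (j - t - 1) = j by omega]
      · simp only [show ¬ (t ≤ i) by omega, if_false, show ¬ (t + 1 ≤ i) by omega]
        rw [show t + 1 + (j - i - 1) = t + (j - i - 1) + 1 by omega]
        exact h2 _ (by omega)
    · intro t h0 ht
      by_cases h : t ≤ i
      · simp only [h, if_true]; exact h3 t h0 (by omega)
      · simp only [h, if_false]; exact h3 _ (by omega) (by omega)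
    · simp only [show ¬ (n - (j - i - 1) ≤ i) by omega, if_false]
      rwa [show n - (j - i - 1) + (j - i - 1) = n by omega]
  have inj : ∀ i j, i < j → j ≤ n → p i ≠ p j := by
    intro i j hij hj e
    rcases eq_or_ne j n with rfl | hjn
    · exact hT i hij (e ▸ h4)
    · have := h2 j (by omega)
      rw [← e] at this
      exact short i (j + 1) (by omega) (by omega) this
  refine ⟨n, p, ?_, h1, h3, h4, hT, fun m q e1 e2 e3 e4 => Nat.find_min' h ⟨q, e1, e2, e3, e4⟩⟩
  intro i j hi hj
  rcases lt_trichotomy i j with h | rfl | h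
  · refine ⟨fun e => absurd e (inj i j h hj), fun e => ?_, fun e => ?_⟩
    · by_contra hne
      exact short i j (by omega) hj e
    · rw [show j = i + 1 by omega]
      exact h2 i (by omega)
  · simp
  · refine ⟨fun e => absurd e.symm (inj j i h hi), fun e => ?_, fun e => ?_⟩
    · by_contra hne
      exact short j i (by omega) hi e.symm
    · rw [show i = j + 1 by omega]
      exact (h2 j (by omega)).symm

theorem exists_min (G : SimpleGraph V) (x : V) (S : Set V) (T : V → Prop)
    (h : ∃ n, ∃ p : ℕ → V, p 0 = x ∧ (∀ i < n, G.Adj (p i) (p (i + 1))) ∧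
      (∀ i, 0 < i → i ≤ n → p i ∈ S) ∧ T (p n)) :
    ∃ n, ∃ p : ℕ → V, IP G p n ∧ p 0 = x ∧ (∀ i, 0 < i → i ≤ n → p i ∈ S) ∧ T (p n) ∧
      ∀ i < n, ¬ T (p i) := by
  obtain ⟨n, p, h1, h2, h3, h4, h5, -⟩ := exists_shortest G x S T h
  exact ⟨n, p, h1, h2, h3, h4, h5⟩

theorem Conn.exists_walk {G : SimpleGraph V} {F : Set V} (hF : Conn G F) {x y z : V}
    (hy : y ∈ F) (e : G.Adj x y) (hz : z ∈ F) :
    ∃ n, ∃ p : ℕ → V, p 0 = x ∧ (∀ i < n, G.Adj (p i) (p (i + 1))) ∧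
      (∀ i, 0 < i → i ≤ n → p i ∈ F) ∧ p n = z := by
  have := hF {z | z ∈ F ∧ ∃ n, ∃ p : ℕ → V, p 0 = x ∧ (∀ i < n, G.Adj (p i) (p (i + 1))) ∧
      (∀ i, 0 < i → i ≤ n → p i ∈ F) ∧ p n = z} (fun _ h => h.1) ?_ ?_
  · exact (this hz).2
  · refine ⟨y, hy, 1, fun i => if i = 0 then x else y, by simp, ?_, ?_, by simp⟩
    · intro i hi
      obtain rfl : i = 0 := by omega
      simpa using e
    · intro i h0 hi
      obtain rfl : i = 1 := by omega
      simpa using hy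
  · rintro u ⟨hu, n, p, h1, h2, h3, h4⟩ w hw e
    refine ⟨hw, n + 1, fun i => if i ≤ n then p i else w, by simp [h1], ?_, ?_, by simp⟩
    · intro i hi
      rcases Nat.lt_or_ge i n with h | h
      · simp only [h.le, show i + 1 ≤ n by omega, if_true]
        exact h2 i h
      · obtain rfl : i = n := by omega
        simpa [h4] using e
    · intro i h0 hi
      by_cases h : i ≤ n
      · simpa [h] using h3 i h0 h
      · simpa [h] using hw

/-- A shortest path from `x` through the connected set `F` to a vertex of `F` satisfying `T`. -/
theorem Conn.exists_min {G : SimpleGraph V} {F : Set V} (hF : Conn G F) {x y z : V} {T : V → Prop}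
    (hx : x ∉ F) (hy : y ∈ F) (e : G.Adj x y) (hz : z ∈ F) (hT : T z) :
    ∃ n, ∃ p : ℕ → V, 1 ≤ n ∧ IP G p n ∧ p 0 = x ∧ (∀ i, 0 < i → i ≤ n → p i ∈ F) ∧ T (p n) ∧
      ∀ i, 0 < i → i < n → ¬ T (p i) := by
  obtain ⟨n, p, h1, h2, h3, h4⟩ := hF.exists_walk hy e hz
  obtain ⟨n, p, k1, k2, k3, k4, k5⟩ := EHF.exists_min G x F (fun v => v ∈ F ∧ T v)
    ⟨n, p, h1, h2, h3, h4 ▸ hz, h4 ▸ hT⟩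
  refine ⟨n, p, ?_, k1, k2, k3, k4.2, fun i h0 hi h => k5 i hi ⟨k3 i h0 hi.le, h⟩⟩
  by_contra h
  obtain rfl : n = 0 := by omega
  exact hx (k2 ▸ k4.1)

theorem Conn.exists_path {G : SimpleGraph V} {F : Set V} (hF : Conn G F) {x y x' y' : V}
    (hx : x' ∈ F) (ex : G.Adj x x') (hy : y' ∈ F) (ey : G.Adj y y') (hxy : x ≠ y)
    (nxy : ¬ G.Adj x y) : ∃ n, 2 ≤ n ∧ PathIn G F x y n := by
  obtain ⟨n, p, h1, h2, h3, h4⟩ := hF.exists_walk hx ex hy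
  obtain ⟨n, p, k1, k2, k3, k4, k5⟩ := EHF.exists_min G x F (fun v => G.Adj v y)
    ⟨n, p, h1, h2, h3, h4 ▸ ey.symm⟩
  have hn : n ≠ 0 := by
    rintro rfl
    exact nxy (k2 ▸ k4)
  refine ⟨n + 1, by omega, _, k1.snoc k4 (fun i hi => ⟨?_, k5 i hi⟩), by simp [k2], by simp, ?_⟩
  · rintro rfl
    rcases Nat.eq_zero_or_pos i with rfl | h
    · exact hxy k2.symm
    · have := k1.adj (i := i - 1) (by omega)
      rw [show i - 1 + 1 = i by omega] at this
      exact k5 (i - 1) (by omega) this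
  · intro i h0 hi
    simp only [show i ≤ n by omega, if_true]
    exact k3 i h0 (by omega)

theorem anti_union_left {G : SimpleGraph V} {X X' Y : Set V} :
    Anti G (X ∪ X') Y ↔ Anti G X Y ∧ Anti G X' Y := by
  constructor
  · exact fun h => ⟨h.mono Set.subset_union_left subset_rfl, h.mono Set.subset_union_right subset_rfl⟩
  · rintro ⟨h, h'⟩ x (hx | hx) y hy
    · exact h x hx y hy
    · exact h' x hx y hy

theorem anti_union_right {G : SimpleGraph V} {X Y Y' : Set V} :
    Anti G X (Y ∪ Y') ↔ Anti G X Y ∧ Anti G X Y' := by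
  constructor
  · exact fun h => ⟨h.mono subset_rfl Set.subset_union_left, h.mono subset_rfl Set.subset_union_right⟩
  · rintro ⟨h, h'⟩ x hx y (hy | hy)
    · exact h x hx y hy
    · exact h' x hx y hy

theorem anti_insert_left {G : SimpleGraph V} {x : V} {X Y : Set V} :
    Anti G (insert x X) Y ↔ Anti G {x} Y ∧ Anti G X Y := by
  rw [Set.insert_eq, anti_union_left]

theorem anti_insert_right {G : SimpleGraph V} {y : V} {X Y : Set V} :
    Anti G X (insert y Y) ↔ Anti G X {y} ∧ Anti G X Y := by
  rw [Set.insert_eq, anti_union_right]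

theorem anti_singleton {G : SimpleGraph V} {x y : V} :
    Anti G {x} {y} ↔ x ≠ y ∧ ¬ G.Adj x y := by
  simp [Anti]

theorem anti_empty_left {G : SimpleGraph V} {Y : Set V} : Anti G ∅ Y := by
  simp [Anti]

/-- The neighbours of `a` different from `b` and not adjacent to `b`. -/
def NA (G : SimpleGraph V) (a b : V) : Set V := {v | G.Adj a v ∧ ¬ G.Adj b v ∧ v ≠ b}

/-- The common neighbours of `a` and `b`. -/
def ZZ (G : SimpleGraph V) (a b : V) : Set V := {v | G.Adj a v ∧ G.Adj b v}

/-- The vertices equal or adjacent to neither `a` nor `b`. -/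
def RR (G : SimpleGraph V) (a b : V) : Set V :=
  {v | v ≠ a ∧ v ≠ b ∧ ¬ G.Adj a v ∧ ¬ G.Adj b v}

theorem ZZ_comm (G : SimpleGraph V) (a b : V) : ZZ G a b = ZZ G b a := by
  ext v; simp [ZZ, and_comm]

theorem RR_comm (G : SimpleGraph V) (a b : V) : RR G a b = RR G b a := by
  ext v; simp [RR]; tauto

theorem anti_left_RR (G : SimpleGraph V) (a b : V) : Anti G {a} (RR G a b) := by
  rintro x rfl y ⟨h1, h2, h3, h4⟩
  exact ⟨h1.symm, h3⟩

theorem anti_right_RR (G : SimpleGraph V) (a b : V) : Anti G {b} (RR G a b) := by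
  rintro x rfl y ⟨h1, h2, h3, h4⟩
  exact ⟨h2.symm, h4⟩

theorem anti_NA (G : SimpleGraph V) (a b : V) {v : V} (hv : v ∈ NA G a b) : Anti G {b} {v} := by
  rw [anti_singleton]
  exact ⟨hv.2.2.symm, hv.2.1⟩

theorem NA_anti {G : SimpleGraph V} (hG : EvenHoleFree G) {a b : V} (hab : G.Adj a b) {x v : V}
    (hx : x ∈ NA G a b) (hv : v ∈ NA G b a) : x ≠ v ∧ ¬ G.Adj x v := by
  have h : x ≠ v := by
    rintro rfl
    exact hx.2.1 hv.1
  refine ⟨h, fun e => no_c4 hG hx.1 e hv.1.symm hab.symm hv.2.2.symm hx.2.2 hv.2.1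
    fun e => hx.2.1 e.symm⟩

theorem odd_of_center {G : SimpleGraph V} (hG : EvenHoleFree G) {F : Set V} {c x y : V} {n : ℕ}
    (h : PathIn G F x y n) (hx : G.Adj c x) (hy : G.Adj c y) (hxy : x ≠ y) (nxy : ¬ G.Adj x y)
    (hc : Anti G {c} F) : Odd n := by
  have := PathIn.hole hG h (PathIn.two hx.symm hy hxy nxy) (h.two_le hxy nxy) le_rfl hc.symm
  simpa [parity_simps] using this

theorem even_of_NA {G : SimpleGraph V} (hG : EvenHoleFree G) {a b : V} (hab : G.Adj a b)
    {F : Set V} (hF : F ⊆ RR G a b) {x v : V} {n : ℕ}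
    (h : PathIn G F x v n) (hx : x ∈ NA G a b) (hv : v ∈ NA G b a) : Even n := by
  have h1 := NA_anti hG hab hx hv
  have h2 : PathIn G (insert a {b}) x v 3 :=
    PathIn.cons hx.1.symm (PathIn.two hab hv.1 hv.2.2.symm hv.2.1) (by omega) (by
      rw [anti_insert_right, anti_singleton, anti_singleton]
      exact ⟨h1, hx.2.2, fun e => hx.2.1 e.symm⟩)
  have := PathIn.hole hG h h2 (h.two_le h1.1 h1.2) (by omega) (by
    rw [anti_insert_right]
    exact ⟨((anti_left_RR G a b).mono subset_rfl hF).symm,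
      ((anti_right_RR G a b).mono subset_rfl hF).symm⟩)
  simpa [Nat.odd_add, parity_simps, show ¬ Even 3 by decide] using this

/-- A common neighbour of two nonadjacent neighbours of `a` is in the closed neighbourhood
of `a`. -/
theorem common_nbr {G : SimpleGraph V} (hG : EvenHoleFree G) {a y₁ y₂ d : V} (h1 : G.Adj a y₁)
    (h2 : G.Adj a y₂) (hne : y₁ ≠ y₂) (hna : ¬ G.Adj y₁ y₂) (d1 : G.Adj y₁ d) (d2 : G.Adj y₂ d) :
    d = a ∨ G.Adj a d := by
  by_contra h
  push Not at h
  exact no_c4 hG d1 d2.symm h2.symm h1 hne h.1 hna fun e => h.2 e.symm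

theorem principle {G : SimpleGraph V} (hG : EvenHoleFree G) {a b : V} {F : Set V}
    (hF : F ⊆ RR G a b) {y₁ y₂ x : V} {n : ℕ} (h : PathIn G F y₁ x n) (h1 : y₁ ∈ ZZ G a b)
    (h2 : y₂ ∈ ZZ G a b) (hne : y₁ ≠ y₂) (hna : ¬ G.Adj y₁ y₂) (hx : x ∈ NA G a b)
    (hx2 : G.Adj y₂ x) (hx1 : ¬ G.Adj y₁ x) (hF2 : Anti G {y₂} F) : False := by
  have hyx : y₁ ≠ x := by
    rintro rfl
    exact hna hx2.symm
  have o1 := odd_of_center hG h h1.1 hx.1 hyx hx1 ((anti_left_RR G a b).mono subset_rfl hF)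
  have o2 := odd_of_center hG (h.concat (PathIn.one hx2.symm) (h.one_le hyx) le_rfl (by
    simp only [insert_empty_eq, anti_insert_left, anti_singleton]
    exact ⟨⟨hne, hna⟩, hF2.symm⟩)) h1.2 h2.2 hne hna (by
      simp only [anti_union_right]
      exact ⟨⟨(anti_right_RR G a b).mono subset_rfl hF, anti_empty_left.symm⟩, anti_NA G a b hx⟩)
  rw [Nat.odd_add_one] at o2
  exact o2 o1

theorem principle' {G : SimpleGraph V} (hG : EvenHoleFree G) {a b : V} {F : Set V}
    (hF : F ⊆ RR G a b) {y₁ y₂ x : V} {n : ℕ} (h : PathIn G F y₁ x n) (h1 : y₁ ∈ ZZ G a b)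
    (h2 : y₂ ∈ ZZ G a b) (hne : y₁ ≠ y₂) (hna : ¬ G.Adj y₁ y₂) (hx : x ∈ NA G a b ∪ NA G b a)
    (hx2 : G.Adj y₂ x) (hx1 : ¬ G.Adj y₁ x) (hF2 : Anti G {y₂} F) : False := by
  rcases hx with hx | hx
  · exact principle hG hF h h1 h2 hne hna hx hx2 hx1 hF2
  · rw [RR_comm] at hF
    rw [ZZ_comm] at h1 h2
    exact principle hG hF h h1 h2 hne hna hx hx2 hx1 hF2

theorem ZZ_ne_NA {G : SimpleGraph V} {a b x y : V} (hx : x ∈ NA G a b ∪ NA G b a)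
    (hy : y ∈ ZZ G a b) : y ≠ x := by
  rintro rfl
  rcases hx with hx | hx
  · exact hx.2.1 hy.2
  · exact hx.2.1 hy.1

theorem RR_ne_NA {G : SimpleGraph V} {a b x y : V} (hx : x ∈ NA G a b ∪ NA G b a)
    (hy : y ∈ RR G a b) : y ≠ x := by
  rintro rfl
  rcases hx with hx | hx
  · exact hy.2.2.1 hx.1
  · exact hy.2.2.2 hx.1

theorem RR_ne_ZZ {G : SimpleGraph V} {a b x y : V} (hx : x ∈ ZZ G a b)
    (hy : y ∈ RR G a b) : y ≠ x := by
  rintro rfl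
  exact hy.2.2.1 hx.1

/-- `x` has a neighbour in `F`. -/
def Hits (G : SimpleGraph V) (x : V) (F : Set V) : Prop := ∃ z ∈ F, G.Adj x z

theorem Hits.mono {G : SimpleGraph V} {x : V} {F F' : Set V} (h : Hits G x F) (hF : F ⊆ F') :
    Hits G x F' := by
  obtain ⟨z, hz, e⟩ := h
  exact ⟨z, hF hz, e⟩

theorem Conn.path {G : SimpleGraph V} {F : Set V} (hF : Conn G F) {x y : V}
    (hx : Hits G x F) (hy : Hits G y F) (hxy : x ≠ y) (nxy : ¬ G.Adj x y) :
    ∃ n, 2 ≤ n ∧ PathIn G F x y n := by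
  obtain ⟨x', hx, ex⟩ := hx
  obtain ⟨y', hy, ey⟩ := hy
  exact hF.exists_path hx ex hy ey hxy nxy

theorem Conn.path_one {G : SimpleGraph V} {F : Set V} (hF : Conn G F) {x y : V}
    (hx : Hits G x F) (hy : Hits G y F) (hxy : x ≠ y) :
    ∃ n, 1 ≤ n ∧ PathIn G F x y n := by
  by_cases nxy : G.Adj x y
  · exact ⟨1, le_rfl, (PathIn.one nxy).mono (Set.empty_subset _)⟩
  · obtain ⟨n, hn, h⟩ := hF.path hx hy hxy nxy
    exact ⟨n, by omega, h⟩

theorem anti_of_not_hits {G : SimpleGraph V} {x : V} {F : Set V} (h : ¬ Hits G x F) (hx : x ∉ F) :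
    Anti G {x} F := by
  rintro _ rfl y hy
  exact ⟨fun e => hx (e ▸ hy), fun e => h ⟨y, hy, e⟩⟩

theorem Conn.subset_of_component {G : SimpleGraph V} {F K W : Set V} (hW : Conn G W)
    (hK : ∀ k ∈ K, ∀ z ∈ F, G.Adj k z → z ∈ K) (hWF : W ⊆ F) {w : V} (hw : w ∈ W) (hwK : w ∈ K) :
    W ⊆ K := by
  have := hW (W ∩ K) (fun _ h => h.1) ⟨w, hw, hwK⟩
    (fun x hx z hz e => ⟨hz, hK x hx.2 z (hWF hz) e⟩)
  exact fun v hv => (this hv).2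

theorem leaves_miss {G : SimpleGraph V} (hG : EvenHoleFree G) {a b : V}
    {R₀ W : Set V} (hR : R₀ ⊆ RR G a b) (hc : Conn G R₀) (hW : W ⊆ R₀) (hWc : Conn G W)
    {y₁ y₂ x₁ x₂ : V} (h1 : y₁ ∈ ZZ G a b) (h2 : y₂ ∈ ZZ G a b) (hne : y₁ ≠ y₂)
    (hna : ¬ G.Adj y₁ y₂) (m1 : ¬ Hits G y₁ W) (m2 : ¬ Hits G y₂ W)
    (hx1 : x₁ ∈ NA G a b ∪ NA G b a) (hx2 : x₂ ∈ NA G a b ∪ NA G b a)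
    (e11 : G.Adj y₁ x₁) (e22 : G.Adj y₂ x₂) (e12 : ¬ G.Adj y₁ x₂) (e21 : ¬ G.Adj y₂ x₁)
    (k1 : Hits G x₁ W) (k2 : Hits G x₂ W) : ¬ Hits G y₁ R₀ ∧ ¬ Hits G y₂ R₀ := by
  obtain ⟨w, hw, ew⟩ := k1
  have hWs : W ⊆ {z | z ∈ R₀ ∧ ¬ G.Adj y₁ z ∧ ¬ G.Adj y₂ z} := fun z hz =>
    ⟨hW hz, fun e => m1 ⟨z, hz, e⟩, fun e => m2 ⟨z, hz, e⟩⟩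
  obtain ⟨K, hKs, hwK, hKc, hKm⟩ := exists_component G
    {z | z ∈ R₀ ∧ ¬ G.Adj y₁ z ∧ ¬ G.Adj y₂ z} w (hWs hw)
  have hWK : W ⊆ K := hWc.subset_of_component hKm hWs hw hwK
  suffices R₀ ⊆ K by
    constructor
    · rintro ⟨z, hz, e⟩
      exact (hKs (this hz)).2.1 e
    · rintro ⟨z, hz, e⟩
      exact (hKs (this hz)).2.2 e
  have main : ∀ y₁ y₂ x₁ x₂ d : V, y₁ ∈ ZZ G a b → y₂ ∈ ZZ G a b → y₁ ≠ y₂ →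
      ¬ G.Adj y₁ y₂ → x₂ ∈ NA G a b ∪ NA G b a → G.Adj y₂ x₂ → ¬ G.Adj y₁ x₂ →
      Hits G x₂ W → (∀ z ∈ K, ¬ G.Adj y₂ z) → d ∈ R₀ → Hits G d K → G.Adj y₁ d →
      ¬ G.Adj y₂ d → False := by
    intro y₁ y₂ x₁ x₂ d h1 h2 hne hna hx2 e22 e12 k2 hK hd ⟨k, hk, ek⟩ d1 d2
    obtain ⟨n, -, hp⟩ := (hKc.insert hk ek).path (x := y₁) (y := x₂) ⟨d, Or.inl rfl, d1⟩
      (k2.mono (hWK.trans (Set.subset_insert _ _))) (ZZ_ne_NA hx2 h1) e12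
    have hsub : insert d K ⊆ RR G a b := by
      rintro z (rfl | hz)
      · exact hR hd
      · exact hR (hKs hz).1
    refine principle' hG hsub hp h1 h2 hne hna hx2 e22 e12 ?_
    refine anti_of_not_hits ?_ (fun h => RR_ne_ZZ h2 (hsub h) rfl)
    rintro ⟨z, rfl | hz, e⟩
    · exact d2 e
    · exact hK z hz e
  refine hc K (fun z hz => (hKs hz).1) ⟨w, hwK⟩ ?_
  intro x hx d hd e
  by_contra hdK
  have : ¬ (¬ G.Adj y₁ d ∧ ¬ G.Adj y₂ d) := fun h => hdK (hKm x hx d ⟨hd, h.1, h.2⟩ e)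
  by_cases d1 : G.Adj y₁ d <;> by_cases d2 : G.Adj y₂ d
  · rcases common_nbr hG h1.1 h2.1 hne hna d1 d2 with h | h
    · exact (hR hd).1 h
    · exact (hR hd).2.2.1 h
  · exact main y₁ y₂ x₁ x₂ d h1 h2 hne hna hx2 e22 e12 k2 (fun z hz => (hKs hz).2.2) hd
      ⟨x, hx, e.symm⟩ d1 d2
  · exact main y₂ y₁ x₂ x₁ d h2 h1 hne.symm (fun e => hna e.symm) hx1 e11 e21 ⟨w, hw, ew⟩
      (fun z hz => (hKs hz).2.1) hd ⟨x, hx, e.symm⟩ d2 d1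
  · exact this ⟨d1, d2⟩

theorem count_gap (H : ℕ → Prop) [DecidablePred H] {i k : ℕ} (hik : i < k) (hi : H i)
    (h : ∀ t, i < t → t < k → ¬ H t) : Nat.count H k = Nat.count H i + 1 := by
  induction k, hik using Nat.le_induction with
  | base => simp [Nat.count_succ, hi]
  | succ k hk ih =>
    rw [Nat.count_succ, ih (fun t h1 h2 => h t h1 (by omega)), if_neg (h k (by omega) (by omega))]

theorem odd_count (H : ℕ → Prop) [DecidablePred H] (n : ℕ) (hne : ∃ k ≤ n, H k)
    (hfirst : ∀ k ≤ n, H k → (∀ i < k, ¬ H i) → Even k)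
    (hlast : ∀ k ≤ n, H k → (∀ i, k < i → i ≤ n → ¬ H i) → Even k)
    (hgap : ∀ i j, i < j → j ≤ n → H i → H j → (∀ t, i < t → t < j → ¬ H t) → Odd (j - i)) :
    Odd (Nat.count H (n + 1)) := by
  have prev : ∀ k, (∃ i < k, H i) → ∃ i < k, H i ∧ ∀ t, i < t → t < k → ¬ H t := by
    intro k h
    induction k with
    | zero => omega
    | succ k ih =>
      by_cases hk : H k
      · exact ⟨k, by omega, hk, fun t h1 h2 => by omega⟩
      · obtain ⟨i, hi, hi'⟩ := ih (by
          obtain ⟨i, h1, h2⟩ := h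
          refine ⟨i, ?_, h2⟩
          rcases eq_or_ne i k with rfl | h
          · exact absurd h2 hk
          · omega)
        refine ⟨i, by omega, hi'.1, fun t h1 h2 => ?_⟩
        rcases eq_or_ne t k with rfl | h
        · exact hk
        · exact hi'.2 t h1 (by omega)
  have key : ∀ k ≤ n, H k → Even (Nat.count H k + k) := by
    intro k
    induction k using Nat.strong_induction_on with
    | _ k ih =>
      intro hk hHk
      by_cases h : ∃ i < k, H i
      · obtain ⟨i, hi, h1, h2⟩ := prev k h
        rw [count_gap H hi h1 h2]
        have a1 := ih i hi (by omega) h1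
        have a2 := hgap i k hi hk h1 hHk h2
        rw [Nat.even_iff] at *
        rw [Nat.odd_iff] at a2
        omega
      · push Not at h
        have := hfirst k hk hHk h
        rw [show Nat.count H k = 0 from ?_]
        · simpa using this
        · clear this ih hHk hk
          induction k with
          | zero => simp
          | succ k ih' =>
            rw [Nat.count_succ, ih' (fun i hi => h i (by omega)), if_neg (h k (by omega))]
  obtain ⟨k, hk, h1, h2⟩ := prev (n + 1) (by
    obtain ⟨k, hk, h⟩ := hne
    exact ⟨k, by omega, h⟩)
  rw [count_gap H hk h1 h2]
  have a1 := key k (by omega) h1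
  have a2 := hlast k (by omega) h1 (fun i h3 h4 => h2 i h3 (by omega))
  rw [Nat.even_iff] at *
  rw [Nat.odd_iff]
  omega

theorem count_or_disjoint (H H' : ℕ → Prop) [DecidablePred H] [DecidablePred H']
    [DecidablePred fun k => H k ∨ H' k] (n : ℕ)
    (h : ∀ k < n, ¬ (H k ∧ H' k)) :
    Nat.count (fun k => H k ∨ H' k) n = Nat.count H n + Nat.count H' n := by
  induction n with
  | zero => simp
  | succ n ih =>
    rw [Nat.count_succ, Nat.count_succ, Nat.count_succ, ih (fun k hk => h k (by omega))]
    have := h n (by omega)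
    by_cases h1 : H n <;> by_cases h2 : H' n <;> simp_all <;> omega

/-- `u, v` are the ends of an induced path with interior `I ⊆ R₀`, and `u`, `v` are private
neighbours of `a`, `b`, respectively. -/
def Link (G : SimpleGraph V) (a b : V) (R₀ : Set V) (u v : V) (I : Set V) : Prop :=
  u ∈ NA G a b ∧ v ∈ NA G b a ∧ I ⊆ R₀ ∧ ∃ p n, IP G p n ∧ p 0 = u ∧ p n = v ∧
    ∀ w, w ∈ I ↔ ∃ i, 0 < i ∧ i < n ∧ w = p i

theorem Link.symm {G : SimpleGraph V} {a b : V} {R₀ : Set V} {u v : V} {I : Set V}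
    (h : Link G a b R₀ u v I) : Link G b a R₀ v u I := by
  obtain ⟨h1, h2, h3, p, n, h4, h5, h6, h7⟩ := h
  refine ⟨h2, h1, h3, _, n, h4.rev, by simpa using h6, by simpa using h5, fun w => ?_⟩
  rw [h7]
  constructor
  · rintro ⟨i, h0, hi, rfl⟩
    exact ⟨n - i, by omega, by omega, by simp [show n - (n - i) = i by omega]⟩
  · rintro ⟨i, h0, hi, rfl⟩
    exact ⟨n - i, by omega, by omega, rfl⟩

theorem Link.path {G : SimpleGraph V} (hG : EvenHoleFree G) {a b : V} (hab : G.Adj a b)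
    {R₀ : Set V} (hR : R₀ ⊆ RR G a b) {u v : V} {I : Set V}
    (h : Link G a b R₀ u v I) : ∃ n, 2 ≤ n ∧ Even n ∧ PathIn G I u v n := by
  obtain ⟨h1, h2, h3, p, n, h4, rfl, rfl, h7⟩ := h
  have hp : PathIn G I (p 0) (p n) n := ⟨p, h4, rfl, rfl, fun i h0 hi => (h7 _).2 ⟨i, h0, hi, rfl⟩⟩
  have := NA_anti hG hab h1 h2
  exact ⟨n, hp.two_le this.1 this.2, even_of_NA hG hab (h3.trans hR) hp h1 h2, hp⟩

theorem Link.conn {G : SimpleGraph V} {a b : V} {R₀ : Set V} {u v : V} {I : Set V}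
    (h : Link G a b R₀ u v I) : Conn G I := by
  obtain ⟨h1, h2, h3, p, n, h4, rfl, rfl, h7⟩ := h
  rcases Nat.lt_or_ge n 2 with hn | hn
  · intro X hX _ _ w hw
    obtain ⟨i, h0, hi, -⟩ := (h7 w).1 hw
    omega
  · have : I = {v | ∃ t, 1 ≤ t ∧ t ≤ n - 1 ∧ v = p t} := by
      ext w
      rw [h7]
      constructor
      · rintro ⟨i, h0, hi, rfl⟩
        exact ⟨i, by omega, by omega, rfl⟩
      · rintro ⟨i, h0, hi, rfl⟩
        exact ⟨i, by omega, by omega, rfl⟩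
    rw [this]
    exact Conn.segment (fun t _ ht => h4.adj (by omega)) (by omega)

theorem Link.hits {G : SimpleGraph V} (hG : EvenHoleFree G) {a b : V} (hab : G.Adj a b)
    {R₀ : Set V} {u v : V} {I : Set V} (h : Link G a b R₀ u v I) : Hits G u I := by
  obtain ⟨h1, h2, h3, p, n, h4, rfl, rfl, h7⟩ := h
  have := NA_anti hG hab h1 h2
  have hn : 2 ≤ n := by
    by_contra hn
    interval_cases n
    · exact this.1 rfl
    · exact this.2 (h4.adj (by omega))
  exact ⟨p 1, (h7 _).2 ⟨1, by omega, by omega, rfl⟩, h4.adj (by omega)⟩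

/-- The vertices of a path with ends `u, v` and interior `I`. -/
def PV (u v : V) (I : Set V) : Set V := insert u (insert v I)

theorem PV_comm (u v : V) (I : Set V) : PV u v I = PV v u I := Set.insert_comm _ _ _

theorem last_hit_even {G : SimpleGraph V} (hG : EvenHoleFree G) {a b : V}
    {p : ℕ → V} {n : ℕ} (hp : IP G p n) (hA : p 0 ∈ NA G a b)
    (hp' : ∀ i, 0 < i → i ≤ n → a ≠ p i ∧ ¬ G.Adj a (p i)) {y : V}
    (hy : y ∈ ZZ G a b) {k : ℕ} (hk : k ≤ n) (e : G.Adj y (p k)) (hm : ∀ i < k, ¬ G.Adj y (p i)) :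
    Even k := by
  rcases Nat.eq_zero_or_pos k with rfl | h0
  · exact Even.zero
  have hyne : ∀ i < k, y ≠ p i := by
    rintro i hi rfl
    rcases Nat.eq_zero_or_pos i with rfl | h
    · exact hA.2.1 hy.2
    · exact (hp' i h (by omega)).2 hy.1
  have h1 : PathIn G (insert (p k) {v | ∃ t, 0 < t ∧ t < k ∧ v = p t}) y (p 0) (k + 1) :=
    PathIn.cons e (PathIn.sub hp (Nat.zero_le k) hk).symm (by omega) (by
      rw [anti_insert_right, anti_singleton]
      refine ⟨⟨hyne 0 h0, hm 0 h0⟩, ?_⟩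
      rintro _ rfl _ ⟨t, h2, h3, rfl⟩
      exact ⟨hyne t h3, hm t h3⟩)
  have := odd_of_center hG h1 hy.1 hA.1 (hyne 0 h0) (hm 0 h0) (by
    rw [anti_insert_right, anti_singleton]
    refine ⟨hp' k h0 hk, ?_⟩
    rintro _ rfl _ ⟨t, h2, h3, rfl⟩
    exact hp' t h2 (by omega))
  simpa [Nat.odd_add_one] using this

theorem hit_gap_odd {G : SimpleGraph V} (hG : EvenHoleFree G) {p : ℕ → V} {n : ℕ}
    (hp : IP G p n) {y : V} (hy : ∀ i ≤ n, y ≠ p i) {i j : ℕ} (hij : i < j) (hj : j ≤ n)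
    (ei : G.Adj y (p i)) (ej : G.Adj y (p j)) (hm : ∀ t, i < t → t < j → ¬ G.Adj y (p t)) :
    Odd (j - i) := by
  rcases Nat.lt_or_ge (i + 1) j with h | h
  · refine odd_of_center hG (PathIn.sub hp hij.le hj) ei ej (hp.ne (by omega) hj (by omega))
      (hp.not_adj (by omega) hj h) ?_
    rintro _ rfl _ ⟨t, h2, h3, rfl⟩
    exact ⟨hy t (by omega), hm t h2 h3⟩
  · rw [show j - i = 1 by omega]
    exact odd_one

theorem hit_gap_odd' {G : SimpleGraph V} (hG : EvenHoleFree G) {p : ℕ → V} {n : ℕ}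
    (hp : IP G p n) {y₁ y₂ : V} (hy1 : ∀ i ≤ n, y₁ ≠ p i) (hy2 : ∀ i ≤ n, y₂ ≠ p i) {c : V}
    (c1 : G.Adj c y₁) (c2 : G.Adj c y₂) (hne : y₁ ≠ y₂) (hna : ¬ G.Adj y₁ y₂) {i j : ℕ}
    (hij : i < j) (hj : j ≤ n) (hc : ∀ t, i ≤ t → t ≤ j → c ≠ p t ∧ ¬ G.Adj c (p t))
    (ei : G.Adj y₁ (p i)) (ej : G.Adj y₂ (p j)) (nj : ¬ G.Adj y₁ (p j)) (ni : ¬ G.Adj y₂ (p i))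
    (hm : ∀ t, i < t → t < j → ¬ G.Adj y₁ (p t) ∧ ¬ G.Adj y₂ (p t)) :
    Odd (j - i) := by
  have h1 := PathIn.cons (x := y₁) ei (PathIn.sub hp hij.le hj) (by omega) (by
    rw [anti_insert_right, anti_singleton]
    refine ⟨⟨hy1 j hj, nj⟩, ?_⟩
    rintro _ rfl _ ⟨t, h2, h3, rfl⟩
    exact ⟨hy1 t (by omega), (hm t h2 h3).1⟩)
  have h2 := h1.symm.cons (x := y₂) ej (by omega) (by
    simp only [anti_insert_right, anti_singleton]
    refine ⟨⟨hne.symm, fun e => hna e.symm⟩, ⟨hy2 i (by omega), ni⟩, ?_⟩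
    rintro _ rfl _ ⟨t, h2, h3, rfl⟩
    exact ⟨hy2 t (by omega), (hm t h2 h3).2⟩)
  have := odd_of_center hG h2 c2 c1 hne.symm (fun e => hna e.symm) (by
    simp only [anti_insert_right, anti_singleton]
    refine ⟨hc j (by omega) (by omega), hc i (by omega) (by omega), ?_⟩
    rintro _ rfl _ ⟨t, h2, h3, rfl⟩
    exact hc t (by omega) (by omega))
  rw [Nat.odd_iff] at *
  omega

theorem Link.not_both {G : SimpleGraph V} (hG : EvenHoleFree G) {a b : V} (hab : G.Adj a b)
    {R₀ : Set V} (hR : R₀ ⊆ RR G a b) (hc : Conn G R₀) {u v : V} {I : Set V}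
    (h : Link G a b R₀ u v I) {y₁ y₂ : V} (h1 : y₁ ∈ ZZ G a b) (h2 : y₂ ∈ ZZ G a b)
    (hne : y₁ ≠ y₂) (hna : ¬ G.Adj y₁ y₂) (k1 : Hits G y₁ (PV u v I)) (k2 : Hits G y₂ (PV u v I))
    (t : Hits G y₁ R₀ ∨ Hits G y₂ R₀) : False := by
  classical
  have hlen := h.path hG hab hR
  have hconn := h.conn
  have hu := h.hits hG hab
  have hv := h.symm.hits hG hab.symm
  obtain ⟨hA, hB, hI, p, n, hp, rfl, rfl, hpI⟩ := h
  have huv := NA_anti hG hab hA hB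
  have hn1 : 1 ≤ n := by
    by_contra h
    obtain rfl : n = 0 := by omega
    exact huv.1 rfl
  have hpa : ∀ i, 0 < i → i ≤ n → a ≠ p i ∧ ¬ G.Adj a (p i) := by
    intro i h0 hi
    rcases eq_or_ne i n with rfl | hin
    · exact ⟨hB.2.2.symm, hB.2.1⟩
    · have := hR (hI ((hpI (p i)).2 ⟨i, h0, by omega, rfl⟩))
      exact ⟨this.1.symm, this.2.2.1⟩
  have hpb : ∀ i < n, b ≠ p i ∧ ¬ G.Adj b (p i) := by
    intro i hi
    rcases Nat.eq_zero_or_pos i with rfl | h0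
    · exact ⟨hA.2.2.symm, hA.2.1⟩
    · have := hR (hI ((hpI (p i)).2 ⟨i, h0, by omega, rfl⟩))
      exact ⟨this.2.1.symm, this.2.2.2⟩
  have hn : Even n := by
    obtain ⟨m, -, -, -⟩ := hlen
    exact even_of_NA hG hab (hI.trans hR)
      ⟨p, hp, rfl, rfl, fun i h0 hi => (hpI _).2 ⟨i, h0, hi, rfl⟩⟩ hA hB
  have hyp : ∀ y ∈ ZZ G a b, ∀ i ≤ n, y ≠ p i := by
    rintro y hy i hi rfl
    rcases Nat.eq_zero_or_pos i with rfl | h0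
    · exact hA.2.1 hy.2
    · exact (hpa i h0 hi).2 hy.1
  have hfirst : ∀ y ∈ ZZ G a b, ∀ k ≤ n, G.Adj y (p k) → (∀ i < k, ¬ G.Adj y (p i)) → Even k :=
    fun y hy k hk e hm => last_hit_even hG hp hA hpa hy hk e hm
  have hlast : ∀ y ∈ ZZ G a b, ∀ k ≤ n, G.Adj y (p k) →
      (∀ i, k < i → i ≤ n → ¬ G.Adj y (p i)) → Even k := by
    intro y hy k hk e hm
    have := last_hit_even hG (a := b) (b := a) hp.rev (by simpa using hB)
      (fun i h0 hi => hpb (n - i) (by omega)) (k := n - k) (y := y) (by rwa [ZZ_comm])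
      (by omega) (by simpa [show n - (n - k) = k by omega] using e)
      (fun i hi => hm _ (by omega) (by omega))
    rw [Nat.even_iff] at *
    omega
  have hhit : ∀ y, Hits G y (PV (p 0) (p n) I) → ∃ k ≤ n, G.Adj y (p k) := by
    rintro y ⟨z, rfl | rfl | hz, e⟩
    · exact ⟨0, by omega, e⟩
    · exact ⟨n, le_rfl, e⟩
    · obtain ⟨i, h0, hi, rfl⟩ := (hpI z).1 hz
      exact ⟨i, hi.le, e⟩
  have hdisj : ∀ k ≤ n, G.Adj y₁ (p k) → G.Adj y₂ (p k) → False := by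
    intro k hk e1 e2
    rcases Nat.eq_zero_or_pos k with rfl | h0
    · rcases common_nbr hG h1.2 h2.2 hne hna e1 e2 with h | h
      · exact hA.2.2 h
      · exact hA.2.1 h
    · rcases common_nbr hG h1.1 h2.1 hne hna e1 e2 with h | h
      · exact (hpa k h0 hk).1 h.symm
      · exact (hpa k h0 hk).2 h
  have o1 := odd_count (fun k => G.Adj y₁ (p k)) n (hhit y₁ k1) (hfirst y₁ h1) (hlast y₁ h1)
    (fun i j hij hj ei ej hm => hit_gap_odd hG hp (hyp y₁ h1) hij hj ei ej hm)
  have o2 := odd_count (fun k => G.Adj y₂ (p k)) n (hhit y₂ k2) (hfirst y₂ h2) (hlast y₂ h2)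
    (fun i j hij hj ei ej hm => hit_gap_odd hG hp (hyp y₂ h2) hij hj ei ej hm)
  have hmix : ∀ y₁ y₂ : V, y₁ ∈ ZZ G a b → y₂ ∈ ZZ G a b → y₁ ≠ y₂ → ¬ G.Adj y₁ y₂ →
      (∀ k ≤ n, G.Adj y₁ (p k) → G.Adj y₂ (p k) → False) → (Hits G y₁ R₀ ∨ Hits G y₂ R₀) →
      ∀ i j, i < j → j ≤ n → G.Adj y₁ (p i) → G.Adj y₂ (p j) →
      (∀ t, i < t → t < j → ¬ G.Adj y₁ (p t) ∧ ¬ G.Adj y₂ (p t)) → Odd (j - i) := by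
    intro y₁ y₂ h1 h2 hne hna hdisj t i j hij hj ei ej hm
    have nj : ¬ G.Adj y₁ (p j) := fun e => hdisj j hj e ej
    have ni : ¬ G.Adj y₂ (p i) := fun e => hdisj i (by omega) ei e
    by_cases hi : 0 < i
    · exact hit_gap_odd' hG hp (hyp y₁ h1) (hyp y₂ h2) h1.1 h2.1 hne hna hij hj
        (fun t h3 h4 => hpa t (by omega) (by omega)) ei ej nj ni hm
    by_cases hjn : j < n
    · exact hit_gap_odd' hG hp (hyp y₁ h1) (hyp y₂ h2) h1.2 h2.2 hne hna hij hj
        (fun t h3 h4 => hpb t (by omega)) ei ej nj ni hm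
    obtain rfl : i = 0 := by omega
    obtain rfl : j = n := by omega
    have := leaves_miss hG hR hc hI hconn h1 h2 hne hna
      (by
        rintro ⟨z, hz, e⟩
        obtain ⟨i, h0, hi, rfl⟩ := (hpI z).1 hz
        exact (hm i h0 hi).1 e)
      (by
        rintro ⟨z, hz, e⟩
        obtain ⟨i, h0, hi, rfl⟩ := (hpI z).1 hz
        exact (hm i h0 hi).2 e) (Or.inl hA) (Or.inr hB) ei ej nj ni hu hv
    exact absurd t (by simpa using this)
  have o3 := odd_count (fun k => G.Adj y₁ (p k) ∨ G.Adj y₂ (p k)) n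
    (by
      obtain ⟨k, hk, e⟩ := hhit y₁ k1
      exact ⟨k, hk, Or.inl e⟩)
    (by
      rintro k hk (e | e) hm
      · exact hfirst y₁ h1 k hk e fun i hi e => hm i hi (Or.inl e)
      · exact hfirst y₂ h2 k hk e fun i hi e => hm i hi (Or.inr e))
    (by
      rintro k hk (e | e) hm
      · exact hlast y₁ h1 k hk e fun i hi h3 e => hm i hi h3 (Or.inl e)
      · exact hlast y₂ h2 k hk e fun i hi h3 e => hm i hi h3 (Or.inr e))
    (by
      rintro i j hij hj (ei | ei) (ej | ej) hm
      · exact hit_gap_odd hG hp (hyp y₁ h1) hij hj ei ej fun t h3 h4 e => hm t h3 h4 (Or.inl e)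
      · exact hmix y₁ y₂ h1 h2 hne hna hdisj t i j hij hj ei ej
          (fun t h3 h4 => not_or.1 (hm t h3 h4))
      · exact hmix y₂ y₁ h2 h1 hne.symm (fun e => hna e.symm) (fun k hk e e' => hdisj k hk e' e)
          t.symm i j hij hj ei ej (fun t h3 h4 => (not_or.1 (hm t h3 h4)).symm)
      · exact hit_gap_odd hG hp (hyp y₂ h2) hij hj ei ej fun t h3 h4 e => hm t h3 h4 (Or.inr e))
  rw [count_or_disjoint _ _ _ (fun k hk h => hdisj k (by omega) h.1 h.2)] at o3
  rw [Nat.odd_iff] at *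
  omega

theorem no_center {G : SimpleGraph V} (hG : EvenHoleFree G) {a b : V} (hab : G.Adj a b)
    {F X X' : Set V} {u v e t y : V} {m k : ℕ} (hF : F ⊆ RR G a b) (hc : Conn G F)
    (hu : u ∈ NA G a b) (hv : v ∈ NA G b a) (ku : Hits G u F) (kv : Hits G v F)
    (he : e ∈ RR G a b) (ke : Hits G e F) (ht : t ∈ NA G a b ∪ NA G b a) (hy : y ∈ ZZ G a b)
    (hX : X ⊆ RR G a b) (hX' : X' ⊆ RR G a b) (pt : PathIn G X t e m) (py : PathIn G X' y e k)
    (at' : Anti G (insert t X) (insert u (insert v F)))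
    (ay : Anti G (insert y X') (insert u (insert v F))) : False := by
  obtain ⟨α, hα, pα⟩ := hc.path_one ke ku (RR_ne_NA (Or.inl hu) he)
  obtain ⟨β, hβ, pβ⟩ := hc.path_one ke kv (RR_ne_NA (Or.inr hv) he)
  have s1 : insert u F ⊆ insert u (insert v F) := Set.insert_subset_insert (Set.subset_insert _ _)
  have s2 : insert v F ⊆ insert u (insert v F) := Set.subset_insert _ _
  have hm := pt.one_le (RR_ne_NA ht he).symm
  have hk := py.one_le (RR_ne_ZZ hy he).symm
  have tu := pt.concat pα hm hα (at'.mono subset_rfl s1)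
  have tv := pt.concat pβ hm hβ (at'.mono subset_rfl s2)
  have yu := py.concat pα hk hα (ay.mono subset_rfl s1)
  have yv := py.concat pβ hk hβ (ay.mono subset_rfl s2)
  have b1 : X ∪ F ∪ {e} ⊆ RR G a b :=
    Set.union_subset (Set.union_subset hX hF) (Set.singleton_subset_iff.2 he)
  have b2 : X' ∪ F ∪ {e} ⊆ RR G a b :=
    Set.union_subset (Set.union_subset hX' hF) (Set.singleton_subset_iff.2 he)
  have ntu := at' t (Or.inl rfl) u (Or.inl rfl)
  have ntv := at' t (Or.inl rfl) v (Or.inr (Or.inl rfl))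
  have nyu := ay y (Or.inl rfl) u (Or.inl rfl)
  have nyv := ay y (Or.inl rfl) v (Or.inr (Or.inl rfl))
  have o1 := odd_of_center hG yu hy.1 hu.1 nyu.1 nyu.2 ((anti_left_RR G a b).mono subset_rfl b2)
  have o2 := odd_of_center hG yv hy.2 hv.1 nyv.1 nyv.2 ((anti_right_RR G a b).mono subset_rfl b2)
  rcases ht with ht | ht
  · have o3 := odd_of_center hG tu ht.1 hu.1 ntu.1 ntu.2 ((anti_left_RR G a b).mono subset_rfl b1)
    have o4 := even_of_NA hG hab b1 tv ht hv
    rw [Nat.odd_iff] at *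
    rw [Nat.even_iff] at *
    omega
  · have o3 := odd_of_center hG tv ht.1 hv.1 ntv.1 ntv.2 ((anti_right_RR G a b).mono subset_rfl b1)
    have o4 := even_of_NA hG hab b1 tu.symm hu ht
    rw [Nat.odd_iff] at *
    rw [Nat.even_iff] at *
    omega

theorem Link.no_end {G : SimpleGraph V} (hG : EvenHoleFree G) {a b : V} (hab : G.Adj a b)
    {R₀ : Set V} (hR : R₀ ⊆ RR G a b) {u v : V} {I : Set V}
    (h : Link G a b R₀ u v I) {e t : V} {X : Set V} {m : ℕ} (he : e ∈ RR G a b) (heI : e ∉ I)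
    (eu : G.Adj e u) (ev : ¬ G.Adj e v) (eI : ¬ Hits G e I) (ht : t ∈ NA G b a)
    (pt : PathIn G X t e m) (hX : X ⊆ RR G a b) (ha : Anti G (insert t X) (PV u v I)) : False := by
  obtain ⟨n, hn2, hn, pn⟩ := h.path hG hab hR
  have hm := pt.one_le (RR_ne_NA (Or.inr ht) he).symm
  have p1 := pt.concat (PathIn.one eu) hm le_rfl (ha.mono subset_rfl (by
    simp [PV]))
  have hI := h.2.2.1.trans hR
  have b1 : X ∪ ∅ ∪ {e} ⊆ RR G a b :=
    Set.union_subset (Set.union_subset hX (Set.empty_subset _)) (Set.singleton_subset_iff.2 he)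
  have o1 := even_of_NA hG hab b1 p1.symm h.1 ht
  have p2 := p1.concat pn (by omega) (by omega) (by
    rw [Set.union_empty, Set.union_comm, Set.singleton_union, Set.insert_comm, anti_insert_left]
    refine ⟨?_, ha.mono subset_rfl (Set.subset_insert _ _)⟩
    rw [anti_insert_right, anti_singleton]
    exact ⟨⟨RR_ne_NA (Or.inr h.2.1) he, ev⟩, anti_of_not_hits eI heI⟩)
  have ntv := ha t (Or.inl rfl) v (Or.inr (Or.inl rfl))
  have o2 := odd_of_center hG p2 ht.1 h.2.1.1 ntv.1 ntv.2 (by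
    simp only [anti_union_right]
    exact ⟨⟨anti_union_right.1 ((anti_right_RR G a b).mono subset_rfl b1) |>.imp_left
      (fun h => anti_union_right.1 h) |> fun h => ⟨⟨h.1.1, h.1.2⟩, h.2⟩,
      (anti_right_RR G a b).mono subset_rfl hI⟩, anti_NA G a b h.1⟩)
  rw [Nat.odd_iff] at *
  rw [Nat.even_iff] at *
  omega

theorem Link.no_ends {G : SimpleGraph V} (hG : EvenHoleFree G) {a b : V} (hab : G.Adj a b)
    {R₀ : Set V} (hR : R₀ ⊆ RR G a b) {u v : V} {I : Set V}
    (h : Link G a b R₀ u v I) {e : V} (heI : e ∉ I)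
    (eu : G.Adj e u) (ev : G.Adj e v) (eI : ¬ Hits G e I) : False := by
  obtain ⟨n, hn2, hn, pn⟩ := h.path hG hab hR
  have h1 := NA_anti hG hab h.1 h.2.1
  have := odd_of_center hG pn eu ev h1.1 h1.2 (anti_of_not_hits eI heI)
  rw [Nat.odd_iff] at *
  rw [Nat.even_iff] at *
  omega

/-- Two anticomplete induced paths between private neighbours of `a` and of `b`, with interiors
in the same component `R₀` of the graph minus the closed neighbourhoods of `a` and `b`. -/
structure Cfg (G : SimpleGraph V) (a b : V) (R₀ : Set V) (u₁ v₁ : V) (I₁ : Set V) (u₂ v₂ : V)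
    (I₂ : Set V) : Prop where
  ehf : EvenHoleFree G
  ab : G.Adj a b
  sub : R₀ ⊆ RR G a b
  conn : Conn G R₀
  closed : ∀ x ∈ R₀, ∀ z ∈ RR G a b, G.Adj x z → z ∈ R₀
  link₁ : Link G a b R₀ u₁ v₁ I₁
  link₂ : Link G a b R₀ u₂ v₂ I₂
  anti : Anti G (PV u₁ v₁ I₁) (PV u₂ v₂ I₂)

theorem Cfg.swap {G : SimpleGraph V} {a b : V} {R₀ : Set V} {u₁ v₁ : V} {I₁ : Set V} {u₂ v₂ : V}
    {I₂ : Set V} (h : Cfg G a b R₀ u₁ v₁ I₁ u₂ v₂ I₂) : Cfg G a b R₀ u₂ v₂ I₂ u₁ v₁ I₁ :=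
  ⟨h.ehf, h.ab, h.sub, h.conn, h.closed, h.link₂, h.link₁, h.anti.symm⟩

theorem Cfg.flip {G : SimpleGraph V} {a b : V} {R₀ : Set V} {u₁ v₁ : V} {I₁ : Set V} {u₂ v₂ : V}
    {I₂ : Set V} (h : Cfg G a b R₀ u₁ v₁ I₁ u₂ v₂ I₂) : Cfg G b a R₀ v₁ u₁ I₁ v₂ u₂ I₂ :=
  ⟨h.ehf, h.ab.symm, by rw [RR_comm]; exact h.sub, h.conn, by rw [RR_comm]; exact h.closed,
    h.link₁.symm, h.link₂.symm, by rw [PV_comm v₁, PV_comm v₂]; exact h.anti⟩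

/-- The configuration together with an induced path `c` linking the two interiors. -/
structure Core (G : SimpleGraph V) (a b : V) (R₀ : Set V) (u₁ v₁ : V) (I₁ : Set V) (u₂ v₂ : V)
    (I₂ : Set V) (c : ℕ → V) (l : ℕ) : Prop where
  cfg : Cfg G a b R₀ u₁ v₁ I₁ u₂ v₂ I₂
  ip : IP G c l
  mem : ∀ k ≤ l, c k ∈ R₀
  nmem₁ : ∀ k ≤ l, c k ∉ I₁
  nmem₂ : ∀ k ≤ l, c k ∉ I₂
  hits₂ : Hits G (c 0) I₂
  hits₁ : Hits G (c l) I₁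
  miss₂ : ∀ k, 0 < k → k ≤ l → ¬ Hits G (c k) (PV u₂ v₂ I₂)
  miss₁ : ∀ k < l, ¬ Hits G (c k) (PV u₁ v₁ I₁)

theorem Core.flip {G : SimpleGraph V} {a b : V} {R₀ : Set V} {u₁ v₁ : V} {I₁ : Set V} {u₂ v₂ : V}
    {I₂ : Set V} {c : ℕ → V} {l : ℕ} (h : Core G a b R₀ u₁ v₁ I₁ u₂ v₂ I₂ c l) :
    Core G b a R₀ v₁ u₁ I₁ v₂ u₂ I₂ c l :=
  ⟨h.cfg.flip, h.ip, h.mem, h.nmem₁, h.nmem₂, h.hits₂, h.hits₁,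
    by rw [PV_comm]; exact h.miss₂, by rw [PV_comm]; exact h.miss₁⟩

theorem Core.swap {G : SimpleGraph V} {a b : V} {R₀ : Set V} {u₁ v₁ : V} {I₁ : Set V} {u₂ v₂ : V}
    {I₂ : Set V} {c : ℕ → V} {l : ℕ} (h : Core G a b R₀ u₁ v₁ I₁ u₂ v₂ I₂ c l) :
    Core G a b R₀ u₂ v₂ I₂ u₁ v₁ I₁ (fun i => c (l - i)) l :=
  ⟨h.cfg.swap, h.ip.rev, fun k _ => h.mem _ (by omega), fun k _ => h.nmem₂ _ (by omega),
    fun k _ => h.nmem₁ _ (by omega), by simpa using h.hits₁, by simpa using h.hits₂,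
    fun k _ _ => h.miss₁ _ (by omega), fun k _ => h.miss₂ _ (by omega) (by omega)⟩

/-- The interior `I` together with the first `k` vertices of `c`. -/
def Xs (I : Set V) (c : ℕ → V) (k : ℕ) : Set V := I ∪ {w | ∃ j < k, w = c j}

theorem Xs_succ (I : Set V) (c : ℕ → V) (k : ℕ) : Xs I c (k + 1) = insert (c k) (Xs I c k) := by
  ext w
  simp only [Xs, Set.mem_union, Set.mem_insert_iff, Set.mem_ofPred_eq]
  constructor
  · rintro (h | ⟨j, hj, rfl⟩)
    · tauto
    · rcases eq_or_ne j k with rfl | h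
      · tauto
      · exact Or.inr (Or.inr ⟨j, by omega, rfl⟩)
  · rintro (rfl | h | ⟨j, hj, rfl⟩)
    · exact Or.inr ⟨k, by omega, rfl⟩
    · tauto
    · exact Or.inr ⟨j, by omega, rfl⟩

theorem hits_Xs {G : SimpleGraph V} {I : Set V} {c : ℕ → V} {l : ℕ} (hc : IP G c l)
    (h0 : Hits G (c 0) I) {k : ℕ} (hk : k ≤ l) : Hits G (c k) (Xs I c k) := by
  rcases Nat.eq_zero_or_pos k with rfl | h
  · exact h0.mono Set.subset_union_left
  · refine ⟨c (k - 1), Or.inr ⟨k - 1, by omega, rfl⟩, ?_⟩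
    have := hc.adj (i := k - 1) (by omega)
    rw [show k - 1 + 1 = k by omega] at this
    exact this.symm

theorem conn_Xs {G : SimpleGraph V} {I : Set V} {c : ℕ → V} {l : ℕ} (hI : Conn G I)
    (hc : IP G c l) (h0 : Hits G (c 0) I) {k : ℕ} (hk : k ≤ l + 1) : Conn G (Xs I c k) := by
  induction k with
  | zero => simpa [Xs] using hI
  | succ k ih =>
    rw [Xs_succ]
    obtain ⟨z, hz, e⟩ := hits_Xs hc h0 (k := k) (by omega)
    exact (ih (by omega)).insert hz e

theorem Conn.exists_walk_of_mem {G : SimpleGraph V} {F : Set V} (hF : Conn G F) {x z : V}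
    (hx : x ∈ F) (hz : z ∈ F) :
    ∃ n, ∃ p : ℕ → V, p 0 = x ∧ (∀ i < n, G.Adj (p i) (p (i + 1))) ∧
      (∀ i, 0 < i → i ≤ n → p i ∈ F) ∧ p n = z := by
  have := hF {z | z ∈ F ∧ ∃ n, ∃ p : ℕ → V, p 0 = x ∧ (∀ i < n, G.Adj (p i) (p (i + 1))) ∧
      (∀ i, 0 < i → i ≤ n → p i ∈ F) ∧ p n = z} (fun _ h => h.1) ?_ ?_
  · exact (this hz).2
  · exact ⟨x, hx, 0, fun _ => x, rfl, by simp, fun i h0 hi => by omega, rfl⟩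
  · rintro u ⟨hu, n, p, h1, h2, h3, h4⟩ w hw e
    refine ⟨hw, n + 1, fun i => if i ≤ n then p i else w, by simp [h1], ?_, ?_, by simp⟩
    · intro i hi
      rcases Nat.lt_or_ge i n with h | h
      · simp only [h.le, show i + 1 ≤ n by omega, if_true]
        exact h2 i h
      · obtain rfl : i = n := by omega
        simpa [h4] using e
    · intro i h0 hi
      by_cases h : i ≤ n
      · simpa [h] using h3 i h0 h
      · simpa [h] using hw

theorem Cfg.core_leaf {G : SimpleGraph V} {a b : V} {R₀ : Set V} {u₁ v₁ : V} {I₁ : Set V}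
    {u₂ v₂ : V} {I₂ : Set V} (h : Cfg G a b R₀ u₁ v₁ I₁ u₂ v₂ I₂) {c : ℕ → V} {l : ℕ}
    (hc : IP G c l) (hm : ∀ k ≤ l, c k ∈ R₀) (hn1 : ∀ k ≤ l, c k ∉ I₁)
    (h2 : Hits G (c 0) I₂) (h1 : ∀ k < l, ¬ Hits G (c k) I₁) :
    ∀ k < l, ¬ G.Adj (c k) u₁ ∧ ¬ G.Adj (c k) v₁ := by
  intro k
  induction k using Nat.strong_induction_on with
  | _ k ih =>
  intro hk
  have hL := h.link₁
  have hXc := conn_Xs h.link₂.conn hc h2 (k := k) (by omega)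
  have hXh := hits_Xs hc h2 (k := k) hk.le
  have hXs : Xs I₂ c k ⊆ R₀ := by
    rintro w (hw | ⟨j, hj, rfl⟩)
    · exact h.link₂.2.2.1 hw
    · exact hm j (by omega)
  have hanti : Anti G (PV u₂ v₂ (Xs I₂ c k)) (PV u₁ v₁ I₁) := by
    have h3 := h.anti.symm
    simp only [PV, Xs, anti_insert_left, anti_union_left] at h3 ⊢
    refine ⟨h3.1, h3.2.1, h3.2.2, ?_⟩
    rintro _ ⟨j, hj, rfl⟩ w hw
    have hR := h.sub (hm j (by omega))
    have := ih j hj (by omega)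
    rcases hw with rfl | rfl | hw
    · exact ⟨RR_ne_NA (Or.inl hL.1) hR, this.1⟩
    · exact ⟨RR_ne_NA (Or.inr hL.2.1) hR, this.2⟩
    · exact ⟨fun e => hn1 j (by omega) (e ▸ hw), fun e => h1 j (by omega) ⟨w, hw, e⟩⟩
  have hck := h.sub (hm k hk.le)
  by_cases eu : G.Adj (c k) u₁ <;> by_cases ev : G.Adj (c k) v₁
  · exact (hL.no_ends h.ehf h.ab h.sub (hn1 k hk.le) eu ev (h1 k hk)).elim
  · exfalso
    have hv2 := h.link₂.symm.hits h.ehf h.ab.symm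
    obtain ⟨m, -, hp⟩ := hXc.path_one (hv2.mono Set.subset_union_left) hXh
      (RR_ne_NA (Or.inr h.link₂.2.1) hck).symm
    refine hL.no_end h.ehf h.ab h.sub hck (hn1 k hk.le) eu ev (h1 k hk) h.link₂.2.1 hp
      (hXs.trans h.sub) (hanti.mono ?_ subset_rfl)
    exact Set.subset_insert _ _
  · exfalso
    have hu2 := h.link₂.hits h.ehf h.ab
    obtain ⟨m, -, hp⟩ := hXc.path_one (hu2.mono Set.subset_union_left) hXh
      (RR_ne_NA (Or.inl h.link₂.1) hck).symm
    have hf := h.flip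
    refine hf.link₁.no_end h.ehf hf.ab hf.sub (hf.sub (hm k hk.le)) (hn1 k hk.le) ev eu (h1 k hk)
      h.link₂.1 hp (hXs.trans hf.sub) ?_
    rw [PV_comm]
    refine hanti.mono ?_ subset_rfl
    exact Set.insert_subset_insert (Set.subset_insert _ _)
  · exact ⟨eu, ev⟩

theorem Cfg.exists_core {G : SimpleGraph V} {a b : V} {R₀ : Set V} {u₁ v₁ : V} {I₁ : Set V}
    {u₂ v₂ : V} {I₂ : Set V} (h : Cfg G a b R₀ u₁ v₁ I₁ u₂ v₂ I₂) :
    ∃ c l, Core G a b R₀ u₁ v₁ I₁ u₂ v₂ I₂ c l := by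
  classical
  obtain ⟨x, hx, -⟩ := h.link₂.hits h.ehf h.ab
  obtain ⟨z, hz, -⟩ := h.link₁.hits h.ehf h.ab
  have hI : Anti G I₁ I₂ := h.anti.mono (fun w hw => Or.inr (Or.inr hw)) fun w hw =>
    Or.inr (Or.inr hw)
  obtain ⟨n, p, g1, g2, g3, g4⟩ := h.conn.exists_walk_of_mem (h.link₂.2.2.1 hx) (h.link₁.2.2.1 hz)
  obtain ⟨n, p, g1, g2, g3, g4, g5⟩ := EHF.exists_min G x R₀ (fun v => v ∈ I₁)
    ⟨n, p, g1, g2, g3, g4 ▸ hz⟩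
  have hn : 0 < n := by
    by_contra hn
    obtain rfl : n = 0 := by omega
    exact (hI _ g4 x hx).1 g2
  have hpR : ∀ i ≤ n, p i ∈ R₀ := by
    intro i hi
    rcases Nat.eq_zero_or_pos i with rfl | h0
    · rw [g2]; exact h.link₂.2.2.1 hx
    · exact g3 i h0 hi
  have hex : ∃ j, j < n ∧ Hits G (p j) I₁ := ⟨n - 1, by omega, p n, g4, by
    have := g1.adj (i := n - 1) (by omega)
    rwa [show n - 1 + 1 = n by omega] at this⟩
  obtain ⟨hj, hj1⟩ := Nat.find_spec hex
  have hj2 : ∀ t < Nat.find hex, ¬ Hits G (p t) I₁ := fun t ht e =>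
    Nat.find_min hex ht ⟨by omega, e⟩
  set j := Nat.find hex
  obtain ⟨i, hij, hi1, hi2⟩ : ∃ i ≤ j, (p i ∈ I₂ ∨ Hits G (p i) I₂) ∧
      ∀ t, i < t → t ≤ j → ¬ (p t ∈ I₂ ∨ Hits G (p t) I₂) := by
    have := Nat.findGreatest_spec (P := fun t => p t ∈ I₂ ∨ Hits G (p t) I₂) (Nat.zero_le j)
      (Or.inl (by rw [g2]; exact hx))
    exact ⟨_, Nat.findGreatest_le j, this, fun t h1 h2 => Nat.findGreatest_is_greatest h1 h2⟩
  have hiI : p i ∉ I₂ := by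
    intro hi
    rcases eq_or_ne i j with rfl | hne
    · obtain ⟨w, hw, e⟩ := hj1
      exact (hI w hw _ hi).2 e.symm
    · exact hi2 (i + 1) (by omega) (by omega) (Or.inr ⟨p i, hi, (g1.adj (by omega)).symm⟩)
  have hi1 : Hits G (p i) I₂ := hi1.resolve_left hiI
  have hip : IP G (fun t => p (i + t)) (j - i) := g1.sub (by omega)
  have n1 : ∀ k ≤ j - i, p (i + k) ∉ I₁ := fun k hk => g5 _ (by omega)
  have n2 : ∀ k ≤ j - i, p (i + k) ∉ I₂ := by
    intro k hk hp
    rcases Nat.eq_zero_or_pos k with rfl | h0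
    · exact hiI hp
    · exact hi2 (i + k) (by omega) (by omega) (Or.inl hp)
  have m1 : ∀ k < j - i, ¬ Hits G (p (i + k)) I₁ := fun k hk => hj2 _ (by omega)
  have m2 : ∀ k, 0 < k → k ≤ j - i → ¬ Hits G (p (i + k)) I₂ := fun k h0 hk e =>
    hi2 _ (by omega) (by omega) (Or.inr e)
  have l1 := h.core_leaf hip (fun k hk => hpR _ (by omega)) n1 (by simpa using hi1) m1
  have l2 := h.swap.core_leaf hip.rev (fun k hk => hpR _ (by omega)) (fun k hk => n2 _ (by omega))
    (by simpa [show i + (j - i) = j by omega] using hj1)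
    (fun k hk => m2 _ (by omega) (by omega))
  refine ⟨fun t => p (i + t), j - i, h, hip, fun k hk => hpR _ (by omega), n1, n2,
    by simpa using hi1, by simpa [show i + (j - i) = j by omega] using hj1, ?_, ?_⟩
  · rintro k h0 hk ⟨w, rfl | rfl | hw, e⟩
    · have := (l2 (j - i - k) (by omega)).1
      rw [show j - i - (j - i - k) = k by omega] at this
      exact this e
    · have := (l2 (j - i - k) (by omega)).2
      rw [show j - i - (j - i - k) = k by omega] at this
      exact this e
    · exact m2 k h0 hk ⟨w, hw, e⟩
  · rintro k hk ⟨w, rfl | rfl | hw, e⟩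
    · exact (l1 k hk).1 e
    · exact (l1 k hk).2 e
    · exact m1 k hk ⟨w, hw, e⟩

/-- A connected set `X` anticomplete to the first path and containing a neighbour of `y`. -/
theorem Cfg.no_side {G : SimpleGraph V} {a b : V} {R₀ : Set V} {u₁ v₁ : V} {I₁ : Set V}
    {u₂ v₂ : V} {I₂ : Set V} (h : Cfg G a b R₀ u₁ v₁ I₁ u₂ v₂ I₂) {X : Set V} {e y : V}
    (hX : X ⊆ R₀) (hXc : Conn G X) (hXa : Anti G X (PV u₁ v₁ I₁)) (hu : Hits G u₂ X)
    (he : e ∈ R₀) (heX : Hits G e X) (he1 : Hits G e I₁) (hy : y ∈ ZZ G a b)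
    (hyP : ¬ Hits G y (PV u₁ v₁ I₁)) (hyX : Hits G y X ∨ G.Adj y e) : False := by
  have heR := h.sub he
  have hyA : Anti G {y} (PV u₁ v₁ I₁) := by
    refine anti_of_not_hits hyP ?_
    rintro (rfl | rfl | hy1)
    · exact ZZ_ne_NA (Or.inl h.link₁.1) hy rfl
    · exact ZZ_ne_NA (Or.inr h.link₁.2.1) hy rfl
    · exact RR_ne_ZZ hy (h.sub (h.link₁.2.2.1 hy1)) rfl
  obtain ⟨k, hk⟩ : ∃ k, PathIn G X y e k := by
    rcases hyX with hyX | hyX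
    · obtain ⟨k, -, hk⟩ := hXc.path_one hyX heX (RR_ne_ZZ hy heR).symm
      exact ⟨k, hk⟩
    · exact ⟨1, (PathIn.one hyX).mono (Set.empty_subset _)⟩
  obtain ⟨m, -, hm⟩ := hXc.path_one hu heX (RR_ne_NA (Or.inl h.link₂.1) heR).symm
  refine no_center h.ehf h.ab (h.link₁.2.2.1.trans h.sub) h.link₁.conn h.link₁.1 h.link₁.2.1
    (h.link₁.hits h.ehf h.ab) (h.link₁.symm.hits h.ehf h.ab.symm) heR he1 (Or.inl h.link₂.1) hy
    (hX.trans h.sub) (hX.trans h.sub) hm hk ?_ ?_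
  · rw [anti_insert_left]
    exact ⟨h.anti.symm.mono (by simp [PV]) subset_rfl, hXa⟩
  · rw [anti_insert_left]
    exact ⟨hyA, hXa⟩

/-- The union of the two interiors and the connecting path. -/
def Ws (I₁ I₂ : Set V) (c : ℕ → V) (l : ℕ) : Set V := I₁ ∪ I₂ ∪ {w | ∃ j ≤ l, w = c j}

theorem Ws_swap (I₁ I₂ : Set V) (c : ℕ → V) (l : ℕ) :
    Ws I₂ I₁ (fun i => c (l - i)) l = Ws I₁ I₂ c l := by
  ext w
  simp only [Ws, Set.mem_union, Set.mem_ofPred_eq]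
  have : (∃ j ≤ l, w = c (l - j)) ↔ ∃ j ≤ l, w = c j := by
    constructor
    · rintro ⟨j, hj, rfl⟩
      exact ⟨l - j, by omega, rfl⟩
    · rintro ⟨j, hj, rfl⟩
      exact ⟨l - j, by omega, by rw [show l - (l - j) = j by omega]⟩
  rw [this]
  tauto

theorem Xs_subset_Ws (I₁ I₂ : Set V) (c : ℕ → V) (l : ℕ) : Xs I₂ c l ⊆ Ws I₁ I₂ c l := by
  rintro w (h | ⟨j, hj, rfl⟩)
  · exact Or.inl (Or.inr h)
  · exact Or.inr ⟨j, hj.le, rfl⟩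

theorem Xs_rev_subset_Ws (I₁ I₂ : Set V) (c : ℕ → V) (l : ℕ) :
    Xs I₁ (fun i => c (l - i)) l ⊆ Ws I₁ I₂ c l := by
  rw [← Ws_swap]
  exact Xs_subset_Ws _ _ _ _

theorem Ws_subset (I₁ I₂ : Set V) (c : ℕ → V) (l : ℕ) :
    Ws I₁ I₂ c l ⊆ insert (c 0) (I₂ ∪ Xs I₁ (fun i => c (l - i)) l) := by
  rintro w ((h | h) | ⟨j, hj, rfl⟩)
  · exact Or.inr (Or.inr (Or.inl h))
  · exact Or.inr (Or.inl h)
  · rcases Nat.eq_zero_or_pos j with rfl | h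
    · exact Or.inl rfl
    · exact Or.inr (Or.inr (Or.inr ⟨l - j, by omega, by simp [show l - (l - j) = j by omega]⟩))

theorem Core.sub_Ws {G : SimpleGraph V} {a b : V} {R₀ : Set V} {u₁ v₁ : V} {I₁ : Set V} {u₂ v₂ : V}
    {I₂ : Set V} {c : ℕ → V} {l : ℕ} (h : Core G a b R₀ u₁ v₁ I₁ u₂ v₂ I₂ c l) :
    Ws I₁ I₂ c l ⊆ R₀ := by
  rintro w ((hw | hw) | ⟨j, hj, rfl⟩)
  · exact h.cfg.link₁.2.2.1 hw
  · exact h.cfg.link₂.2.2.1 hw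
  · exact h.mem j hj

theorem Core.conn_Ws {G : SimpleGraph V} {a b : V} {R₀ : Set V} {u₁ v₁ : V} {I₁ : Set V}
    {u₂ v₂ : V} {I₂ : Set V} {c : ℕ → V} {l : ℕ} (h : Core G a b R₀ u₁ v₁ I₁ u₂ v₂ I₂ c l) :
    Conn G (Ws I₁ I₂ c l) := by
  have h1 := conn_Xs h.cfg.link₂.conn h.ip h.hits₂ (k := l + 1) le_rfl
  obtain ⟨z, hz, e⟩ := h.hits₁
  have h2 := h.cfg.link₁.conn.union h1 hz (Or.inr ⟨l, by omega, rfl⟩) (Or.inr e.symm)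
  convert h2 using 1
  ext w
  simp [Ws, Xs, or_assoc]

theorem Core.anti₁ {G : SimpleGraph V} {a b : V} {R₀ : Set V} {u₁ v₁ : V} {I₁ : Set V}
    {u₂ v₂ : V} {I₂ : Set V} {c : ℕ → V} {l : ℕ} (h : Core G a b R₀ u₁ v₁ I₁ u₂ v₂ I₂ c l) :
    Anti G (Xs I₂ c l) (PV u₁ v₁ I₁) := by
  rintro w (hw | ⟨j, hj, rfl⟩) z hz
  · exact (h.cfg.anti z hz w (Or.inr (Or.inr hw))).imp Ne.symm fun h e => h e.symm
  · refine ⟨?_, fun e => h.miss₁ j hj ⟨z, hz, e⟩⟩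
    have hR := h.cfg.sub (h.mem j hj.le)
    rcases hz with rfl | rfl | hz
    · exact RR_ne_NA (Or.inl h.cfg.link₁.1) hR
    · exact RR_ne_NA (Or.inr h.cfg.link₁.2.1) hR
    · exact fun e => h.nmem₁ j hj.le (e ▸ hz)

theorem Core.anti₂ {G : SimpleGraph V} {a b : V} {R₀ : Set V} {u₁ v₁ : V} {I₁ : Set V}
    {u₂ v₂ : V} {I₂ : Set V} {c : ℕ → V} {l : ℕ} (h : Core G a b R₀ u₁ v₁ I₁ u₂ v₂ I₂ c l) :
    Anti G (Xs I₁ (fun i => c (l - i)) l) (PV u₂ v₂ I₂) := h.swap.anti₁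

theorem Core.miss_of_miss_left {G : SimpleGraph V} {a b : V} {R₀ : Set V} {u₁ v₁ : V} {I₁ : Set V}
    {u₂ v₂ : V} {I₂ : Set V} {c : ℕ → V} {l : ℕ} (h : Core G a b R₀ u₁ v₁ I₁ u₂ v₂ I₂ c l) {y : V}
    (hy : y ∈ ZZ G a b) (h1 : ¬ Hits G y (PV u₁ v₁ I₁)) :
    ¬ Hits G y I₂ ∧ ∀ j ≤ l, ¬ G.Adj y (c j) := by
  have key : ¬ (Hits G y (Xs I₂ c l) ∨ G.Adj y (c l)) := fun hh =>
    h.cfg.no_side ((Xs_subset_Ws I₁ I₂ c l).trans h.sub_Ws)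
      (conn_Xs h.cfg.link₂.conn h.ip h.hits₂ (by omega)) h.anti₁
      ((h.cfg.link₂.hits h.cfg.ehf h.cfg.ab).mono Set.subset_union_left) (h.mem l le_rfl)
      (hits_Xs h.ip h.hits₂ le_rfl) h.hits₁ hy h1 hh
  push Not at key
  refine ⟨fun h' => key.1 (h'.mono Set.subset_union_left), fun j hj e => ?_⟩
  rcases eq_or_ne j l with rfl | hne
  · exact key.2 e
  · exact key.1 ⟨c j, Or.inr ⟨j, by omega, rfl⟩, e⟩

theorem Core.miss_Ws {G : SimpleGraph V} {a b : V} {R₀ : Set V} {u₁ v₁ : V} {I₁ : Set V}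
    {u₂ v₂ : V} {I₂ : Set V} {c : ℕ → V} {l : ℕ} (h : Core G a b R₀ u₁ v₁ I₁ u₂ v₂ I₂ c l) {y : V}
    (hy : y ∈ ZZ G a b) (h1 : ¬ Hits G y (PV u₁ v₁ I₁)) : ¬ Hits G y (Ws I₁ I₂ c l) := by
  have := h.miss_of_miss_left hy h1
  rintro ⟨w, (hw | hw) | ⟨j, hj, rfl⟩, e⟩
  · exact h1 ⟨w, Or.inr (Or.inr hw), e⟩
  · exact this.1 ⟨w, hw, e⟩
  · exact this.2 j hj e

/-- A vertex `y` adjacent to both ends of the edge, with a path in `R₀` towards the core. -/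
structure ZD (G : SimpleGraph V) (a b : V) (R₀ : Set V) (u₁ v₁ : V) (I₁ : Set V) (u₂ v₂ : V)
    (I₂ : Set V) (c : ℕ → V) (l : ℕ) (y : V) (Y : Set V) (e : V) (m : ℕ) : Prop where
  core : Core G a b R₀ u₁ v₁ I₁ u₂ v₂ I₂ c l
  hy : y ∈ ZZ G a b
  y₁ : Anti G {y} (PV u₁ v₁ I₁)
  y₂ : Anti G {y} (PV u₂ v₂ I₂)
  yW : Anti G {y} (Ws I₁ I₂ c l)
  eR : e ∈ R₀
  YR : Y ⊆ R₀
  py : PathIn G Y y e m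
  m1 : 1 ≤ m
  YW : Anti G Y (Ws I₁ I₂ c l)
  conn : Conn G (insert e Y)
  eY : Y.Nonempty → Hits G e Y
  Yc : Conn G Y
  ye : Hits G y (insert e Y)
  eW : e ∉ Ws I₁ I₂ c l
  he : Hits G e (Ws I₁ I₂ c l)
  Yu : Anti G Y {u₂}
  Yv : Anti G Y {v₂}

theorem ZD.flip {G : SimpleGraph V} {a b : V} {R₀ : Set V} {u₁ v₁ : V} {I₁ : Set V} {u₂ v₂ : V}
    {I₂ : Set V} {c : ℕ → V} {l : ℕ} {y : V} {Y : Set V} {e : V} {m : ℕ}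
    (h : ZD G a b R₀ u₁ v₁ I₁ u₂ v₂ I₂ c l y Y e m) :
    ZD G b a R₀ v₁ u₁ I₁ v₂ u₂ I₂ c l y Y e m :=
  ⟨h.core.flip, by rw [ZZ_comm]; exact h.hy, by rw [PV_comm]; exact h.y₁,
    by rw [PV_comm]; exact h.y₂, h.yW, h.eR, h.YR, h.py, h.m1, h.YW, h.conn, h.eY, h.Yc, h.ye,
    h.eW, h.he, h.Yv, h.Yu⟩

section
variable {G : SimpleGraph V} {a b : V} {R₀ : Set V} {u₁ v₁ : V} {I₁ : Set V} {u₂ v₂ : V}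
    {I₂ : Set V} {c : ℕ → V} {l : ℕ} {y : V} {Y : Set V} {e : V} {m : ℕ}

theorem ZD.leaf_path (h : ZD G a b R₀ u₁ v₁ I₁ u₂ v₂ I₂ c l y Y e m) {t : V}
    (ht : t ∈ NA G a b ∪ NA G b a) (hY : Hits G t (insert e Y)) : ∃ k, PathIn G Y t e k := by
  obtain ⟨z, rfl | hz, hh⟩ := hY
  · exact ⟨1, (PathIn.one hh).mono (Set.empty_subset _)⟩
  · obtain ⟨k, -, hk⟩ := h.Yc.path_one ⟨z, hz, hh⟩ (h.eY ⟨z, hz⟩)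
      (RR_ne_NA ht (h.core.cfg.sub h.eR)).symm
    exact ⟨k, hk⟩

theorem ZD.eRR (h : ZD G a b R₀ u₁ v₁ I₁ u₂ v₂ I₂ c l y Y e m) : e ∈ RR G a b :=
  h.core.cfg.sub h.eR

theorem ZD.YI₁ (h : ZD G a b R₀ u₁ v₁ I₁ u₂ v₂ I₂ c l y Y e m) : Anti G Y I₁ :=
  h.YW.mono subset_rfl fun _ h => Or.inl (Or.inl h)

theorem ZD.YI₂ (h : ZD G a b R₀ u₁ v₁ I₁ u₂ v₂ I₂ c l y Y e m) : Anti G Y I₂ :=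
  h.YW.mono subset_rfl fun _ h => Or.inl (Or.inr h)

theorem ZD.YP₂ (h : ZD G a b R₀ u₁ v₁ I₁ u₂ v₂ I₂ c l y Y e m) : Anti G Y (PV u₂ v₂ I₂) := by
  simp only [PV, anti_insert_right]
  exact ⟨h.Yu, h.Yv, h.YI₂⟩

theorem ZD.Yc0 (h : ZD G a b R₀ u₁ v₁ I₁ u₂ v₂ I₂ c l y Y e m) : Anti G Y {c 0} :=
  h.YW.mono subset_rfl fun _ h => Or.inr ⟨0, by omega, h⟩

theorem ZD.yc0 (h : ZD G a b R₀ u₁ v₁ I₁ u₂ v₂ I₂ c l y Y e m) : Anti G {y} {c 0} :=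
  h.yW.mono subset_rfl fun _ h => Or.inr ⟨0, by omega, h⟩

theorem ZD.leaf_anti (h : ZD G a b R₀ u₁ v₁ I₁ u₂ v₂ I₂ c l y Y e m) {t : V}
    (ht : t = u₁ ∨ t = v₁) : Anti G {t} (PV u₂ v₂ I₂) := by
  refine h.core.cfg.anti.mono ?_ subset_rfl
  rintro _ rfl
  rcases ht with rfl | rfl
  · exact Or.inl rfl
  · exact Or.inr (Or.inl rfl)

theorem ZD.leaf_mem (h : ZD G a b R₀ u₁ v₁ I₁ u₂ v₂ I₂ c l y Y e m) {t : V}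
    (ht : t = u₁ ∨ t = v₁) : t ∈ NA G a b ∪ NA G b a := by
  rcases ht with rfl | rfl
  · exact Or.inl h.core.cfg.link₁.1
  · exact Or.inr h.core.cfg.link₁.2.1

theorem ZD.X2_sub (h : ZD G a b R₀ u₁ v₁ I₁ u₂ v₂ I₂ c l y Y e m) :
    Xs I₁ (fun i => c (l - i)) l ⊆ R₀ := (Xs_rev_subset_Ws I₁ I₂ c l).trans h.core.sub_Ws

theorem ZD.X2_conn (h : ZD G a b R₀ u₁ v₁ I₁ u₂ v₂ I₂ c l y Y e m) :
    Conn G (Xs I₁ (fun i => c (l - i)) l) :=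
  conn_Xs h.core.swap.cfg.link₂.conn h.core.swap.ip h.core.swap.hits₂ (by omega)

theorem ZD.leaf_hits (h : ZD G a b R₀ u₁ v₁ I₁ u₂ v₂ I₂ c l y Y e m) {t : V}
    (ht : t = u₁ ∨ t = v₁) : Hits G t (Xs I₁ (fun i => c (l - i)) l) := by
  have hc := h.core.cfg
  rcases ht with rfl | rfl
  · exact (hc.link₁.hits hc.ehf hc.ab).mono Set.subset_union_left
  · exact (hc.link₁.symm.hits hc.ehf hc.ab.symm).mono Set.subset_union_left

/-- Two far sides of `no_center`, with the second path as its base. -/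
theorem ZD.center₂ (h : ZD G a b R₀ u₁ v₁ I₁ u₂ v₂ I₂ c l y Y e m) {d t : V} {X X' : Set V}
    {i j : ℕ} (hd : d ∈ RR G a b) (kd : Hits G d I₂) (ht : t = u₁ ∨ t = v₁) (hX : X ⊆ R₀)
    (hX' : X' ⊆ R₀) (pt : PathIn G X t d i) (py : PathIn G X' y d j)
    (aX : Anti G X (PV u₂ v₂ I₂)) (aX' : Anti G X' (PV u₂ v₂ I₂)) : False := by
  have hc := h.core.cfg
  refine no_center hc.ehf hc.ab (hc.link₂.2.2.1.trans hc.sub) hc.link₂.conn hc.link₂.1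
    hc.link₂.2.1 (hc.link₂.hits hc.ehf hc.ab) (hc.link₂.symm.hits hc.ehf hc.ab.symm) hd kd
    (h.leaf_mem ht) h.hy (hX.trans hc.sub) (hX'.trans hc.sub) pt py ?_ ?_
  · rw [anti_insert_left]
    exact ⟨h.leaf_anti ht, aX⟩
  · rw [anti_insert_left]
    exact ⟨h.y₂, aX'⟩

theorem ZD.c0_hits (h : ZD G a b R₀ u₁ v₁ I₁ u₂ v₂ I₂ c l y Y e m) :
    Hits G (c 0) (Xs I₁ (fun i => c (l - i)) l) := by
  simpa using hits_Xs h.core.swap.ip h.core.swap.hits₂ (le_refl l)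

theorem ZD.anti_side (h : ZD G a b R₀ u₁ v₁ I₁ u₂ v₂ I₂ c l y Y e m)
    (hu : ¬ Hits G u₁ (insert e Y)) (hv : ¬ Hits G v₁ (insert e Y)) (e1 : ¬ Hits G e I₁) :
    Anti G (insert e Y) (PV u₁ v₁ I₁) := by
  have hc := h.core.cfg
  have hR : insert e Y ⊆ R₀ := Set.insert_subset h.eR h.YR
  simp only [PV, anti_insert_right]
  refine ⟨(anti_of_not_hits hu fun h' => ?_).symm, (anti_of_not_hits hv fun h' => ?_).symm, ?_⟩
  · exact RR_ne_NA (Or.inl hc.link₁.1) (hc.sub (hR h')) rfl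
  · exact RR_ne_NA (Or.inr hc.link₁.2.1) (hc.sub (hR h')) rfl
  · rw [anti_insert_left]
    exact ⟨anti_of_not_hits e1 fun h' => h.eW (Or.inl (Or.inl h')), h.YI₁⟩

theorem ZD.side (h : ZD G a b R₀ u₁ v₁ I₁ u₂ v₂ I₂ c l y Y e m)
    (hu : ¬ Hits G u₁ (insert e Y)) (hv : ¬ Hits G v₁ (insert e Y)) (e1 : ¬ Hits G e I₁)
    (e2 : Hits G e (Xs I₂ c l)) : False := by
  have hc := h.core.cfg
  have hR : insert e Y ⊆ R₀ := Set.insert_subset h.eR h.YR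
  obtain ⟨z, hz, ez⟩ := e2
  refine hc.no_side (X := Xs I₂ c l ∪ insert e Y) (e := c l) (y := y) ?_ ?_ ?_ ?_
    (h.core.mem l le_rfl) ?_ h.core.hits₁ h.hy ?_ ?_
  · exact Set.union_subset ((Xs_subset_Ws I₁ I₂ c l).trans h.core.sub_Ws) hR
  · exact (conn_Xs hc.link₂.conn h.core.ip h.core.hits₂ (by omega)).union h.conn hz (Or.inl rfl)
      (Or.inr ez.symm)
  · rw [anti_union_left]
    exact ⟨h.core.anti₁, h.anti_side hu hv e1⟩
  · exact (hc.link₂.hits hc.ehf hc.ab).mono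
      (Set.subset_union_left.trans Set.subset_union_left)
  · exact (hits_Xs h.core.ip h.core.hits₂ le_rfl).mono Set.subset_union_left
  · rintro ⟨w, hw, ew⟩
    exact (h.y₁ y rfl w hw).2 ew
  · exact Or.inl (h.ye.mono Set.subset_union_right)

theorem ZD.not_hits (h : ZD G a b R₀ u₁ v₁ I₁ u₂ v₂ I₂ c l y Y e m) (h2 : Hits G e I₂) : False := by
  have key : ∀ t, t = u₁ ∨ t = v₁ → ¬ Hits G t (insert e Y) := by
    intro t ht hh
    obtain ⟨k, hk⟩ := h.leaf_path (h.leaf_mem ht) hh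
    exact h.center₂ h.eRR h2 ht h.YR h.YR hk h.py h.YP₂ h.YP₂
  by_cases e2 : Hits G e (Xs I₁ (fun i => c (l - i)) l)
  · obtain ⟨k, -, hk⟩ := h.X2_conn.path_one (h.leaf_hits (Or.inl rfl)) e2
      (RR_ne_NA (h.leaf_mem (Or.inl rfl)) h.eRR).symm
    exact h.center₂ h.eRR h2 (Or.inl rfl) h.X2_sub h.YR hk h.py h.core.anti₂ h.YP₂
  · exact h.side (key _ (Or.inl rfl)) (key _ (Or.inr rfl))
      (fun h' => e2 (h'.mono Set.subset_union_left)) (h2.mono Set.subset_union_left)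

theorem ZD.hits_or_adj (h : ZD G a b R₀ u₁ v₁ I₁ u₂ v₂ I₂ c l y Y e m) (h2 : ¬ Hits G e I₂) :
    Hits G e (Xs I₁ (fun i => c (l - i)) l) ∨ G.Adj e (c 0) := by
  obtain ⟨z, hz, ez⟩ := h.he
  rcases Ws_subset _ _ _ _ hz with rfl | hz | hz
  · exact Or.inr ez
  · exact absurd ⟨z, hz, ez⟩ h2
  · exact Or.inl ⟨z, hz, ez⟩

theorem ZD.not_miss_ends (h : ZD G a b R₀ u₁ v₁ I₁ u₂ v₂ I₂ c l y Y e m) (h2 : ¬ Hits G e I₂)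
    (hu : ¬ G.Adj e u₂) (hv : ¬ G.Adj e v₂) : False := by
  have hc := h.core.cfg
  have hd := hc.sub (h.core.mem 0 (by omega))
  obtain ⟨k, -, hk⟩ := h.X2_conn.path_one (h.leaf_hits (Or.inl rfl)) h.c0_hits
    (RR_ne_NA (h.leaf_mem (Or.inl rfl)) hd).symm
  have hea : Anti G {e} (PV u₂ v₂ I₂) := by
    simp only [PV, anti_insert_right, anti_singleton]
    exact ⟨⟨RR_ne_NA (Or.inl hc.link₂.1) h.eRR, hu⟩, ⟨RR_ne_NA (Or.inr hc.link₂.2.1) h.eRR, hv⟩,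
      anti_of_not_hits h2 fun h' => h.eW (Or.inl (Or.inr h'))⟩
  have heY : Anti G (insert e Y) (PV u₂ v₂ I₂) := by
    rw [anti_insert_left]; exact ⟨hea, h.YP₂⟩
  have hR : insert e Y ⊆ R₀ := Set.insert_subset h.eR h.YR
  have hne : y ≠ c 0 := (RR_ne_ZZ h.hy hd).symm
  rcases h.hits_or_adj h2 with hz | hz
  · obtain ⟨z, hz, ez⟩ := hz
    have hcon := h.X2_conn.union h.conn hz (Or.inl rfl) (Or.inr ez.symm)
    obtain ⟨i, -, hi⟩ := hcon.path_one (h.ye.mono Set.subset_union_right)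
      (h.c0_hits.mono Set.subset_union_left) hne
    exact h.center₂ hd h.core.hits₂ (Or.inl rfl) h.X2_sub (Set.union_subset h.X2_sub hR) hk hi
      h.core.anti₂ (anti_union_left.2 ⟨h.core.anti₂, heY⟩)
  · obtain ⟨i, -, hi⟩ := h.conn.path_one h.ye ⟨e, Or.inl rfl, hz.symm⟩ hne
    exact h.center₂ hd h.core.hits₂ (Or.inl rfl) h.X2_sub hR hk hi h.core.anti₂ heY

/-- `no_center` for the second interior enlarged by the first vertex of the connecting path. -/
theorem ZD.center₂' (h : ZD G a b R₀ u₁ v₁ I₁ u₂ v₂ I₂ c l y Y e m) (he : G.Adj e (c 0)) {t : V}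
    (ht : t = u₁ ∨ t = v₁) (hY : Hits G t (insert e Y)) (tc : ¬ G.Adj t (c 0)) : False := by
  have hc := h.core.cfg
  have hd := hc.sub (h.core.mem 0 (by omega))
  obtain ⟨k, hk⟩ := h.leaf_path (h.leaf_mem ht) hY
  obtain ⟨z, hz, ez⟩ := h.core.hits₂
  have h1 := h.leaf_anti ht
  have h2 := h.y₂
  have h3 : Anti G {t} {c 0} := anti_singleton.2 ⟨(RR_ne_NA (h.leaf_mem ht) hd).symm, tc⟩
  have h4 := h.yc0
  have h5 := h.Yc0
  have h6 := h.YP₂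
  simp only [PV, anti_insert_right] at h1 h2 h6
  refine no_center (F := insert (c 0) I₂) (e := e) hc.ehf hc.ab ?_ (hc.link₂.conn.insert hz ez)
    hc.link₂.1 hc.link₂.2.1 ((hc.link₂.hits hc.ehf hc.ab).mono (Set.subset_insert _ _))
    ((hc.link₂.symm.hits hc.ehf hc.ab.symm).mono (Set.subset_insert _ _)) h.eRR
    ⟨c 0, Or.inl rfl, he⟩ (h.leaf_mem ht) h.hy (h.YR.trans hc.sub) (h.YR.trans hc.sub) hk h.py ?_ ?_
  · exact Set.insert_subset hd (hc.link₂.2.2.1.trans hc.sub)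
  · simp only [anti_insert_left, anti_insert_right]
    tauto
  · simp only [anti_insert_left, anti_insert_right]
    tauto

theorem ZD.not_adj_single_end (h : ZD G a b R₀ u₁ v₁ I₁ u₂ v₂ I₂ c l y Y e m) (h2 : ¬ Hits G e I₂)
    (hu : G.Adj e u₂) (hv : ¬ G.Adj e v₂) : False := by
  have hc := h.core.cfg
  have hd := hc.sub (h.core.mem 0 (by omega))
  have heI : e ∉ I₂ := fun h' => h.eW (Or.inl (Or.inr h'))
  have hR : insert e Y ⊆ R₀ := Set.insert_subset h.eR h.YR
  have hvl := h.leaf_anti (Or.inr rfl)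
  have hul := h.leaf_anti (Or.inl rfl)
  by_cases e2 : Hits G e (Xs I₁ (fun i => c (l - i)) l)
  · obtain ⟨k, -, hk⟩ := h.X2_conn.path_one (h.leaf_hits (Or.inr rfl)) e2
      (RR_ne_NA (h.leaf_mem (Or.inr rfl)) h.eRR).symm
    exact hc.link₂.no_end hc.ehf hc.ab hc.sub h.eRR heI hu hv h2 hc.link₁.2.1 hk
      (h.X2_sub.trans hc.sub) (anti_insert_left.2 ⟨hvl, h.core.anti₂⟩)
  have hec : G.Adj e (c 0) := (h.hits_or_adj h2).resolve_left e2
  have e1 : ¬ Hits G e I₁ := fun h' => e2 (h'.mono Set.subset_union_left)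
  rcases Nat.eq_zero_or_pos l with rfl | hl
  · have kv : ¬ Hits G v₁ (insert e Y) := by
      intro hh
      obtain ⟨k, hk⟩ := h.leaf_path (h.leaf_mem (Or.inr rfl)) hh
      exact hc.link₂.no_end hc.ehf hc.ab hc.sub h.eRR heI hu hv h2 hc.link₁.2.1 hk
        (h.YR.trans hc.sub) (anti_insert_left.2 ⟨hvl, h.YP₂⟩)
    by_cases ku : Hits G u₁ (insert e Y)
    · by_cases kc : G.Adj u₁ (c 0)
      · obtain ⟨i, hi, pi⟩ := hc.link₂.conn.path_one h.core.hits₂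
          (hc.link₂.symm.hits hc.ehf hc.ab.symm) (RR_ne_NA (Or.inr hc.link₂.2.1) hd)
        have hI := hc.link₂.2.2.1.trans hc.sub
        have hI' : insert (c 0) I₂ ⊆ RR G a b := Set.insert_subset hd hI
        have q1 := PathIn.cons kc pi hi (hul.mono subset_rfl (by simp [PV]))
        have f1 := even_of_NA hc.ehf hc.ab hI' q1 hc.link₁.1 hc.link₂.2.1
        have h3 := h.y₂
        have h4 := h.YP₂
        have h5 := h.yc0
        have h6 := h.Yc0
        simp only [PV, anti_insert_right] at h3 h4
        have q2 := PathIn.cons hec pi hi (by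
          rw [anti_insert_right, anti_singleton]
          exact ⟨⟨RR_ne_NA (Or.inr hc.link₂.2.1) h.eRR, hv⟩, anti_of_not_hits h2 heI⟩)
        have q3 := h.py.concat q2 h.m1 (by omega) (by
          simp only [anti_insert_left, anti_insert_right]
          tauto)
        have h31 := anti_singleton.1 h3.1
        have h32 := anti_singleton.1 h3.2.1
        have hYR := h.YR.trans hc.sub
        have f2 := odd_of_center hc.ehf q3 h.hy.2 hc.link₂.2.1.1 h32.1 h32.2
          ((anti_right_RR G a b).mono subset_rfl (by
            refine Set.union_subset (Set.union_subset hYR hI') ?_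
            rintro _ rfl
            exact h.eRR))
        have q4 := h.py.concat (PathIn.one hu) h.m1 le_rfl (by
          simp only [anti_insert_left, insert_empty_eq]
          tauto)
        have f3 := odd_of_center hc.ehf q4 h.hy.1 hc.link₂.1.1 h31.1 h31.2
          ((anti_left_RR G a b).mono subset_rfl (by
            refine Set.union_subset (Set.union_subset hYR (Set.empty_subset _)) ?_
            rintro _ rfl
            exact h.eRR))
        rw [Nat.odd_iff] at f2 f3
        rw [Nat.even_iff] at f1
        omega
      · exact h.center₂' hec (Or.inl rfl) ku kc
    · obtain ⟨k, -, hk⟩ := h.conn.path_one h.ye ⟨e, Or.inl rfl, hec.symm⟩ (RR_ne_ZZ h.hy hd).symm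
      obtain ⟨i, -, hi⟩ := hc.link₂.conn.path_one (hc.link₂.hits hc.ehf hc.ab) h.core.hits₂
        (RR_ne_NA (Or.inl hc.link₂.1) hd).symm
      refine no_center hc.ehf hc.ab (hc.link₁.2.2.1.trans hc.sub) hc.link₁.conn hc.link₁.1
        hc.link₁.2.1 (hc.link₁.hits hc.ehf hc.ab) (hc.link₁.symm.hits hc.ehf hc.ab.symm) hd
        h.core.hits₁ (Or.inl hc.link₂.1) h.hy (hc.link₂.2.2.1.trans hc.sub) (hR.trans hc.sub)
        hi hk ?_ ?_
      · exact hc.anti.symm.mono (by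
          rintro w (rfl | hw)
          · exact Or.inl rfl
          · exact Or.inr (Or.inr hw)) subset_rfl
      · rw [anti_insert_left]
        exact ⟨h.y₁, h.anti_side ku kv e1⟩
  · have m1 := h.core.miss₁ 0 hl
    have key : ∀ t, t = u₁ ∨ t = v₁ → ¬ Hits G t (insert e Y) := by
      intro t ht hh
      refine h.center₂' hec ht hh fun h' => m1 ⟨t, ?_, h'.symm⟩
      rcases ht with rfl | rfl
      · exact Or.inl rfl
      · exact Or.inr (Or.inl rfl)
    exact h.side (key _ (Or.inl rfl)) (key _ (Or.inr rfl)) e1 ⟨c 0, Or.inr ⟨0, hl, rfl⟩, hec⟩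

theorem ZD.false (h : ZD G a b R₀ u₁ v₁ I₁ u₂ v₂ I₂ c l y Y e m) : False := by
  have hc := h.core.cfg
  by_cases h2 : Hits G e I₂
  · exact h.not_hits h2
  by_cases hu : G.Adj e u₂ <;> by_cases hv : G.Adj e v₂
  · exact hc.link₂.no_ends hc.ehf hc.ab hc.sub (fun h' => h.eW (Or.inl (Or.inr h'))) hu hv h2
  · exact h.not_adj_single_end h2 hu hv
  · exact h.flip.not_adj_single_end h2 hv hu
  · exact h.not_miss_ends h2 hu hv

end

section
variable {G : SimpleGraph V} {a b : V} {R₀ : Set V} {u₁ v₁ : V} {I₁ : Set V} {u₂ v₂ : V}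
    {I₂ : Set V} {c : ℕ → V} {l : ℕ}

theorem Cfg.anti_y (h : Cfg G a b R₀ u₁ v₁ I₁ u₂ v₂ I₂) {y : V} (hy : y ∈ ZZ G a b)
    (h1 : ¬ Hits G y (PV u₁ v₁ I₁)) : Anti G {y} (PV u₁ v₁ I₁) := by
  refine anti_of_not_hits h1 ?_
  rintro (rfl | rfl | hy1)
  · exact ZZ_ne_NA (Or.inl h.link₁.1) hy rfl
  · exact ZZ_ne_NA (Or.inr h.link₁.2.1) hy rfl
  · exact RR_ne_ZZ hy (h.sub (h.link₁.2.2.1 hy1)) rfl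

theorem Cfg.leaves_ne (h : Cfg G a b R₀ u₁ v₁ I₁ u₂ v₂ I₂) : u₁ ≠ u₂ ∧ ¬ G.Adj u₁ u₂ :=
  h.anti u₁ (Or.inl rfl) u₂ (Or.inl rfl)

/-- Two nonadjacent private neighbours of `a` or `b` are not both attached to two
anticomplete connected subsets. -/
theorem no_two_sides (hG : EvenHoleFree G) (hab : G.Adj a b) {X X' : Set V}
    (hX : X ⊆ RR G a b) (hX' : X' ⊆ RR G a b) (cX : Conn G X) (cX' : Conn G X') (ha : Anti G X X')
    {t t' : V} (ht : t ∈ NA G a b ∪ NA G b a) (ht' : t' ∈ NA G a b ∪ NA G b a) (hne : t ≠ t')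
    (hna : ¬ G.Adj t t') (k1 : Hits G t X) (k2 : Hits G t' X) (k3 : Hits G t X')
    (k4 : Hits G t' X') : False := by
  obtain ⟨n, hn, p⟩ := cX.path k1 k2 hne hna
  obtain ⟨m, hm, q⟩ := cX'.path k3 k4 hne hna
  have key := PathIn.hole hG p q hn hm ha
  have par : ∀ {Z : Set V} {k : ℕ}, Z ⊆ RR G a b → PathIn G Z t t' k →
      ((t ∈ NA G a b ↔ t' ∈ NA G a b) ↔ Odd k) := by
    intro Z k hZ r
    have hnot : ∀ x, x ∈ NA G b a → x ∉ NA G a b := fun x h1 h2 => h2.2.1 h1.1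
    rcases ht with h1 | h1 <;> rcases ht' with h2 | h2
    · simpa [h1, h2] using
        odd_of_center hG r h1.1 h2.1 hne hna ((anti_left_RR G a b).mono subset_rfl hZ)
    · simpa [h1, hnot _ h2] using even_of_NA hG hab hZ r h1 h2
    · simpa [h2, hnot _ h1] using even_of_NA hG hab hZ r.symm h2 h1
    · simpa [hnot _ h1, hnot _ h2] using
        odd_of_center hG r h1.1 h2.1 hne hna ((anti_right_RR G a b).mono subset_rfl hZ)
  have e1 := par hX p
  have e2 := par hX' q
  rw [Nat.odd_add] at key
  rw [← Nat.not_odd_iff_even] at key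
  tauto

theorem Core.hits_PV (h : Core G a b R₀ u₁ v₁ I₁ u₂ v₂ I₂ c l) {y : V} (hy : y ∈ ZZ G a b)
    (hR : Hits G y R₀) : Hits G y (PV u₁ v₁ I₁) ∨ Hits G y (PV u₂ v₂ I₂) := by
  by_contra hcon
  push Not at hcon
  obtain ⟨n1, n2⟩ := hcon
  have hc := h.cfg
  have hyR : y ∉ RR G a b := fun h' => RR_ne_ZZ hy h' rfl
  have mW := h.miss_Ws hy n1
  have hyW : Anti G {y} (Ws I₁ I₂ c l) :=
    anti_of_not_hits mW fun h' => hyR (hc.sub (h.sub_Ws h'))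
  obtain ⟨z, hz, ez⟩ := hR
  obtain ⟨z', hz', ez'⟩ := h.hits₁
  obtain ⟨m, q, hm, hq, rfl, hqR, hT, hmin⟩ := hc.conn.exists_min (T := fun w => Hits G w (Ws I₁ I₂ c l))
    (fun h' => hyR (hc.sub h')) hz ez (hc.link₁.2.2.1 hz')
    ⟨c l, Or.inr ⟨l, le_rfl, rfl⟩, ez'.symm⟩
  have hqW : ∀ i ≤ m, q i ∉ Ws I₁ I₂ c l := by
    intro i hi hw
    rcases Nat.eq_zero_or_pos i with rfl | h0
    · exact hyR (hc.sub (h.sub_Ws hw))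
    · have hadj := hq.adj (i := i - 1) (by omega)
      rw [show i - 1 + 1 = i by omega] at hadj
      rcases Nat.eq_zero_or_pos (i - 1) with h1 | h1
      · rw [h1] at hadj
        exact mW ⟨_, hw, hadj⟩
      · exact hmin (i - 1) h1 (by omega) ⟨_, hw, hadj⟩
  set Y : Set V := {w | ∃ t, 1 ≤ t ∧ t ≤ m - 1 ∧ w = q t} with hYdef
  have YR : Y ⊆ R₀ := by
    rintro w ⟨t, h1, h2, rfl⟩
    exact hqR t h1 (by omega)
  have py : PathIn G Y (q 0) (q m) m :=
    ⟨q, hq, rfl, rfl, fun i h0 hi => ⟨i, h0, by omega, rfl⟩⟩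
  have YW : Anti G Y (Ws I₁ I₂ c l) := by
    rintro w ⟨t, h1, h2, rfl⟩ x hx
    exact ⟨fun e => hqW t (by omega) (e ▸ hx), fun e => hmin t h1 (by omega) ⟨x, hx, e⟩⟩
  have Yc : Conn G Y := by
    rcases Nat.lt_or_ge m 2 with h2 | h2
    · intro X hX _ _ w ⟨t, h1, h2, _⟩
      omega
    · exact Conn.segment (fun t h1 h3 => hq.adj (by omega)) (by omega)
  have hlast : 2 ≤ m → q (m - 1) ∈ Y ∧ G.Adj (q m) (q (m - 1)) := by
    intro h2
    have hadj := hq.adj (i := m - 1) (by omega)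
    rw [show m - 1 + 1 = m by omega] at hadj
    exact ⟨⟨m - 1, by omega, le_rfl, rfl⟩, hadj.symm⟩
  have eY : Y.Nonempty → Hits G (q m) Y := by
    rintro ⟨w, t, h1, h2, rfl⟩
    exact ⟨_, hlast (by omega)⟩
  have conn : Conn G (insert (q m) Y) := by
    rcases Nat.lt_or_ge m 2 with h2 | h2
    · have : Y = ∅ := by
        ext w
        simp only [hYdef, Set.mem_ofPred_eq, Set.mem_empty_iff_false, iff_false]
        rintro ⟨t, h1, h2, _⟩
        omega
      rw [this, insert_empty_eq]
      exact Conn.singleton _ _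
    · exact Yc.insert (hlast h2).1 (hlast h2).2
  have ye : Hits G (q 0) (insert (q m) Y) := by
    refine ⟨q 1, ?_, hq.adj (by omega)⟩
    rcases eq_or_ne m 1 with rfl | hne
    · exact Or.inl rfl
    · exact Or.inr ⟨1, le_rfl, by omega, rfl⟩
  have a1 := hc.anti_y hy n1
  have a2 := hc.swap.anti_y hy n2
  have I1W : I₁ ⊆ Ws I₁ I₂ c l := fun _ h => Or.inl (Or.inl h)
  have I2W : I₂ ⊆ Ws I₁ I₂ c l := fun _ h => Or.inl (Or.inr h)
  have two : ∀ t t', t ∈ NA G a b ∪ NA G b a → t' ∈ NA G a b ∪ NA G b a → t ≠ t' → ¬ G.Adj t t' →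
      Hits G t (Ws I₁ I₂ c l) → Hits G t' (Ws I₁ I₂ c l) → Hits G t Y → Hits G t' Y → False :=
    fun t t' ht ht' hne hna k1 k2 k3 k4 => no_two_sides hc.ehf hc.ab (YR.trans hc.sub)
      (h.sub_Ws.trans hc.sub) Yc h.conn_Ws YW ht ht' hne hna k3 k4 k1 k2
  have hu1 := (hc.link₁.hits hc.ehf hc.ab).mono I1W
  have hv1 := (hc.link₁.symm.hits hc.ehf hc.ab.symm).mono I1W
  have hu2 := (hc.link₂.hits hc.ehf hc.ab).mono I2W
  have hv2 := (hc.link₂.symm.hits hc.ehf hc.ab.symm).mono I2W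
  have to_anti : ∀ t, t ∈ NA G a b ∪ NA G b a → ¬ Hits G t Y → Anti G Y {t} := by
    intro t ht hh
    exact (anti_of_not_hits hh fun h' => RR_ne_NA ht (hc.sub (YR h')) rfl).symm
  have mu1 : u₁ ∈ NA G a b ∪ NA G b a := Or.inl hc.link₁.1
  have mv1 : v₁ ∈ NA G a b ∪ NA G b a := Or.inr hc.link₁.2.1
  have mu2 : u₂ ∈ NA G a b ∪ NA G b a := Or.inl hc.link₂.1
  have mv2 : v₂ ∈ NA G a b ∪ NA G b a := Or.inr hc.link₂.2.1
  have pu : u₁ ∈ PV u₁ v₁ I₁ := Or.inl rfl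
  have pv : v₁ ∈ PV u₁ v₁ I₁ := Or.inr (Or.inl rfl)
  have pu' : u₂ ∈ PV u₂ v₂ I₂ := Or.inl rfl
  have pv' : v₂ ∈ PV u₂ v₂ I₂ := Or.inr (Or.inl rfl)
  have d1 := NA_anti hc.ehf hc.ab hc.link₁.1 hc.link₁.2.1
  have d2 := NA_anti hc.ehf hc.ab hc.link₂.1 hc.link₂.2.1
  by_cases k2 : Hits G u₂ Y ∨ Hits G v₂ Y
  · have : ¬ Hits G u₁ Y ∧ ¬ Hits G v₁ Y := by
      rcases k2 with k | k
      · exact ⟨fun k' => two _ _ mu1 mu2 (hc.anti _ pu _ pu').1 (hc.anti _ pu _ pu').2 hu1 hu2 k' k,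
          fun k' => two _ _ mv1 mu2 (hc.anti _ pv _ pu').1 (hc.anti _ pv _ pu').2 hv1 hu2 k' k⟩
      · exact ⟨fun k' => two _ _ mu1 mv2 (hc.anti _ pu _ pv').1 (hc.anti _ pu _ pv').2 hu1 hv2 k' k,
          fun k' => two _ _ mv1 mv2 (hc.anti _ pv _ pv').1 (hc.anti _ pv _ pv').2 hv1 hv2 k' k⟩
    have hW := Ws_swap I₁ I₂ c l
    exact ZD.false (m := m) (Y := Y) ⟨h.swap, hy, a2, a1, by rwa [hW], hqR m (by omega) le_rfl, YR, py, hm,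
      by rwa [hW], conn, eY, Yc, ye, by rw [hW]; exact hqW m le_rfl, by rwa [hW], to_anti _ mu1 this.1,
      to_anti _ mv1 this.2⟩
  · push Not at k2
    exact ZD.false (m := m) (Y := Y) ⟨h, hy, a1, a2, hyW, hqR m (by omega) le_rfl, YR, py, hm, YW, conn, eY, Yc,
      ye, hqW m le_rfl, hT, to_anti _ mu2 k2.1, to_anti _ mv2 k2.2⟩

theorem Core.adj_leaf (h : Core G a b R₀ u₁ v₁ I₁ u₂ v₂ I₂ c l) {y : V}
    (mW : ¬ Hits G y (Ws I₁ I₂ c l)) (h1 : Hits G y (PV u₁ v₁ I₁)) :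
    ∃ t, (t = u₁ ∨ t = v₁) ∧ G.Adj y t := by
  obtain ⟨w, rfl | rfl | hw, e⟩ := h1
  · exact ⟨_, Or.inl rfl, e⟩
  · exact ⟨_, Or.inr rfl, e⟩
  · exact absurd ⟨w, Or.inl (Or.inl hw), e⟩ mW

theorem Core.not_split (h : Core G a b R₀ u₁ v₁ I₁ u₂ v₂ I₂ c l) {y₁ y₂ : V}
    (h1 : y₁ ∈ ZZ G a b) (h2 : y₂ ∈ ZZ G a b) (hne : y₁ ≠ y₂) (hna : ¬ G.Adj y₁ y₂)
    (r1 : Hits G y₁ R₀) (k1 : Hits G y₁ (PV u₁ v₁ I₁)) (k2 : Hits G y₂ (PV u₂ v₂ I₂))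
    (n1 : ¬ Hits G y₁ (PV u₂ v₂ I₂)) (n2 : ¬ Hits G y₂ (PV u₁ v₁ I₁)) : False := by
  have hc := h.cfg
  have mW2 := h.miss_Ws h2 n2
  have mW1 : ¬ Hits G y₁ (Ws I₁ I₂ c l) := by
    rw [← Ws_swap]
    exact h.swap.miss_Ws h1 n1
  obtain ⟨t, ht, et⟩ := h.adj_leaf mW1 k1
  obtain ⟨t', ht', et'⟩ := h.swap.adj_leaf (by rwa [Ws_swap]) k2
  have I1W : I₁ ⊆ Ws I₁ I₂ c l := fun _ h => Or.inl (Or.inl h)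
  have I2W : I₂ ⊆ Ws I₁ I₂ c l := fun _ h => Or.inl (Or.inr h)
  refine (leaves_miss hc.ehf hc.sub hc.conn h.sub_Ws h.conn_Ws h1 h2 hne hna mW1 mW2 (x₁ := t)
    (x₂ := t') ?_ ?_ et et' (fun e => n1 ⟨t', ?_, e⟩) (fun e => n2 ⟨t, ?_, e⟩) ?_ ?_).1 r1
  · rcases ht with rfl | rfl
    · exact Or.inl hc.link₁.1
    · exact Or.inr hc.link₁.2.1
  · rcases ht' with rfl | rfl
    · exact Or.inl hc.link₂.1
    · exact Or.inr hc.link₂.2.1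
  · rcases ht' with rfl | rfl <;> simp [PV]
  · rcases ht with rfl | rfl <;> simp [PV]
  · rcases ht with rfl | rfl
    · exact (hc.link₁.hits hc.ehf hc.ab).mono I1W
    · exact (hc.link₁.symm.hits hc.ehf hc.ab.symm).mono I1W
  · rcases ht' with rfl | rfl
    · exact (hc.link₂.hits hc.ehf hc.ab).mono I2W
    · exact (hc.link₂.symm.hits hc.ehf hc.ab.symm).mono I2W

/-- Two common neighbours of `a, b` attached to `R₀` are adjacent. -/
theorem Cfg.adj_of_hits (hc : Cfg G a b R₀ u₁ v₁ I₁ u₂ v₂ I₂) {y₁ y₂ : V}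
    (h1 : y₁ ∈ ZZ G a b) (h2 : y₂ ∈ ZZ G a b) (hne : y₁ ≠ y₂) (hna : ¬ G.Adj y₁ y₂)
    (r1 : Hits G y₁ R₀) (r2 : Hits G y₂ R₀) : False := by
  obtain ⟨c, l, h⟩ := hc.exists_core
  have nb1 : ¬ (Hits G y₁ (PV u₁ v₁ I₁) ∧ Hits G y₂ (PV u₁ v₁ I₁)) := fun h' =>
    hc.link₁.not_both hc.ehf hc.ab hc.sub hc.conn h1 h2 hne hna h'.1 h'.2 (Or.inl r1)
  have nb2 : ¬ (Hits G y₁ (PV u₂ v₂ I₂) ∧ Hits G y₂ (PV u₂ v₂ I₂)) := fun h' =>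
    hc.link₂.not_both hc.ehf hc.ab hc.sub hc.conn h1 h2 hne hna h'.1 h'.2 (Or.inl r1)
  have z1 := h.hits_PV h1 r1
  have z2 := h.hits_PV h2 r2
  rcases z1 with k1 | k1 <;> rcases z2 with k2 | k2
  · exact nb1 ⟨k1, k2⟩
  · exact h.not_split h1 h2 hne hna r1 k1 k2 (fun h' => nb2 ⟨h', k2⟩) (fun h' => nb1 ⟨k1, h'⟩)
  · exact h.swap.not_split h1 h2 hne hna r1 k1 k2 (fun h' => nb1 ⟨h', k2⟩)
      (fun h' => nb2 ⟨k1, h'⟩)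
  · exact nb2 ⟨k1, k2⟩

end

section
variable {G : SimpleGraph V} {a b : V} {R₀ : Set V} {u₁ v₁ : V} {I₁ : Set V} {u₂ v₂ : V}
    {I₂ : Set V}

/-- `z` is neither in `F` nor adjacent to a vertex of `F`. -/
def Out (G : SimpleGraph V) (F : Set V) (z : V) : Prop := z ∉ F ∧ ¬ Hits G z F

theorem Out.anti {F : Set V} {z : V} (h : Out G F z) : Anti G {z} F :=
  anti_of_not_hits h.2 h.1

theorem anti_of_out {F X : Set V} (h : ∀ z ∈ X, Out G F z) : Anti G X F := by
  intro z hz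
  exact (h z hz).anti z rfl

theorem Out.ne {F : Set V} {z w : V} (h : Out G F z) (hw : Hits G w F) : w ≠ z := by
  rintro rfl
  exact h.2 hw

theorem even_inner (hG : EvenHoleFree G) (hab : G.Adj a b) (hR : R₀ ⊆ RR G a b)
    (hR0 : Conn G R₀) {x w : V} (hx : x ∈ NA G a b) (hw : w ∈ NA G b a)
    (rx : Hits G x R₀) (rw : Hits G w R₀) : ∃ n, 2 ≤ n ∧ Even n ∧ PathIn G R₀ x w n := by
  have h := NA_anti hG hab hx hw
  obtain ⟨n, hn, p⟩ := hR0.path rx rw h.1 h.2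
  exact ⟨n, hn, even_of_NA hG hab hR p hx hw, p⟩

theorem odd_outer (hG : EvenHoleFree G) (hab : G.Adj a b) (hR : R₀ ⊆ RR G a b)
    (hR0 : Conn G R₀) {x w : V} (hx : x ∈ NA G a b) (hw : w ∈ NA G b a)
    (rx : Hits G x R₀) (rw : Hits G w R₀) {F : Set V} {n : ℕ} (h : PathIn G F x w n)
    (hF : ∀ z ∈ F, Out G R₀ z) : Odd n := by
  have h' := NA_anti hG hab hx hw
  obtain ⟨m, hm, em, p⟩ := even_inner hG hab hR hR0 hx hw rx rw
  have := PathIn.hole hG h p (h.two_le h'.1 h'.2) hm (anti_of_out hF)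
  rw [Nat.odd_add] at this
  exact this.2 em

theorem Cfg.hits_u (hc : Cfg G a b R₀ u₁ v₁ I₁ u₂ v₂ I₂) : Hits G u₁ R₀ :=
  (hc.link₁.hits hc.ehf hc.ab).mono hc.link₁.2.2.1

theorem Cfg.hits_v (hc : Cfg G a b R₀ u₁ v₁ I₁ u₂ v₂ I₂) : Hits G v₁ R₀ :=
  hc.flip.hits_u

/-- No vertex `c` complete to the `a`-ends and `t` complete to the `b`-ends of the two links,
when there are no further edges. -/
theorem Cfg.two_links (hc : Cfg G a b R₀ u₁ v₁ I₁ u₂ v₂ I₂) {c t : V} (c1 : G.Adj c u₁)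
    (c2 : G.Adj c u₂) (t1 : G.Adj t v₁) (t2 : G.Adj t v₂) (hti1 : Anti G {t} I₁)
    (hti2 : Anti G {t} I₂) (htu1 : Anti G {t} {u₁}) (htu2 : Anti G {t} {u₂})
    (hci1 : Anti G {c} I₁) (hci2 : Anti G {c} I₂) (hcv1 : Anti G {c} {v₁})
    (hcv2 : Anti G {c} {v₂}) (hct : Anti G {c} {t}) : False := by
  obtain ⟨n, hn, en, p⟩ := hc.link₁.path hc.ehf hc.ab hc.sub
  obtain ⟨m, hm, em, q⟩ := hc.link₂.path hc.ehf hc.ab hc.sub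
  have hu := hc.leaves_ne
  have p1 := p.concat (PathIn.one t1.symm) (by omega) le_rfl (by
    simp only [insert_empty_eq, anti_insert_left]
    exact ⟨htu1.symm, hti1.symm⟩)
  have p2 := p1.concat (PathIn.one t2) (by omega) le_rfl
    (hc.anti.mono (by intro z hz; simp at hz; simp [PV]; tauto) (by simp [PV]))
  have p3 := p2.concat q.symm (by omega) (by omega) (by
    refine Anti.mono (X := PV u₁ v₁ I₁ ∪ {t}) (Y := insert u₂ I₂) ?_
      (by intro z hz; simp at hz; simp [PV]; tauto) subset_rfl
    rw [anti_union_left]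
    exact ⟨hc.anti.mono subset_rfl (by intro z hz; simp at hz; simp [PV]; tauto),
      anti_insert_right.2 ⟨htu2, hti2⟩⟩)
  have := odd_of_center hc.ehf p3 c1 c2 hu.1 hu.2 (by
    simp only [anti_union_right, hci1, hci2, hcv1, hcv2, hct, anti_empty_left.symm, and_self])
  revert this
  simp only [imp_false, Nat.not_odd_iff_even]
  have := en.add em
  rw [Nat.even_iff] at this ⊢
  omega

/-- A private neighbour of `b` not attached to `R₀` misses one of the `b`-ends. -/
theorem Cfg.exists_miss (hc : Cfg G a b R₀ u₁ v₁ I₁ u₂ v₂ I₂) {t : V} (ht : t ∈ NA G b a)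
    (ho : Out G R₀ t) : ∃ v ∈ NA G b a, Hits G v R₀ ∧ ¬ G.Adj v t := by
  by_contra h
  push Not at h
  have t1 := h _ hc.link₁.2.1 hc.hits_v
  have t2 := h _ hc.link₂.2.1 hc.swap.hits_v
  have aR := (anti_left_RR G a b).mono subset_rfl hc.sub
  refine hc.two_links hc.link₁.1.1 hc.link₂.1.1 t1.symm t2.symm
    (ho.anti.mono subset_rfl hc.link₁.2.2.1) (ho.anti.mono subset_rfl hc.link₂.2.2.1)
    (anti_singleton.2 (NA_anti hc.ehf hc.ab.symm ht hc.link₁.1))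
    (anti_singleton.2 (NA_anti hc.ehf hc.ab.symm ht hc.link₂.1))
    (aR.mono subset_rfl hc.link₁.2.2.1) (aR.mono subset_rfl hc.link₂.2.2.1)
    (anti_NA _ _ _ hc.link₁.2.1) (anti_NA _ _ _ hc.link₂.2.1) (anti_NA _ _ _ ht)

/-- A shortest path from `y` to a vertex attached to `R₀`, avoiding the closed neighbourhood
of `a` after `y`. -/
structure Esc (G : SimpleGraph V) (a b : V) (R₀ : Set V) (y : V) (p : ℕ → V) (k : ℕ) : Prop where
  ip : IP G p k
  zero : p 0 = y
  na : ∀ i, 0 < i → i ≤ k → p i ≠ a ∧ ¬ G.Adj a (p i)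
  pos : 0 < k
  out : ∀ i < k, Out G R₀ (p i)
  hit : Hits G (p k) R₀
  last : p k ∈ NA G b a
  far : ∀ v ∈ NA G b a, Hits G v R₀ → ∀ i, i + 1 < k → ¬ G.Adj (p i) v

/-- There is a walk from `y` to a vertex attached to `R₀`, avoiding the closed neighbourhood
of `a` after `y`. -/
def Ext (G : SimpleGraph V) (a : V) (R₀ : Set V) (y : V) : Prop :=
  ∃ n, ∃ p : ℕ → V, p 0 = y ∧ (∀ i < n, G.Adj (p i) (p (i + 1))) ∧
    (∀ i, 0 < i → i ≤ n → p i ∈ {v | v ≠ a ∧ ¬ G.Adj a v}) ∧ Hits G (p n) R₀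

theorem Cfg.exists_esc (hc : Cfg G a b R₀ u₁ v₁ I₁ u₂ v₂ I₂) {y : V} (hy : y ∈ ZZ G a b)
    (hy' : ¬ Hits G y R₀) (he : Ext G a R₀ y) : ∃ p k, Esc G a b R₀ y p k := by
  obtain ⟨k, p, ip, p0, na, hit, nohit, hmin⟩ := exists_shortest G y _ (fun v => Hits G v R₀) he
  have kpos : 0 < k := by
    rcases Nat.eq_zero_or_pos k with rfl | h
    · exact absurd (p0 ▸ hit) hy'
    · exact h
  have nR : ∀ i ≤ k, p i ∉ R₀ := by
    intro i hi hR
    rcases Nat.eq_zero_or_pos i with rfl | h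
    · exact (hc.sub hR).2.2.1 (p0 ▸ hy.1)
    · have := ip.adj (i := i - 1) (by omega)
      rw [show i - 1 + 1 = i by omega] at this
      exact nohit (i - 1) (by omega) ⟨_, hR, this⟩
  have hk := na k kpos le_rfl
  refine ⟨p, k, ip, p0, na, kpos, fun i hi => ⟨nR i hi.le, nohit i hi⟩, hit, ⟨?_, hk.2, hk.1⟩, ?_⟩
  · by_contra hb
    obtain ⟨z, hz, e⟩ := hit
    exact nR k le_rfl (hc.closed z hz _ ⟨hk.1, fun e => hk.2 (e ▸ hc.ab), hk.2, hb⟩ e.symm)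
  · intro v hv hvR i hi e
    have := hmin (i + 1) (fun j => if j ≤ i then p j else v) (by simp [p0]) ?_ ?_ (by simpa using hvR)
    · omega
    · intro j hj
      rcases Nat.lt_or_ge j i with h | h
      · simp only [h.le, show j + 1 ≤ i by omega, if_true]
        exact ip.adj (by omega)
      · obtain rfl : j = i := by omega
        simpa using e
    · intro j h0 hj
      by_cases h : j ≤ i
      · simp only [h, if_true]
        exact na j h0 (by omega)
      · simp only [h, if_false]
        exact ⟨hv.2.2, hv.2.1⟩

variable {y : V} {p : ℕ → V} {k : ℕ}

theorem Esc.ne_b (h : Esc G a b R₀ y p k) (hab : G.Adj a b) {i : ℕ} (h0 : 0 < i) (hi : i ≤ k) :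
    p i ≠ b :=
  fun e => (h.na i h0 hi).2 (e ▸ hab)

/-- An attached private neighbour of `a` has no neighbour on the escape path after `y`. -/
theorem Cfg.esc_miss (hc : Cfg G a b R₀ u₁ v₁ I₁ u₂ v₂ I₂) (h : Esc G a b R₀ y p k) {x : V}
    (hx : x ∈ NA G a b) (rx : Hits G x R₀) {d : ℕ} (d0 : 0 < d) (dk : d ≤ k) :
    ¬ G.Adj x (p d) := by
  classical
  intro e
  obtain ⟨d, ⟨⟨d0, dk⟩, e⟩, dmax⟩ : ∃ d, ((0 < d ∧ d ≤ k) ∧ G.Adj x (p d)) ∧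
      ∀ d', d < d' → d' ≤ k → ¬ G.Adj x (p d') := by
    have hP : ∃ m, m ≤ k ∧ 0 < k - m ∧ G.Adj x (p (k - m)) :=
      ⟨k - d, by omega, by omega, by rwa [show k - (k - d) = d by omega]⟩
    obtain ⟨h1, h2, h3⟩ := Nat.find_spec hP
    refine ⟨k - Nat.find hP, ⟨⟨h2, by omega⟩, h3⟩, fun d' h4 h5 h6 => ?_⟩
    exact Nat.find_min hP (m := k - d') (by omega)
      ⟨by omega, by omega, by rwa [show k - (k - d') = d' by omega]⟩
  have hdk : d < k := by
    rcases dk.lt_or_eq with h' | rfl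
    · exact h'
    · exact absurd e (NA_anti hc.ehf hc.ab hx h.last).2
  have hdb : ¬ G.Adj b (p d) := fun e' =>
    (NA_anti hc.ehf hc.ab hx ⟨e', (h.na d d0 dk).2, (h.na d d0 dk).1⟩).2 e
  have hF : ∃ f, d ≤ f ∧ f ≤ k ∧ G.Adj b (p f) := ⟨k, dk, le_rfl, h.last.1⟩
  obtain ⟨hdf, hfk, ef⟩ := Nat.find_spec hF
  have hmin : ∀ t, d ≤ t → t < Nat.find hF → ¬ G.Adj b (p t) := fun t h1 h2 h3 =>
    Nat.find_min hF h2 ⟨h1, by omega, h3⟩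
  set f := Nat.find hF
  have hdf' : d < f := lt_of_le_of_ne hdf (by rintro h'; exact hdb (h' ▸ ef))
  have hpf : p f ∈ NA G b a := ⟨ef, (h.na f (by omega) hfk).2, (h.na f (by omega) hfk).1⟩
  have q := PathIn.cons e (PathIn.sub h.ip hdf hfk) (by omega) (by
    rintro _ rfl z (rfl | ⟨t, h1, h2, rfl⟩)
    · exact NA_anti hc.ehf hc.ab hx hpf
    · exact ⟨(h.out t (by omega)).ne rx, dmax t h1 (by omega)⟩)
  have hsub : ∀ z ∈ insert (p d) {v | ∃ t, d < t ∧ t < f ∧ v = p t},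
      ∃ t, d ≤ t ∧ t < f ∧ z = p t := by
    rintro z (rfl | ⟨t, h1, h2, rfl⟩)
    · exact ⟨d, le_rfl, hdf', rfl⟩
    · exact ⟨t, h1.le, h2, rfl⟩
  have ev := even_of_NA hc.ehf hc.ab (fun z hz => by
    obtain ⟨t, h1, h2, rfl⟩ := hsub z hz
    have := h.na t (by omega) (by omega)
    exact ⟨this.1, h.ne_b hc.ab (by omega) (by omega), this.2, hmin t h1 h2⟩) q hx hpf
  have hout : ∀ z ∈ insert (p d) {v | ∃ t, d < t ∧ t < f ∧ v = p t}, Out G R₀ z := fun z hz => by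
    obtain ⟨t, h1, h2, rfl⟩ := hsub z hz
    exact h.out t (by omega)
  rcases hfk.lt_or_eq with hfk' | hfk'
  · obtain ⟨v, hv, rv, ev'⟩ := hc.exists_miss hpf (h.out f hfk')
    have hxv := NA_anti hc.ehf hc.ab hx hv
    have q1 := q.concat (PathIn.one ef.symm) (by omega) le_rfl (by
      simp only [insert_empty_eq]
      rintro z (rfl | hz) _ rfl
      · exact ⟨hx.2.2, fun e => hx.2.1 e.symm⟩
      · obtain ⟨t, h1, h2, rfl⟩ := hsub z hz
        exact ⟨h.ne_b hc.ab (by omega) (by omega), fun e => hmin t h1 h2 e.symm⟩)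
    have q2 := q1.concat (PathIn.one hv.1) (by omega) le_rfl (by
      simp only [insert_empty_eq]
      rintro z (rfl | ((hz | hz) | rfl)) _ rfl
      · exact hxv
      · obtain ⟨t, h1, h2, rfl⟩ := hsub z hz
        exact ⟨((h.out t (by omega)).ne rv).symm, h.far _ hv rv t (by omega)⟩
      · exact absurd hz (by simp)
      · exact ⟨((h.out f (by omega)).ne rv).symm, fun e => ev' e.symm⟩)
    have := odd_outer hc.ehf hc.ab hc.sub hc.conn hx hv rx rv q2 (by
      have hb : Out G R₀ b :=
        ⟨fun h' => (hc.sub h').2.1 rfl, fun ⟨z, hz, e⟩ => (hc.sub hz).2.2.2 e⟩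
      rintro z (((( hz | hz) | rfl) | hz) | rfl)
      · exact hout z hz
      · exact absurd hz (by simp)
      · exact h.out f hfk'
      · exact absurd hz (by simp)
      · exact hb)
    revert this ev
    simp [parity_simps]
  · have := odd_outer hc.ehf hc.ab hc.sub hc.conn hx hpf rx (by rw [hfk']; exact h.hit) q hout
    exact (Nat.not_even_iff_odd.2 this) ev

/-- The parity of the escape path determines the neighbours of `y`. -/
theorem Cfg.esc_odd (hc : Cfg G a b R₀ u₁ v₁ I₁ u₂ v₂ I₂) (hy : y ∈ ZZ G a b)
    (h : Esc G a b R₀ y p k) {x : V} (hx : x ∈ NA G a b) (rx : Hits G x R₀) :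
    Odd k ↔ ¬ G.Adj x y := by
  have hq := PathIn.of_ip h.ip
  rw [h.zero] at hq
  have oy : Out G R₀ y := h.zero ▸ h.out 0 h.pos
  have hxy := NA_anti hc.ehf hc.ab hx h.last
  have hyx : y ≠ x := ZZ_ne_NA (Or.inl hx) hy
  obtain ⟨m, hm, em, q⟩ := even_inner hc.ehf hc.ab hc.sub hc.conn hx h.last rx h.hit
  have hk := h.pos
  by_cases e : G.Adj x y
  · have q' := PathIn.cons e hq (by omega) (by
      rintro _ rfl z (rfl | ⟨t, h1, h2, rfl⟩)
      · exact hxy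
      · exact ⟨(h.out t (by omega)).ne rx, hc.esc_miss h hx rx h1 (by omega)⟩)
    have := odd_outer hc.ehf hc.ab hc.sub hc.conn hx h.last rx h.hit q' (by
      rintro z (rfl | ⟨t, h1, h2, rfl⟩)
      · exact oy
      · exact h.out t (by omega))
    simp only [e, not_true_eq_false, iff_false]
    intro h'
    rw [Nat.odd_add_one] at this
    exact this h'
  · have q' := hq.concat q.symm (by omega) (by omega) (by
      rw [anti_insert_right]
      constructor
      · rintro z (rfl | ⟨t, h1, h2, rfl⟩) _ rfl
        · exact ⟨hyx, fun e' => e e'.symm⟩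
        · exact ⟨((h.out t (by omega)).ne rx).symm, fun e =>
            hc.esc_miss h hx rx h1 (by omega) e.symm⟩
      · apply anti_of_out
        rintro z (rfl | ⟨t, h1, h2, rfl⟩)
        · exact oy
        · exact h.out t (by omega))
    have := odd_of_center hc.ehf q' hy.1 hx.1 hyx (fun e' => e e'.symm) (by
      rintro _ rfl z ((⟨t, h1, h2, rfl⟩ | hz) | rfl)
      · have := h.na t h1 h2.le
        exact ⟨this.1.symm, this.2⟩
      · exact anti_left_RR G _ b _ rfl z (hc.sub hz)
      · exact ⟨h.last.2.2.symm, h.last.2.1⟩)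
    simp only [e, not_false_iff, iff_true]
    rw [Nat.odd_add] at this
    exact this.2 em

end

theorem IP.join {G : SimpleGraph V} {p q : ℕ → V} {n m : ℕ} (hp : IP G p n) (hq : IP G q m)
    (e : G.Adj (p n) (q 0))
    (h : ∀ s ≤ n, ∀ t ≤ m, p s ≠ q t ∧ (G.Adj (p s) (q t) → s = n ∧ t = 0)) :
    IP G (fun t => if t ≤ n then p t else q (t - n - 1)) (n + m + 1) := by
  have key : ∀ s ≤ n, ∀ t ≤ m, p s ≠ q t ∧ (G.Adj (p s) (q t) ↔ s = n ∧ t = 0) :=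
    fun s hs t ht => ⟨(h s hs t ht).1, (h s hs t ht).2, by rintro ⟨rfl, rfl⟩; exact e⟩
  intro i j hi hj
  rcases Nat.lt_or_ge n i with h1 | h1 <;> rcases Nat.lt_or_ge n j with h2 | h2
  · simp only [not_le.2 h1, not_le.2 h2, if_false]
    have := hq (i - n - 1) (j - n - 1) (by omega) (by omega)
    refine ⟨fun e => ?_, ?_⟩
    · have := this.1 e
      omega
    · rw [this.2]
      omega
  · simp only [not_le.2 h1, h2, if_false, if_true]
    have := key j h2 (i - n - 1) (by omega)
    refine ⟨fun e => absurd e.symm this.1, ?_⟩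
    rw [G.adj_comm, this.2]
    omega
  · simp only [h1, not_le.2 h2, if_false, if_true]
    have := key i h1 (j - n - 1) (by omega)
    refine ⟨fun e => absurd e this.1, ?_⟩
    rw [this.2]
    omega
  · simp only [h1, h2, if_true]
    exact hp i j h1 h2

section
variable {G : SimpleGraph V} {a b : V} {R₀ : Set V} {u₁ v₁ : V} {I₁ : Set V} {u₂ v₂ : V}
    {I₂ : Set V} {y : V} {p p' : ℕ → V} {k k' : ℕ}

theorem Cfg.tail_odd (hc : Cfg G a b R₀ u₁ v₁ I₁ u₂ v₂ I₂) {r : ℕ → V} {N F : ℕ}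
    (ip : IP G r N) (h0 : r 0 ∈ NA G b a) (r0 : Hits G (r 0) R₀) (hN : r N ∈ NA G a b)
    (rN : Hits G (r N) R₀) (out : ∀ t, 0 < t → t < N → Out G R₀ (r t)) (hFN : F < N)
    (hF : r F ∈ NA G b a) (hb : ∀ t, F < t → t ≤ N → b ≠ r t ∧ ¬ G.Adj b (r t))
    (hv : F ≠ 0 → ∀ v ∈ NA G b a, Hits G v R₀ → ∀ t, F < t → t < N → ¬ G.Adj (r t) v) :
    Odd (N - F) := by
  have q := (PathIn.sub ip hFN.le le_rfl).symm
  have hout : ∀ z ∈ {v | ∃ t, F < t ∧ t < N ∧ v = r t}, Out G R₀ z := by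
    rintro z ⟨t, h1, h2, rfl⟩
    exact out t (by omega) h2
  rcases Nat.eq_zero_or_pos F with rfl | hF0
  · exact odd_outer hc.ehf hc.ab hc.sub hc.conn hN h0 rN r0 q hout
  · have oF := out F hF0 hFN
    obtain ⟨v, hv', rv, ev⟩ := hc.exists_miss hF oF
    have q1 := q.concat (PathIn.one hF.1.symm) (by omega) le_rfl (by
      simp only [insert_empty_eq]
      rintro z (rfl | ⟨t, h1, h2, rfl⟩) _ rfl
      · have := hb N hFN le_rfl
        exact ⟨this.1.symm, fun e => this.2 e.symm⟩
      · have := hb t h1 h2.le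
        exact ⟨this.1.symm, fun e => this.2 e.symm⟩)
    have q2 := q1.concat (PathIn.one hv'.1) (by omega) le_rfl (by
      simp only [insert_empty_eq]
      rintro z (rfl | ((⟨t, h1, h2, rfl⟩ | hz) | rfl)) _ rfl
      · exact NA_anti hc.ehf hc.ab hN hv'
      · exact ⟨((out t (by omega) h2).ne rv).symm, hv (by omega) _ hv' rv t h1 h2⟩
      · exact absurd hz (by simp)
      · exact ⟨(oF.ne rv).symm, fun e => ev e.symm⟩)
    have := odd_outer hc.ehf hc.ab hc.sub hc.conn hN hv' rN rv q2 (by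
      have hb : Out G R₀ b :=
        ⟨fun h' => (hc.sub h').2.1 rfl, fun ⟨z, hz, e⟩ => (hc.sub hz).2.2.2 e⟩
      rintro z ((((hz | hz) | rfl) | hz) | rfl)
      · exact hout z hz
      · exact absurd hz (by simp)
      · exact oF
      · exact absurd hz (by simp)
      · exact hb)
    rw [Nat.odd_iff] at this ⊢
    omega

/-- Two escape paths of odd length, for the two vertices `a`, `b`, cannot both exist. -/
theorem Cfg.not_odd_odd (hc : Cfg G a b R₀ u₁ v₁ I₁ u₂ v₂ I₂) (hy : y ∈ ZZ G a b)
    (h : Esc G a b R₀ y p k) (h' : Esc G b a R₀ y p' k') (hk : Odd k) (hk' : Odd k') : False := by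
  classical
  have kpos := h.pos
  have kpos' := h'.pos
  have oy : Out G R₀ y := h.zero ▸ h.out 0 h.pos
  have hA : ∀ i, 0 < i → i ≤ k → ∀ j, 0 < j → j ≤ k' → p i = p' j →
      i < k ∧ G.Adj (p (i + 1)) (p' j) := by
    intro i i0 ik j j0 jk e
    have hi : i < k := by
      rcases ik.lt_or_eq with h1 | rfl
      · exact h1
      · exfalso
        rcases jk.lt_or_eq with h2 | rfl
        · exact (h'.out j h2).2 (e ▸ h.hit)
        · exact (NA_anti hc.ehf hc.ab h'.last h.last).1 e.symm
    exact ⟨hi, e ▸ (h.ip.adj hi).symm⟩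
  by_cases hT : ∃ m, m < k ∧ ∃ j, 0 < j ∧ j ≤ k' ∧ G.Adj (p (k - m)) (p' j)
  · -- the last vertex of `p` with a neighbour on `p'`
    obtain ⟨i, i0, ik, hi, imax⟩ : ∃ i, 0 < i ∧ i ≤ k ∧ (∃ j, 0 < j ∧ j ≤ k' ∧ G.Adj (p i) (p' j)) ∧
        ∀ i', i < i' → i' ≤ k → ∀ j, 0 < j → j ≤ k' → ¬ G.Adj (p i') (p' j) := by
      obtain ⟨h1, h2⟩ := Nat.find_spec hT
      refine ⟨k - Nat.find hT, by omega, by omega, h2, fun i' h3 h4 j h5 h6 h7 => ?_⟩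
      exact Nat.find_min hT (m := k - i') (by omega)
        ⟨by omega, j, h5, h6, by rwa [show k - (k - i') = i' by omega]⟩
    obtain ⟨j, j0, jk, ej, jmax⟩ : ∃ j, 0 < j ∧ j ≤ k' ∧ G.Adj (p i) (p' j) ∧
        ∀ j', j < j' → j' ≤ k' → ¬ G.Adj (p i) (p' j') := by
      have hP : ∃ m, m < k' ∧ G.Adj (p i) (p' (k' - m)) := by
        obtain ⟨j, h1, h2, h3⟩ := hi
        exact ⟨k' - j, by omega, by rwa [show k' - (k' - j) = j by omega]⟩
      obtain ⟨h1, h2⟩ := Nat.find_spec hP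
      refine ⟨k' - Nat.find hP, by omega, by omega, h2, fun j' h3 h4 h5 => ?_⟩
      exact Nat.find_min hP (m := k' - j') (by omega)
        ⟨by omega, by rwa [show k' - (k' - j') = j' by omega]⟩
    have hne : ∀ i', i ≤ i' → i' ≤ k → ∀ j', 0 < j' → j' ≤ k' → p i' ≠ p' j' := by
      intro i' h1 h2 j' h3 h4 e
      obtain ⟨h5, h6⟩ := hA i' (by omega) h2 j' h3 h4 e
      exact imax (i' + 1) (by omega) (by omega) j' h3 h4 h6
    have ip := IP.join (h.ip.rev.sub (i := 0) (k := k - i) (by omega))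
      (h'.ip.sub (i := j) (k := k' - j) (by omega))
      (by simpa [show k - (k - i) = i by omega] using ej) (by
        intro s hs t ht
        refine ⟨by simpa using hne (k - s) (by omega) (by omega) (j + t) (by omega) (by omega), ?_⟩
        simp only [zero_add]
        intro e
        rcases eq_or_ne s (k - i) with rfl | hs'
        · refine ⟨rfl, ?_⟩
          by_contra ht'
          rw [show k - (k - i) = i by omega] at e
          exact jmax _ (by omega) (by omega) e
        · exact absurd e (imax _ (by omega) (by omega) _ (by omega) (by omega)))
    simp only [zero_add] at ip
    set r : ℕ → V := fun t => if t ≤ k - i then p (k - t) else p' (j + (t - (k - i) - 1)) with hr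
    set N := k - i + (k' - j) + 1 with hN
    have r1 : ∀ t ≤ k - i, r t = p (k - t) := fun t ht => by simp [hr, ht]
    have r2 : ∀ t, k - i < t → r t = p' (j + (t - (k - i) - 1)) := fun t ht => by
      simp [hr, not_le.2 ht]
    have rz : r 0 = p k := by rw [r1 _ (by omega)]; simp
    have rn : r N = p' k' := by
      rw [r2 _ (by omega)]
      congr 1
      omega
    have na1 : ∀ t ≤ k - i, a ≠ r t ∧ ¬ G.Adj a (r t) := by
      intro t ht
      rw [r1 t ht]
      have := h.na (k - t) (by omega) (by omega)
      exact ⟨this.1.symm, this.2⟩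
    have nb2 : ∀ t, k - i < t → t ≤ N → b ≠ r t ∧ ¬ G.Adj b (r t) := by
      intro t ht ht'
      rw [r2 t ht]
      have := h'.na (j + (t - (k - i) - 1)) (by omega) (by omega)
      exact ⟨this.1.symm, this.2⟩
    have nb : ∀ t ≤ N, b ≠ r t := by
      intro t ht
      rcases Nat.lt_or_ge (k - i) t with h1 | h1
      · exact (nb2 t h1 ht).1
      · rw [r1 t h1]
        exact (h.ne_b hc.ab (by omega) (by omega)).symm
    have na : ∀ t ≤ N, a ≠ r t := by
      intro t ht
      rcases Nat.lt_or_ge (k - i) t with h1 | h1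
      · rw [r2 t h1]
        exact (h'.ne_b hc.ab.symm (by omega) (by omega)).symm
      · exact (na1 t h1).1
    have out : ∀ t, 0 < t → t < N → Out G R₀ (r t) := by
      intro t h1 h2
      rcases Nat.lt_or_ge (k - i) t with h3 | h3
      · rw [r2 t h3]
        exact h'.out _ (by omega)
      · rw [r1 t h3]
        exact h.out _ (by omega)
    have h0 : r 0 ∈ NA G b a := rz ▸ h.last
    have r0 : Hits G (r 0) R₀ := rz ▸ h.hit
    have hN' : r N ∈ NA G a b := rn ▸ h'.last
    have rN : Hits G (r N) R₀ := rn ▸ h'.hit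
    -- the last neighbour of `b` and the first neighbour of `a`
    obtain ⟨F, hF, eF, Fmax⟩ : ∃ F, F ≤ k - i ∧ G.Adj b (r F) ∧ ∀ t, F < t → t ≤ N → ¬ G.Adj b (r t) := by
      have hP : ∃ m, m ≤ N ∧ G.Adj b (r (N - m)) := ⟨N, le_rfl, by simpa using h0.1⟩
      obtain ⟨h1, h2⟩ := Nat.find_spec hP
      refine ⟨N - Nat.find hP, ?_, h2, fun t h3 h4 h5 => ?_⟩
      · by_contra h6
        exact (nb2 _ (by omega) (by omega)).2 h2
      · exact Nat.find_min hP (m := N - t) (by omega)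
          ⟨by omega, by rwa [show N - (N - t) = t by omega]⟩
    obtain ⟨L, hL, hL', eL, Lmin⟩ : ∃ L, k - i < L ∧ L ≤ N ∧ G.Adj a (r L) ∧
        ∀ t < L, ¬ G.Adj a (r t) := by
      have hP : ∃ m, G.Adj a (r m) := ⟨N, hN'.1⟩
      refine ⟨Nat.find hP, ?_, Nat.find_min' hP hN'.1, Nat.find_spec hP, fun t h3 =>
        Nat.find_min hP h3⟩
      by_contra h6
      exact (na1 _ (by omega)).2 (Nat.find_spec hP)
    have rF : r F ∈ NA G b a := ⟨eF, (na1 F hF).2, (na1 F hF).1.symm⟩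
    have rL : r L ∈ NA G a b := ⟨eL, (nb2 L hL hL').2, (nb L hL').symm⟩
    have e1 := even_of_NA hc.ehf hc.ab (by
      rintro z ⟨t, h1, h2, rfl⟩
      exact ⟨(na t (by omega)).symm, (nb t (by omega)).symm, Lmin t h2, Fmax t h1 (by omega)⟩)
      (PathIn.sub ip (i := F) (j := L) (by omega) hL').symm rL rF
    have e2 := odd_outer hc.ehf hc.ab hc.sub hc.conn hN' h0 rN r0 (PathIn.of_ip ip).symm (by
      rintro z ⟨t, h1, h2, rfl⟩
      exact out t h1 h2)
    have e3 := hc.tail_odd ip h0 r0 hN' rN out (F := F) (by omega) rF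
      (fun t h1 h2 => ⟨nb t h2, Fmax t h1 h2⟩) (by
        intro hF0 v hv rv t h1 h2
        rcases Nat.lt_or_ge (k - i) t with h3 | h3
        · rw [r2 t h3]
          exact fun e => hc.flip.esc_miss h' hv rv (by omega) (by omega) e.symm
        · rw [r1 t h3]
          exact h.far v hv rv _ (by omega))
    have e4 := hc.flip.tail_odd (F := N - L) ip.rev (by simpa using hN') (by simpa using rN)
      (by simpa using h0) (by simpa using r0) (fun t h1 h2 => out _ (by omega) (by omega))
      (by omega) (by simpa [show N - (N - L) = L by omega] using rL)
      (fun t h1 h2 => ⟨na _ (by omega), Lmin _ (by omega)⟩) (by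
        intro hF0 v hv rv t h1 h2
        rcases Nat.lt_or_ge (k - i) (N - t) with h3 | h3
        · rw [r2 _ h3]
          exact h'.far v hv rv _ (by omega)
        · rw [r1 _ h3]
          exact fun e => hc.esc_miss h hv rv (by omega) (by omega) e.symm)
    rw [Nat.odd_iff] at e2 e3 e4
    rw [Nat.even_iff] at e1
    omega
  · have hT' : ∀ i, 0 < i → i ≤ k → ∀ j, 0 < j → j ≤ k' → ¬ G.Adj (p i) (p' j) :=
      fun i h1 h2 j h3 h4 h5 =>
        hT ⟨k - i, by omega, j, h3, h4, by rwa [show k - (k - i) = i by omega]⟩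
    have q := PathIn.of_ip h.ip
    have q' := PathIn.of_ip h'.ip
    rw [h.zero] at q
    rw [h'.zero] at q'
    have hanti : ∀ i, 0 < i → i ≤ k → ∀ j, 0 < j → j ≤ k' → p' j ≠ p i ∧ ¬ G.Adj (p' j) (p i) := by
      intro i h1 h2 j h3 h4
      refine ⟨fun e => ?_, fun e => hT' i h1 h2 j h3 h4 e.symm⟩
      obtain ⟨h5, h6⟩ := hA i h1 h2 j h3 h4 e.symm
      exact hT' (i + 1) (by omega) (by omega) j h3 h4 h6
    have q2 := q'.symm.concat q (by omega) (by omega) (by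
      rintro z (rfl | ⟨t, h1, h2, rfl⟩) w (rfl | ⟨s, h3, h4, rfl⟩)
      all_goals exact hanti _ (by omega) (by omega) _ (by omega) (by omega))
    have := odd_outer hc.ehf hc.ab hc.sub hc.conn h'.last h.last h'.hit h.hit q2 (by
      rintro z ((⟨t, h1, h2, rfl⟩ | ⟨t, h1, h2, rfl⟩) | rfl)
      · exact h'.out t h2
      · exact h.out t h2
      · exact oy)
    rw [Nat.odd_iff] at *
    omega

theorem Cfg.esc_all (hc : Cfg G a b R₀ u₁ v₁ I₁ u₂ v₂ I₂) (hy : y ∈ ZZ G a b)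
    (hy' : ¬ Hits G y R₀) (ea : Ext G a R₀ y) (eb : Ext G b R₀ y) :
    (G.Adj y u₁ ∧ G.Adj y u₂ ∧ ¬ G.Adj y v₁ ∧ ¬ G.Adj y v₂) ∨
    (G.Adj y v₁ ∧ G.Adj y v₂ ∧ ¬ G.Adj y u₁ ∧ ¬ G.Adj y u₂) := by
  obtain ⟨p, k, h⟩ := hc.exists_esc hy hy' ea
  obtain ⟨p', k', h'⟩ := hc.flip.exists_esc (by rwa [ZZ_comm]) hy' eb
  have a1 := hc.esc_odd hy h hc.link₁.1 hc.hits_u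
  have a2 := hc.esc_odd hy h hc.link₂.1 hc.swap.hits_u
  have b1 := hc.flip.esc_odd (by rwa [ZZ_comm]) h' hc.link₁.2.1 hc.hits_v
  have b2 := hc.flip.esc_odd (by rwa [ZZ_comm]) h' hc.link₂.2.1 hc.swap.hits_v
  have c1 : ¬ (G.Adj y u₁ ∧ G.Adj y v₁) := by
    rintro ⟨c1, c2⟩
    obtain ⟨n, hn, en, q⟩ := hc.link₁.path hc.ehf hc.ab hc.sub
    have h1 := NA_anti hc.ehf hc.ab hc.link₁.1 hc.link₁.2.1
    have := odd_of_center hc.ehf q c1 c2 h1.1 h1.2 ((h.zero ▸ h.out 0 h.pos).anti.mono subset_rfl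
      hc.link₁.2.2.1)
    exact Nat.not_even_iff_odd.2 this en
  have d := hc.not_odd_odd hy h h'
  simp only [G.adj_comm _ y] at a1 a2 b1 b2
  tauto

theorem Cfg.not_miss (hc : Cfg G a b R₀ u₁ v₁ I₁ u₂ v₂ I₂) {y₁ y₂ : V}
    (h1 : y₁ ∈ ZZ G a b) (h2 : y₂ ∈ ZZ G a b) (hne : y₁ ≠ y₂) (hna : ¬ G.Adj y₁ y₂)
    (r1 : ¬ Hits G y₁ R₀) (ea : Ext G a R₀ y₂) (eb : Ext G b R₀ y₂)
    (k1 : G.Adj y₁ u₁) (k2 : G.Adj y₁ u₂) (n1 : ¬ G.Adj y₁ v₁) (n2 : ¬ G.Adj y₁ v₂) : False := by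
  have hn : ∀ u ∈ NA G a b, G.Adj y₁ u → ¬ G.Adj y₂ u := by
    intro u hu e1 e2
    rcases common_nbr hc.ehf h1.2 h2.2 hne hna e1 e2 with h | h
    · exact hu.2.2 h
    · exact hu.2.1 h
  have o1 : Out G R₀ y₁ := ⟨fun h => (hc.sub h).2.2.1 h1.1, r1⟩
  by_cases r2 : Hits G y₂ R₀
  · have hx := ZZ_ne_NA (Or.inl hc.link₁.1) h2
    have nx := hn _ hc.link₁.1 k1
    obtain ⟨n, hn, q⟩ := hc.conn.path r2 hc.hits_u hx nx
    exact principle hc.ehf hc.sub q h2 h1 hne.symm (fun e => hna e.symm) hc.link₁.1 k1 nx o1.anti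
  · rcases hc.esc_all h2 r2 ea eb with h | h
    · exact hn _ hc.link₁.1 k1 h.1
    · have o2 : Out G R₀ y₂ := ⟨fun h => (hc.sub h).2.2.1 h2.1, r2⟩
      have z1 : ∀ {x}, x ∈ NA G a b ∪ NA G b a → y₁ ≠ x := fun hx => ZZ_ne_NA hx h1
      have z2 : ∀ {x}, x ∈ NA G a b ∪ NA G b a → y₂ ≠ x := fun hx => ZZ_ne_NA hx h2
      exact hc.two_links k1 k2 h.1 h.2.1 (o2.anti.mono subset_rfl hc.link₁.2.2.1)
        (o2.anti.mono subset_rfl hc.link₂.2.2.1)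
        (anti_singleton.2 ⟨z2 (Or.inl hc.link₁.1), h.2.2.1⟩)
        (anti_singleton.2 ⟨z2 (Or.inl hc.link₂.1), h.2.2.2⟩)
        (o1.anti.mono subset_rfl hc.link₁.2.2.1)
        (o1.anti.mono subset_rfl hc.link₂.2.2.1)
        (anti_singleton.2 ⟨z1 (Or.inr hc.link₁.2.1), n1⟩)
        (anti_singleton.2 ⟨z1 (Or.inr hc.link₂.2.1), n2⟩)
        (anti_singleton.2 ⟨hne, hna⟩)

theorem Cfg.hits_of_not_adj (hc : Cfg G a b R₀ u₁ v₁ I₁ u₂ v₂ I₂) {y₁ y₂ : V}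
    (h1 : y₁ ∈ ZZ G a b) (h2 : y₂ ∈ ZZ G a b) (hne : y₁ ≠ y₂) (hna : ¬ G.Adj y₁ y₂)
    (ea₁ : Ext G a R₀ y₁) (eb₁ : Ext G b R₀ y₁) (ea₂ : Ext G a R₀ y₂) (eb₂ : Ext G b R₀ y₂) :
    Hits G y₁ R₀ := by
  by_contra r1
  rcases hc.esc_all h1 r1 ea₁ eb₁ with ⟨k1, k2, n1, n2⟩ | ⟨k1, k2, n1, n2⟩
  · exact hc.not_miss h1 h2 hne hna r1 ea₂ eb₂ k1 k2 n1 n2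
  · rw [ZZ_comm] at h1 h2
    exact hc.flip.not_miss h1 h2 hne hna r1 eb₂ ea₂ k1 k2 n1 n2

/-- Common neighbours of `a, b` from which `R₀` can be reached are adjacent. -/
theorem Cfg.adj_of_ext (hc : Cfg G a b R₀ u₁ v₁ I₁ u₂ v₂ I₂) {y₁ y₂ : V}
    (h1 : y₁ ∈ ZZ G a b) (h2 : y₂ ∈ ZZ G a b) (hne : y₁ ≠ y₂)
    (ea₁ : Ext G a R₀ y₁) (eb₁ : Ext G b R₀ y₁) (ea₂ : Ext G a R₀ y₂) (eb₂ : Ext G b R₀ y₂) :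
    G.Adj y₁ y₂ := by
  by_contra hna
  exact hc.adj_of_hits h1 h2 hne hna
    (hc.hits_of_not_adj h1 h2 hne hna ea₁ eb₁ ea₂ eb₂)
    (hc.hits_of_not_adj h2 h1 hne.symm (fun e => hna e.symm) ea₂ eb₂ ea₁ eb₁)

end

theorem leaf_nbr_unique {J : SimpleGraph W} {l u v : W} (h : IsLeaf J l) (hu : J.Adj l u)
    (hv : J.Adj l v) : u = v := by
  obtain ⟨x, hx⟩ := Set.ncard_eq_one.1 h
  have h1 : u ∈ J.neighborSet l := hu
  have h2 : v ∈ J.neighborSet l := hv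
  rw [hx] at h1 h2
  exact h1.trans h2.symm

theorem leaf_exists_nbr {J : SimpleGraph W} {l : W} (h : IsLeaf J l) : ∃ u, J.Adj l u := by
  obtain ⟨x, hx⟩ := Set.ncard_eq_one.1 h
  have : x ∈ J.neighborSet l := by simp [hx]
  exact ⟨x, this⟩

theorem closed_eq_univ {J : SimpleGraph W} (hJ : J.Connected) {Q : W → Prop} {s : W} (hs : Q s)
    (hQ : ∀ x y, J.Adj x y → Q x → Q y) (x : W) : Q x := by
  obtain ⟨p⟩ := hJ.preconnected s x
  induction p with
  | nil => exact hs
  | cons h p ih => exact ih (hQ _ _ h hs)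

theorem nbr_of_leaf_not_leaf [Fintype W] {J : SimpleGraph W} (hJ : J.Connected)
    (hW : 3 ≤ Nat.card W) {l s : W} (hl : IsLeaf J l) (h : J.Adj l s) : ¬ IsLeaf J s := by
  intro hs
  have key : ∀ x, x = l ∨ x = s := by
    refine closed_eq_univ hJ (Q := fun x => x = l ∨ x = s) (s := l) (Or.inl rfl) ?_
    rintro x y hxy (rfl | rfl)
    · exact Or.inr (leaf_nbr_unique hl hxy h)
    · exact Or.inl (leaf_nbr_unique hs hxy h.symm)
  classical
  have : (Finset.univ : Finset W) ⊆ {l, s} := fun x _ => by simpa using key x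
  have := (Finset.card_le_card this).trans Finset.card_le_two
  rw [Finset.card_univ, ← Nat.card_eq_fintype_card] at this
  omega

theorem three_le_of_not_leaf [Fintype W] {J : SimpleGraph W} (hJ : J.Connected)
    (hW : 3 ≤ Nat.card W) (h2 : ∀ u : W, (J.neighborSet u).ncard ≠ 2) {u : W}
    (hu : ¬ IsLeaf J u) : 3 ≤ (J.neighborSet u).ncard := by
  have h1 : (J.neighborSet u).ncard ≠ 1 := hu
  have h3 := h2 u
  have h0 : (J.neighborSet u).ncard ≠ 0 := by
    intro h0
    rw [Set.ncard_eq_zero] at h0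
    have key : ∀ x, x = u := by
      refine closed_eq_univ hJ (Q := fun x => x = u) (s := u) rfl ?_
      rintro x y hxy rfl
      have : y ∈ J.neighborSet x := hxy
      rw [h0] at this
      exact this.elim
    have : Nat.card W ≤ 1 := by
      rw [Nat.card_eq_fintype_card]
      exact Fintype.card_le_one_iff.2 fun x y => (key x).trans (key y).symm
    omega
  omega

/-- In a tree without vertices of degree two, whose leaves are split into two classes such that
no vertex has two neighbours in the same class, two vertices have a neighbour in both classes. -/
theorem exists_two_branch [Fintype W] {J : SimpleGraph W} (hJ : J.IsTree) {α β : Set W}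
    (hαβ : α ∪ β = {u : W | IsLeaf J u}) (hdis : Disjoint α β)
    (h2 : ∀ u : W, (J.neighborSet u).ncard ≠ 2) (hW : 3 ≤ Nat.card W)
    (hα : ∀ u u₁ u₂ : W, u₁ ∈ α → u₂ ∈ α → J.Adj u u₁ → J.Adj u u₂ → u₁ = u₂)
    (hβ : ∀ u u₁ u₂ : W, u₁ ∈ β → u₂ ∈ β → J.Adj u u₁ → J.Adj u u₂ → u₁ = u₂) :
    ∃ s t, s ≠ t ∧ (∃ p ∈ α, ∃ q ∈ β, J.Adj p s ∧ J.Adj s q) ∧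
      ∃ p ∈ α, ∃ q ∈ β, J.Adj p t ∧ J.Adj t q := by
  classical
  have hlα : ∀ x ∈ α, IsLeaf J x := fun x hx => by
    have : x ∈ α ∪ β := Or.inl hx
    rwa [hαβ] at this
  have hlβ : ∀ x ∈ β, IsLeaf J x := fun x hx => by
    have : x ∈ α ∪ β := Or.inr hx
    rwa [hαβ] at this
  have hf : ∃ f : W → W, ∀ x, IsLeaf J x → J.Adj x (f x) := by
    refine ⟨fun x => if h : IsLeaf J x then (leaf_exists_nbr h).choose else x, fun x hx => ?_⟩
    simp only [hx, dif_pos]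
    exact (leaf_exists_nbr hx).choose_spec
  obtain ⟨f, hf⟩ := hf
  set A := (Finset.univ : Finset W).filter (· ∈ α) with hA
  set B := (Finset.univ : Finset W).filter (· ∈ β) with hB
  set L := (Finset.univ : Finset W).filter (IsLeaf J) with hL
  set N := (Finset.univ : Finset W).filter (fun x => ¬ IsLeaf J x) with hN
  have hLN : L.card + N.card = Fintype.card W := by
    rw [hL, hN, Finset.card_filter_add_card_filter_not, Finset.card_univ]
  have hAB : A.card + B.card = L.card := by
    rw [← Finset.card_union_of_disjoint]
    · congr 1
      ext x
      simp only [hA, hB, hL, Finset.mem_union, Finset.mem_filter, Finset.mem_univ, true_and]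
      rw [← Set.mem_union, hαβ]
      rfl
    · rw [Finset.disjoint_left]
      intro x hx hx'
      simp only [hA, hB, Finset.mem_filter, Finset.mem_univ, true_and] at hx hx'
      exact Set.disjoint_left.1 hdis hx hx'
  have hdeg : ∀ u, J.degree u = (J.neighborSet u).ncard := fun u => by
    rw [← J.card_neighborSet_eq_degree, Set.ncard_eq_toFinset_card', Set.toFinset_card]
  have hsum : L.card + 3 * N.card ≤ ∑ u, J.degree u := by
    rw [← Finset.sum_filter_add_sum_filter_not Finset.univ (IsLeaf J)]
    refine Nat.add_le_add ?_ ?_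
    · rw [Finset.card_eq_sum_ones]
      refine Finset.sum_le_sum fun x hx => ?_
      rw [hdeg]
      have : IsLeaf J x := by simpa [hL] using hx
      exact this.ge
    · rw [mul_comm, ← smul_eq_mul]
      refine Finset.card_nsmul_le_sum _ _ _ fun x hx => ?_
      rw [hdeg]
      exact three_le_of_not_leaf hJ.connected hW h2 (by simpa [hN] using hx)
  rw [J.sum_degrees_eq_twice_card_edges] at hsum
  have hedge := hJ.card_edgeFinset
  have hiA : (A.image f).card = A.card := by
    refine Finset.card_image_of_injOn fun x hx y hy hxy => ?_
    simp only [hA, Finset.coe_filter, Finset.mem_univ, true_and, Set.mem_ofPred_eq] at hx hy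
    exact hα (f x) x y hx hy (hf x (hlα x hx)).symm (hxy ▸ (hf y (hlα y hy)).symm)
  have hiB : (B.image f).card = B.card := by
    refine Finset.card_image_of_injOn fun x hx y hy hxy => ?_
    simp only [hB, Finset.coe_filter, Finset.mem_univ, true_and, Set.mem_ofPred_eq] at hx hy
    exact hβ (f x) x y hx hy (hf x (hlβ x hx)).symm (hxy ▸ (hf y (hlβ y hy)).symm)
  have hun : (A.image f ∪ B.image f).card ≤ N.card := by
    refine Finset.card_le_card fun x hx => ?_
    have : ∃ y, IsLeaf J y ∧ f y = x := by
      rcases Finset.mem_union.1 hx with h | h <;> obtain ⟨y, hy, rfl⟩ := Finset.mem_image.1 h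
      · exact ⟨y, hlα y (by simpa [hA] using hy), rfl⟩
      · exact ⟨y, hlβ y (by simpa [hB] using hy), rfl⟩
    obtain ⟨y, hy, rfl⟩ := this
    simpa [hN] using nbr_of_leaf_not_leaf hJ.connected hW hy (hf y hy)
  have hcard := Finset.card_union_add_card_inter (A.image f) (B.image f)
  have h1 : 1 < (A.image f ∩ B.image f).card := by
    omega
  obtain ⟨s, hs, t, ht, hst⟩ := Finset.one_lt_card.1 h1
  have hmem : ∀ s ∈ A.image f ∩ B.image f, ∃ p ∈ α, ∃ q ∈ β, J.Adj p s ∧ J.Adj s q := by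
    intro s hs
    obtain ⟨h3, h4⟩ := Finset.mem_inter.1 hs
    obtain ⟨p, hp, rfl⟩ := Finset.mem_image.1 h3
    obtain ⟨q, hq, hqp⟩ := Finset.mem_image.1 h4
    simp only [hA, hB, Finset.mem_filter, Finset.mem_univ, true_and] at hp hq
    exact ⟨p, hp, q, hq, hf p (hlα p hp), hqp ▸ (hf q (hlβ q hq)).symm⟩
  exact ⟨s, t, hst, hmem s hs, hmem t ht⟩

/-- An induced path, as a walk, gives an induced path, as a sequence. -/
theorem IP.of_walk {G : SimpleGraph V} {x y : V} {P : G.Walk x y} (hP : P.IsPath)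
    (hi : InducedWalk G P) : IP G P.getVert P.length := by
  intro i j hin hjn
  have inj : ∀ i j, i ≤ P.length → j ≤ P.length → P.getVert i = P.getVert j → i = j :=
    fun i j h1 h2 h => hP.getVert_injOn h1 h2 h
  refine ⟨inj i j hin hjn, fun h => ?_, ?_⟩
  · have := hi _ _ (P.getVert_mem_support i) (P.getVert_mem_support j) h
    rw [Walk.mk_mem_edges_iff_exists] at this
    obtain ⟨k, hk, h1⟩ := this
    rcases Sym2.eq_iff.1 h1 with h1 | h1
    · left
      have h2 := inj _ _ (by omega) hin h1.1
      have h3 := inj _ _ (by omega) hjn h1.2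
      omega
    · right
      have h2 := inj _ _ (by omega) hjn h1.1
      have h3 := inj _ _ (by omega) hin h1.2
      omega
  · rintro (rfl | rfl)
    · exact P.adj_getVert_succ (by omega)
    · exact (P.adj_getVert_succ (by omega)).symm

theorem IsStrip.exists_path {G : SimpleGraph V} {A B C : Set V} (h : IsStrip G A B C) {v : V}
    (hv : v ∈ A ∪ B ∪ C) : ∃ p n, IP G p n ∧ p 0 ∈ A ∧ p n ∈ B ∧
      (∀ i, 0 < i → i < n → p i ∈ C) ∧ (0 < n → p 0 ∉ B ∧ p n ∉ A) ∧ ∃ i ≤ n, p i = v := by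
  obtain ⟨x, y, P, ⟨hP, hx, hy, hC, hne, hi⟩, hvP⟩ := h.2.2.2.2 v hv
  have hip := IP.of_walk hP hi
  refine ⟨P.getVert, P.length, hip, by simpa, by simpa, fun i h0 hn => ?_, fun hn => ?_, ?_⟩
  · refine hC _ (P.getVert_mem_support i) ?_ ?_
    · have := hip.ne hn.le (Nat.zero_le _) h0.ne'
      simpa using this
    · have := hip.ne hn.le le_rfl hn.ne
      simpa using this
  · have := hip.ne (Nat.zero_le _) le_rfl hn.ne
    simp only [Walk.getVert_zero, Walk.getVert_length] at this ⊢
    exact hne this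
  · obtain ⟨i, h1, h2⟩ := Walk.mem_support_iff_exists_getVert.1 hvP
    exact ⟨i, h2, h1⟩

section StripFacts

variable {G : SimpleGraph V} {J : SimpleGraph W} {S : StripSystem G J} {a b : V} {α β : Set W}

theorem StripSystem.eq_or_eq (S : StripSystem G J) {u v w : W} {z : V} (h : J.Adj u v)
    (hz : z ∈ S.ME u v) (hw : z ∈ S.MV w) : w = u ∨ w = v := by
  have := S.mv_sub w hw
  simp only [Set.mem_iUnion] at this
  obtain ⟨x, hx, hzx⟩ := this
  by_contra hne
  push Not at hne
  have hs : s(u, v) ≠ s(w, x) := by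
    intro e
    rcases Sym2.eq_iff.1 e with e | e
    · exact hne.1 e.1.symm
    · exact hne.2 e.2.symm
  exact Set.disjoint_left.1 (S.me_disj u v w x h hx hs) hz hzx

theorem StripSystem.exists_edge (S : StripSystem G J) {u : W} {z : V} (hz : z ∈ S.MV u) :
    ∃ v, J.Adj u v ∧ z ∈ S.ME u v := by
  have := S.mv_sub u hz
  simp only [Set.mem_iUnion] at this
  obtain ⟨x, hx, hzx⟩ := this
  exact ⟨x, hx, hzx⟩

theorem mem_VM {z : V} : z ∈ VM S ↔ ∃ u v, J.Adj u v ∧ z ∈ S.ME u v := by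
  simp [VM]

theorem StripSystem.exists_path (S : StripSystem G J) {u v : W} (h : J.Adj u v) {z : V}
    (hz : z ∈ S.ME u v) : ∃ p n, IP G p n ∧ (∀ i ≤ n, p i ∈ S.ME u v) ∧
      (∀ i ≤ n, p i ∈ S.MV u ↔ i = 0) ∧ (∀ i ≤ n, p i ∈ S.MV v ↔ i = n) ∧ ∃ i ≤ n, p i = z := by
  have hz' : z ∈ (S.ME u v ∩ S.MV u) ∪ (S.ME u v ∩ S.MV v) ∪ (S.ME u v \ (S.MV u ∪ S.MV v)) := by
    by_cases h1 : z ∈ S.MV u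
    · exact Or.inl (Or.inl ⟨hz, h1⟩)
    · by_cases h2 : z ∈ S.MV v
      · exact Or.inl (Or.inr ⟨hz, h2⟩)
      · exact Or.inr ⟨hz, fun h => h.elim h1 h2⟩
  obtain ⟨p, n, hp, h0, hn, hi, he, hv⟩ := (S.strip u v h).exists_path hz'
  have hM : ∀ i ≤ n, p i ∈ S.ME u v := by
    intro i hin
    rcases Nat.eq_zero_or_pos i with rfl | h0i
    · exact h0.1
    · rcases hin.lt_or_eq with h | rfl
      · exact (hi i h0i h).1
      · exact hn.1
  refine ⟨p, n, hp, hM, fun i hin => ⟨fun hu => ?_, ?_⟩, fun i hin => ⟨fun hu => ?_, ?_⟩, hv⟩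
  · by_contra h0i
    rcases hin.lt_or_eq with h | rfl
    · exact (hi i (by omega) h).2 (Or.inl hu)
    · exact (he (by omega)).2 ⟨hM _ le_rfl, hu⟩
  · rintro rfl
    exact h0.2
  · by_contra hne
    rcases Nat.eq_zero_or_pos i with rfl | h0i
    · exact (he (by omega)).1 ⟨hM _ (Nat.zero_le _), hu⟩
    · exact (hi i h0i (by omega)).2 (Or.inr hu)
  · rintro rfl
    exact hn.2

theorem IsCrossEdge.flip (hX : IsCrossEdge S a b α β) : IsCrossEdge S b a β α := by
  obtain ⟨h1, h2, h3, h4, h5, h6, h7, h8, h9, h10⟩ := hX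
  exact ⟨h1.symm, by rw [Set.union_comm, h2], h3.symm, h4, h5, h7, h6,
    fun u v h => (h8 u v h).symm, h10, h9⟩

theorem IsCrossEdge.leaf_iff (hX : IsCrossEdge S a b α β) {l : W} :
    IsLeaf J l ↔ l ∈ α ∨ l ∈ β := by
  rw [← Set.mem_union, hX.2.1]
  rfl

variable [Fintype W]

theorem IsCrossEdge.mem_NA (hX : IsCrossEdge S a b α β) (hJ : J.Connected) {l : W} (hl : l ∈ α)
    {z : V} (hz : z ∈ S.MV l) : z ∈ NA G a b := by
  have hleaf : IsLeaf J l := hX.leaf_iff.2 (Or.inl hl)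
  obtain ⟨x, hx, hzx⟩ := S.exists_edge hz
  have hVM : z ∈ VM S := mem_VM.2 ⟨l, x, hx, hzx⟩
  obtain ⟨h1, h2, h3, h4, h5, h6, h7, h8, h9, h10⟩ := hX
  refine ⟨(h9 z hVM).2 ⟨l, hl, hz⟩, fun h => ?_, fun e => (h8 l x hx).2 (e ▸ hzx)⟩
  obtain ⟨k, hk, hzk⟩ := (h10 z hVM).1 h
  rcases S.eq_or_eq hx hzx hzk with rfl | rfl
  · exact Set.disjoint_left.1 h3 hl hk
  · have : k ∈ α ∪ β := Or.inr hk
    rw [h2] at this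
    exact nbr_of_leaf_not_leaf hJ h5 hleaf hx this

omit [Fintype W] in
theorem IsCrossEdge.mem_RR (hX : IsCrossEdge S a b α β) {u v : W} (h : J.Adj u v) {z : V}
    (hz : z ∈ S.ME u v) (hu : IsLeaf J u → z ∉ S.MV u) (hv : IsLeaf J v → z ∉ S.MV v) :
    z ∈ RR G a b := by
  have hl := fun l => hX.leaf_iff (l := l)
  have hVM : z ∈ VM S := mem_VM.2 ⟨u, v, h, hz⟩
  obtain ⟨h1, h2, h3, h4, h5, h6, h7, h8, h9, h10⟩ := hX
  have key : ∀ l, IsLeaf J l → z ∉ S.MV l := by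
    intro l hll hzl
    rcases S.eq_or_eq h hz hzl with rfl | rfl
    · exact hu hll hzl
    · exact hv hll hzl
  refine ⟨fun e => (h8 u v h).1 (e ▸ hz), fun e => (h8 u v h).2 (e ▸ hz), fun e => ?_, fun e => ?_⟩
  · obtain ⟨l, hlα, hzl⟩ := (h9 z hVM).1 e
    exact key l ((hl l).2 (Or.inl hlα)) hzl
  · obtain ⟨l, hlα, hzl⟩ := (h10 z hVM).1 e
    exact key l ((hl l).2 (Or.inr hlα)) hzl

theorem IsCrossEdge.exists_good (hX : IsCrossEdge S a b α β) (hJ : J.Connected)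
    (hG : EvenHoleFree G) {v : W} (hv : ¬ IsLeaf J v) (u : W) :
    ∃ g, J.Adj v g ∧ g ≠ u ∧ ∃ w ∈ S.MV v, w ∈ S.ME v g ∧ w ∈ RR G a b := by
  have h3 := three_le_of_not_leaf hJ hX.2.2.2.2.1 hX.2.2.2.1 hv
  have h4 : 1 < (J.neighborSet v \ {u}).ncard := by
    have := Set.pred_ncard_le_ncard_sdiff_singleton (J.neighborSet v) u
    omega
  obtain ⟨g₁, ⟨hg₁, hu₁⟩, g₂, ⟨hg₂, hu₂⟩, hne⟩ := (Set.one_lt_ncard (Set.toFinite _)).1 h4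
  have hg₁ : J.Adj v g₁ := hg₁
  have hg₂ : J.Adj v g₂ := hg₂
  obtain ⟨w₁, hw₁, hw₁'⟩ := (S.strip v g₁ hg₁).1
  obtain ⟨w₂, hw₂, hw₂'⟩ := (S.strip v g₂ hg₂).1
  by_cases hr₁ : w₁ ∈ RR G a b
  · exact ⟨g₁, hg₁, hu₁, w₁, hw₁', hw₁, hr₁⟩
  by_cases hr₂ : w₂ ∈ RR G a b
  · exact ⟨g₂, hg₂, hu₂, w₂, hw₂', hw₂, hr₂⟩
  exfalso
  have bad : ∀ {g w}, J.Adj v g → w ∈ S.ME v g → w ∉ RR G a b →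
      (g ∈ α ∧ w ∈ NA G a b) ∨ (g ∈ β ∧ w ∈ NA G b a) := by
    intro g w hg hw hr
    by_contra hc
    refine hr (hX.mem_RR hg hw (fun h => absurd h hv) fun h hwg => hc ?_)
    rcases hX.leaf_iff.1 h with h | h
    · exact Or.inl ⟨h, hX.mem_NA hJ h hwg⟩
    · exact Or.inr ⟨h, hX.flip.mem_NA hJ h hwg⟩
  have hadj : G.Adj w₁ w₂ := (S.near v g₁ g₂ hg₁ hg₂ hne w₁ hw₁ w₂ hw₂).2 ⟨hw₁', hw₂'⟩
  rcases bad hg₁ hw₁ hr₁ with ⟨h1, h2⟩ | ⟨h1, h2⟩ <;>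
    rcases bad hg₂ hw₂ hr₂ with ⟨h3, h4⟩ | ⟨h3, h4⟩
  · exact hne (hX.2.2.2.2.2.1 v _ _ h1 h3 hg₁ hg₂)
  · exact (NA_anti hG hX.1 h2 h4).2 hadj
  · exact (NA_anti hG hX.1 h4 h2).2 hadj.symm
  · exact hne (hX.2.2.2.2.2.2.1 v _ _ h1 h3 hg₁ hg₂)

/-- `z` and `w` are joined by a connected subset of `R`. -/
def Lk (G : SimpleGraph V) (R : Set V) (z w : V) : Prop := ∃ K ⊆ R, Conn G K ∧ z ∈ K ∧ w ∈ K

omit [Fintype W]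

theorem Lk.symm {R : Set V} {z w : V} (h : Lk G R z w) : Lk G R w z := by
  obtain ⟨K, h1, h2, h3, h4⟩ := h
  exact ⟨K, h1, h2, h4, h3⟩

theorem Lk.trans {R : Set V} {x y z : V} (h : Lk G R x y) (h' : Lk G R y z) : Lk G R x z := by
  obtain ⟨K, h1, h2, h3, h4⟩ := h
  obtain ⟨K', h1', h2', h3', h4'⟩ := h'
  exact ⟨K ∪ K', Set.union_subset h1 h1', h2.union h2' h4 h3' (Or.inl rfl), Or.inl h3, Or.inr h4'⟩

theorem Lk.of_adj {R : Set V} {x y : V} (hx : x ∈ R) (hy : y ∈ R) (h : G.Adj x y) :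
    Lk G R x y :=
  ⟨{x} ∪ {y}, Set.union_subset (by simpa using hx) (by simpa using hy),
    (Conn.singleton G x).union (Conn.singleton G y) rfl rfl (Or.inr h), Or.inl rfl, Or.inr rfl⟩

variable [Fintype W]

theorem IsCrossEdge.lk_MV (hX : IsCrossEdge S a b α β) (hJ : J.Connected)
    (hG : EvenHoleFree G) {v : W} (hv : ¬ IsLeaf J v) {z w : V} (hz : z ∈ S.MV v)
    (hzR : z ∈ RR G a b) (hw : w ∈ S.MV v) (hwR : w ∈ RR G a b) : Lk G (RR G a b) z w := by
  obtain ⟨x, hx, hzx⟩ := S.exists_edge hz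
  obtain ⟨y, hy, hwy⟩ := S.exists_edge hw
  by_cases hxy : x = y
  · subst hxy
    obtain ⟨g, hg, hgx, w', h1, h2, h3⟩ := hX.exists_good hJ hG hv x
    exact (Lk.of_adj hzR h3 ((S.near v x g hx hg hgx.symm z hzx w' h2).2 ⟨hz, h1⟩)).trans
      (Lk.of_adj h3 hwR ((S.near v g x hg hx hgx w' h2 w hwy).2 ⟨h1, hw⟩))
  · exact Lk.of_adj hzR hwR ((S.near v x y hx hy hxy z hzx w hwy).2 ⟨hz, hw⟩)

omit [Fintype W] in
theorem IsCrossEdge.lk_ME (hX : IsCrossEdge S a b α β) {u v : W} (h : J.Adj u v)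
    (hv : ¬ IsLeaf J v) {z : V} (hz : z ∈ S.ME u v) (hzR : z ∈ RR G a b) :
    ∃ w ∈ S.MV v, w ∈ RR G a b ∧ Lk G (RR G a b) z w := by
  obtain ⟨p, n, hp, hM, hu, hvn, i, hin, rfl⟩ := S.exists_path h hz
  have hR : ∀ t, i ≤ t → t ≤ n → p t ∈ RR G a b := by
    intro t h1 h2
    rcases Nat.eq_zero_or_pos t with rfl | h0
    · obtain rfl : i = 0 := by omega
      exact hzR
    · exact hX.mem_RR h (hM t h2) (fun _ => by rw [hu t h2]; omega) (fun h => absurd h hv)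
  refine ⟨p n, (hvn n le_rfl).2 rfl, hR n hin le_rfl, {v | ∃ t, i ≤ t ∧ t ≤ n ∧ v = p t}, ?_,
    Conn.segment (fun t _ ht => hp.adj (by omega)) hin, ⟨i, le_rfl, hin, rfl⟩,
    ⟨n, hin, le_rfl, rfl⟩⟩
  rintro _ ⟨t, h1, h2, rfl⟩
  exact hR t h1 h2

theorem IsCrossEdge.exists_edge (hX : IsCrossEdge S a b α β) (hJ : J.Connected) {z : V}
    (hz : z ∈ VM S) : ∃ u v, J.Adj u v ∧ ¬ IsLeaf J v ∧ z ∈ S.ME u v := by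
  obtain ⟨u, v, h, hz⟩ := mem_VM.1 hz
  by_cases hv : IsLeaf J v
  · exact ⟨v, u, h.symm, nbr_of_leaf_not_leaf hJ hX.2.2.2.2.1 hv h.symm, S.me_symm u v ▸ hz⟩
  · exact ⟨u, v, h, hv, hz⟩

theorem IsCrossEdge.lk_VM (hX : IsCrossEdge S a b α β) (hJ : J.Connected)
    (hG : EvenHoleFree G) {s : W} (hs : ¬ IsLeaf J s) {z w : V} (hz : z ∈ S.MV s)
    (hzR : z ∈ RR G a b) (hw : w ∈ VM S) (hwR : w ∈ RR G a b) : Lk G (RR G a b) z w := by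
  let Q : W → Prop := fun x =>
    (¬ IsLeaf J x → ∀ w ∈ S.MV x, w ∈ RR G a b → Lk G (RR G a b) z w) ∧
    (IsLeaf J x → ∀ t, J.Adj x t → ∀ w ∈ S.MV t, w ∈ RR G a b → Lk G (RR G a b) z w)
  have hQ : ∀ x, Q x := by
    refine closed_eq_univ hJ (s := s) ?_ ?_
    · exact ⟨fun _ w hw hwR => hX.lk_MV hJ hG hs hz hzR hw hwR, fun h => absurd h hs⟩
    · rintro x y hxy ⟨h1, h2⟩
      by_cases hx : IsLeaf J x
      · have hy := nbr_of_leaf_not_leaf hJ hX.2.2.2.2.1 hx hxy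
        exact ⟨fun _ => h2 hx y hxy, fun h => absurd h hy⟩
      · by_cases hy : IsLeaf J y
        · refine ⟨fun h => absurd hy h, fun _ t ht => ?_⟩
          obtain rfl := leaf_nbr_unique hy ht hxy.symm
          exact h1 hx
        · refine ⟨fun _ w hw hwR => ?_, fun h => absurd h hy⟩
          obtain ⟨p, hp, hp'⟩ := (S.strip x y hxy).1
          have hpR := hX.mem_RR hxy hp (fun h => absurd h hx) (fun h => absurd h hy)
          obtain ⟨q, hq, hqR, hpq⟩ := hX.lk_ME hxy hy hp hpR
          exact ((h1 hx p hp' hpR).trans hpq).trans (hX.lk_MV hJ hG hy hq hqR hw hwR)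
  obtain ⟨u, v, huv, hv, hwuv⟩ := hX.exists_edge hJ hw
  obtain ⟨q, hq, hqR, hwq⟩ := hX.lk_ME huv hv hwuv hwR
  exact ((hQ v).1 hv q hq hqR).trans hwq.symm

theorem IsCrossEdge.hits_VM (hX : IsCrossEdge S a b α β) (hJ : J.Connected)
    (hG : EvenHoleFree G) {z : V} (hz : z ∈ VM S) : Hits G z (VM S ∩ RR G a b) := by
  obtain ⟨u, v, h, hv, hz⟩ := hX.exists_edge hJ hz
  obtain ⟨p, n, hp, hM, hu, hvn, i, hin, rfl⟩ := S.exists_path h hz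
  rcases hin.lt_or_eq with hlt | rfl
  · refine ⟨p (i + 1), ⟨mem_VM.2 ⟨u, v, h, hM _ hlt⟩, ?_⟩, hp.adj hlt⟩
    exact hX.mem_RR h (hM _ hlt) (fun _ => by rw [hu _ hlt]; omega) (fun h => absurd h hv)
  · obtain ⟨g, hg, hgu, w, h1, h2, h3⟩ := hX.exists_good hJ hG hv u
    refine ⟨w, ⟨mem_VM.2 ⟨v, g, hg, h2⟩, h3⟩, ?_⟩
    exact (S.near v u g h.symm hg hgu.symm _ (S.me_symm u v ▸ hz) w h2).2
      ⟨(hvn i le_rfl).2 rfl, h1⟩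

theorem IsCrossEdge.exists_link (hX : IsCrossEdge S a b α β) (hJ : J.Connected) {l s r : W}
    (hl : l ∈ α) (hr : r ∈ β) (hls : J.Adj l s) (hsr : J.Adj s r) {R₀ : Set V}
    (hR₀ : VM S ∩ RR G a b ⊆ R₀) :
    ∃ u v I, Link G a b R₀ u v I ∧ PV u v I ⊆ S.ME l s ∪ S.ME s r := by
  have hlr : l ≠ r := by
    rintro rfl
    exact Set.disjoint_left.1 hX.2.2.1 hl hr
  have hs : ¬ IsLeaf J s :=
    nbr_of_leaf_not_leaf hJ hX.2.2.2.2.1 (hX.leaf_iff.2 (Or.inl hl)) hls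
  obtain ⟨z, hz, -⟩ := (S.strip l s hls).1
  obtain ⟨p, n, hp, hpM, hpl, hps, -⟩ := S.exists_path hls hz
  obtain ⟨w, hw, -⟩ := (S.strip s r hsr).1
  obtain ⟨q, m, hq, hqM, hqs, hqr, -⟩ := S.exists_path hsr hw
  have hpM' : ∀ i ≤ n, p i ∈ S.ME s l := fun i hi => S.me_symm l s ▸ hpM i hi
  have hnear : ∀ i ≤ n, ∀ j ≤ m, (G.Adj (p i) (q j) ↔ i = n ∧ j = 0) := by
    intro i hi j hj
    rw [S.near s l r hls.symm hsr hlr _ (hpM' i hi) _ (hqM j hj), hps i hi, hqs j hj]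
  have hdisj : Disjoint (S.ME l s) (S.ME s r) := by
    refine S.me_disj l s s r hls hsr fun e => ?_
    rcases Sym2.eq_iff.1 e with e | e
    · exact hls.ne e.1
    · exact hlr e.1
  have hj := hp.join hq ((hnear n le_rfl 0 (Nat.zero_le _)).2 ⟨rfl, rfl⟩) fun i hi j hj =>
    ⟨fun e => Set.disjoint_left.1 hdisj (hpM i hi) (e ▸ hqM j hj), (hnear i hi j hj).1⟩
  set c : ℕ → V := fun t => if t ≤ n then p t else q (t - n - 1) with hc
  have hcM : ∀ i ≤ n + m + 1, c i ∈ S.ME l s ∪ S.ME s r := by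
    intro i hi
    by_cases hin : i ≤ n
    · simp only [hc, hin, if_true]
      exact Or.inl (hpM i hin)
    · simp only [hc, hin, if_false]
      exact Or.inr (hqM _ (by omega))
  have hc0 : c 0 ∈ S.MV l := by
    simp only [hc, Nat.zero_le, if_true]
    exact (hpl 0 (Nat.zero_le _)).2 rfl
  have hcn : c (n + m + 1) ∈ S.MV r := by
    simp only [hc, show ¬ n + m + 1 ≤ n by omega, if_false]
    exact (hqr _ (by omega)).2 (by omega)
  refine ⟨c 0, c (n + m + 1), {v | ∃ i, 0 < i ∧ i < n + m + 1 ∧ v = c i},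
    ⟨hX.mem_NA hJ hl hc0, hX.flip.mem_NA hJ hr hcn, ?_, c, _, hj, rfl, rfl, fun w => Iff.rfl⟩, ?_⟩
  · rintro _ ⟨i, h0, hi, rfl⟩
    refine hR₀ ?_
    by_cases hin : i ≤ n
    · simp only [hc, hin, if_true]
      exact ⟨mem_VM.2 ⟨l, s, hls, hpM i hin⟩, hX.mem_RR hls (hpM i hin)
        (fun _ => by rw [hpl i hin]; omega) (fun h => absurd h hs)⟩
    · simp only [hc, hin, if_false]
      have hle : i - n - 1 ≤ m := by omega
      exact ⟨mem_VM.2 ⟨s, r, hsr, hqM _ hle⟩, hX.mem_RR hsr (hqM _ hle)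
        (fun h => absurd h hs) (fun _ => by rw [hqr _ hle]; omega)⟩
  · rintro w (rfl | rfl | ⟨i, h0, hi, rfl⟩)
    · exact hcM _ (by omega)
    · exact hcM _ le_rfl
    · exact hcM _ (by omega)

omit [Fintype W] in
theorem StripSystem.anti (S : StripSystem G J) {u v w x : W} (h : J.Adj u v) (h' : J.Adj w x)
    (h1 : u ≠ w) (h2 : u ≠ x) (h3 : v ≠ w) (h4 : v ≠ x) : Anti G (S.ME u v) (S.ME w x) := by
  intro p hp q hq
  refine ⟨?_, S.far u v w x h h' h1 h2 h3 h4 p hp q hq⟩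
  rintro rfl
  refine Set.disjoint_left.1 (S.me_disj u v w x h h' fun e => ?_) hp hq
  rcases Sym2.eq_iff.1 e with e | e
  · exact h1 e.1
  · exact h2 e.1

omit [Fintype W] in
theorem ExternalFrom.ext {R₀ : Set V} {y : V}
    (hR₀ : ∀ z ∈ VM S, Hits G z R₀) (h : ExternalFrom G (VM S) a y) : Ext G a R₀ y := by
  obtain ⟨z, P, hP, hz, hza, hPa⟩ := h
  have hne : ∀ i, 0 < i → i ≤ P.length → P.getVert i ≠ y := by
    intro i h0 hi e
    have := hP.getVert_injOn (x₁ := i) (x₂ := 0) hi (Nat.zero_le _) (by simpa using e)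
    omega
  refine ⟨P.length, P.getVert, by simp, fun i hi => P.adj_getVert_succ hi, fun i h0 hi => ?_,
    by simpa using hR₀ z hz⟩
  refine ⟨fun e => ?_, fun e => hne i h0 hi (hPa _ (P.getVert_mem_support i) e)⟩
  rcases hi.lt_or_eq with hlt | rfl
  · have h1 := P.adj_getVert_succ hlt
    rw [e] at h1
    exact hne (i + 1) (by omega) (by omega) (hPa _ (P.getVert_mem_support _) h1)
  · rw [Walk.getVert_length] at e
    exact hza (Or.inl e)

theorem IsCrossEdge.exists_cfg (hX : IsCrossEdge S a b α β) (hJ : J.IsTree)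
    (hG : EvenHoleFree G) : ∃ R₀ u₁ v₁ I₁ u₂ v₂ I₂, Cfg G a b R₀ u₁ v₁ I₁ u₂ v₂ I₂ ∧
      VM S ∩ RR G a b ⊆ R₀ := by
  have hc := hJ.connected
  obtain ⟨s, t, hst, ⟨l, hl, r, hr, hls, hsr⟩, ⟨l', hl', r', hr', hls', hsr'⟩⟩ :=
    exists_two_branch hJ hX.2.1 hX.2.2.1 hX.2.2.2.1 hX.2.2.2.2.1 hX.2.2.2.2.2.1
      hX.2.2.2.2.2.2.1
  have Ll : IsLeaf J l := hX.leaf_iff.2 (Or.inl hl)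
  have Lr : IsLeaf J r := hX.leaf_iff.2 (Or.inr hr)
  have Ll' : IsLeaf J l' := hX.leaf_iff.2 (Or.inl hl')
  have Lr' : IsLeaf J r' := hX.leaf_iff.2 (Or.inr hr')
  have hs : ¬ IsLeaf J s := nbr_of_leaf_not_leaf hc hX.2.2.2.2.1 Ll hls
  have ht : ¬ IsLeaf J t := nbr_of_leaf_not_leaf hc hX.2.2.2.2.1 Ll' hls'
  have ne : ∀ {x y}, IsLeaf J x → ¬ IsLeaf J y → x ≠ y := by
    rintro x y hx hy rfl
    exact hy hx
  have neαβ : ∀ {x y}, x ∈ α → y ∈ β → x ≠ y := by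
    rintro x y hx hy rfl
    exact Set.disjoint_left.1 hX.2.2.1 hx hy
  have hll : l ≠ l' := by
    rintro rfl
    exact hst (leaf_nbr_unique Ll hls hls')
  have hrr : r ≠ r' := by
    rintro rfl
    exact hst (leaf_nbr_unique Lr hsr.symm hsr'.symm)
  obtain ⟨g, -, -, z, hz, hzg, hzR⟩ := hX.exists_good hc hG hs s
  obtain ⟨R₀, hR, hzR₀, hconn, hcl⟩ := exists_component G (RR G a b) z hzR
  have hsub : VM S ∩ RR G a b ⊆ R₀ := by
    rintro w ⟨hw, hwR⟩
    obtain ⟨K, h1, h2, h3, h4⟩ := hX.lk_VM hc hG hs hz hzR hw hwR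
    exact h2.subset_of_component hcl h1 h3 hzR₀ h4
  obtain ⟨u₁, v₁, I₁, k₁, e₁⟩ := hX.exists_link hc hl hr hls hsr hsub
  obtain ⟨u₂, v₂, I₂, k₂, e₂⟩ := hX.exists_link hc hl' hr' hls' hsr' hsub
  refine ⟨R₀, u₁, v₁, I₁, u₂, v₂, I₂, ⟨hG, hX.1, hR, hconn, hcl, k₁, k₂, ?_⟩, hsub⟩
  refine Anti.mono ?_ e₁ e₂
  rw [anti_union_left, anti_union_right, anti_union_right]
  exact ⟨⟨S.anti hls hls' hll (ne Ll ht) (ne Ll' hs).symm hst,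
      S.anti hls hsr' (ne Ll ht) (neαβ hl hr') hst (ne Lr' hs).symm⟩,
    S.anti hsr hls' (ne Ll' hs).symm hst (neαβ hl' hr).symm (ne Lr ht),
    S.anti hsr hsr' hst (ne Lr' hs).symm (ne Lr ht) hrr⟩

theorem IsCrossEdge.clique_major (hX : IsCrossEdge S a b α β) (hJ : J.IsTree)
    (hG : EvenHoleFree G) : G.IsClique {y | MajorVertex S a b y} := by
  obtain ⟨R₀, u₁, v₁, I₁, u₂, v₂, I₂, hc, hR₀⟩ := hX.exists_cfg hJ hG
  have hit : ∀ z ∈ VM S, Hits G z R₀ := fun z hz => (hX.hits_VM hJ.connected hG hz).mono hR₀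
  rintro y₁ ⟨h1, h2, h3, h4⟩ y₂ ⟨h1', h2', h3', h4'⟩ hne
  exact hc.adj_of_ext ⟨h1, h2⟩ ⟨h1', h2'⟩ hne (h3.ext hit) (h4.ext hit) (h3'.ext hit)
    (h4'.ext hit)

end StripFacts

theorem statement_11 {V W : Type*} [Fintype V] [Fintype W] (G : SimpleGraph V)
    (hG : EvenHoleFree G) (J : SimpleGraph W) (hJ : J.IsTree)
    (S : StripSystem G J) (a b : V) (α β : Set W)
    (hopt : OptimalFor S a b α β) :
    G.IsClique {y : V | MajorVertex S a b y} :=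
  hopt.2.2.1.clique_major hJ hG

end EHF
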